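/- arXiv:1009.5298 — 2 statements merged into one kernel-verified Lean document; each statement's English description precedes it below -/
import Mathlib

section
/- Let (A_1,m_1) and (A_2,m_2) be multiarrangements in ℂ^ℓ. If Ω^1(A_1,m_1) and Ω^1(A_2,m_2) are isomorphic as graded S-modules, then Ω^p(A_1,m_1) and Ω^p(A_2,m_2) are isomorphic as graded S-modules for every p ≥ 0. -/
open MvPolynomial

noncomputable section

attribute [local instance] Classical.propDecidable

abbrev Spoly (ℓ : ℕ) := MvPolynomial (Fin ℓ) ℂ

abbrev Frac (ℓ : ℕ) := FractionRing (Spoly ℓ)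

variable {ℓ : ℕ}

def IsArrangement (A : Finset (Spoly ℓ)) : Prop :=
  (∀ α ∈ A, α.IsHomogeneous 1 ∧ α ≠ 0) ∧
    ∀ α ∈ A, ∀ β ∈ A, α ≠ β → ∀ c : ℂ, α ≠ c • β

def Qpoly (A : Finset (Spoly ℓ)) (m : Spoly ℓ → ℕ) : Spoly ℓ :=
  ∏ α ∈ A, α ^ m α

/-- Index set for `p`-forms: `p`-element subsets of the coordinates. -/
abbrev PIdx (ℓ p : ℕ) := {s : Finset (Fin ℓ) // s.card = p}

/-- Rational differential `p`-forms on `ℂ^ℓ`: coefficient functions (with respect to the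
standard basis `dx_I`) with values in the field of rational functions. -/
abbrev RForm (ℓ p : ℕ) := PIdx ℓ p → Frac ℓ

/-- The coefficient of `dα ∧ ψ` on `dx_J`, `|J| = p+1`, for a polynomial `p`-form `ψ`. -/
def wedgeCoeff {p : ℕ} (α : Spoly ℓ) (ψ : PIdx ℓ p → Spoly ℓ) (J : PIdx ℓ (p+1)) :
    Spoly ℓ :=
  ∑ j ∈ J.1.attach,
    (-1 : Spoly ℓ) ^ ((J.1.filter (fun i => i < j.1)).card) * pderiv j.1 α *
      ψ ⟨J.1.erase j.1, by rw [Finset.card_erase_of_mem j.2, J.2]; rfl⟩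

lemma wedgeCoeff_add {p : ℕ} (α : Spoly ℓ) (ψ₁ ψ₂ : PIdx ℓ p → Spoly ℓ)
    (J : PIdx ℓ (p+1)) :
    wedgeCoeff α (ψ₁ + ψ₂) J = wedgeCoeff α ψ₁ J + wedgeCoeff α ψ₂ J := by
  unfold wedgeCoeff
  rw [← Finset.sum_add_distrib]
  refine Finset.sum_congr rfl fun j _ => ?_
  simp only [Pi.add_apply]
  ring

lemma wedgeCoeff_smul {p : ℕ} (α : Spoly ℓ) (c : Spoly ℓ) (ψ : PIdx ℓ p → Spoly ℓ)
    (J : PIdx ℓ (p+1)) :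
    wedgeCoeff α (c • ψ) J = c * wedgeCoeff α ψ J := by
  unfold wedgeCoeff
  rw [Finset.mul_sum]
  refine Finset.sum_congr rfl fun j _ => ?_
  simp only [Pi.smul_apply, smul_eq_mul]
  ring

/-- The module `Ω^p(𝒜, m)` of logarithmic `p`-forms of the multiarrangement `(𝒜, m)`:
rational forms `ω` with `Q(𝒜,m)·ω` polynomial (say `= ψ`) such that for each hyperplane
`{α = 0}` of `𝒜`, `dα ∧ ω` has no pole along it, i.e. `α^{m(α)}` divides every
coefficient of `dα ∧ ψ`. -/
def OmegaMod (A : Finset (Spoly ℓ)) (m : Spoly ℓ → ℕ) (p : ℕ) :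
    Submodule (Spoly ℓ) (RForm ℓ p) where
  carrier := {ω | ∃ ψ : PIdx ℓ p → Spoly ℓ,
    (∀ I, algebraMap (Spoly ℓ) (Frac ℓ) (Qpoly A m) * ω I =
      algebraMap (Spoly ℓ) (Frac ℓ) (ψ I)) ∧
    ∀ α ∈ A, ∀ J : PIdx ℓ (p+1), α ^ m α ∣ wedgeCoeff α ψ J}
  add_mem' := by
    rintro ω₁ ω₂ ⟨ψ₁, h₁, d₁⟩ ⟨ψ₂, h₂, d₂⟩
    refine ⟨ψ₁ + ψ₂, fun I => ?_, fun α hα J => ?_⟩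
    · rw [Pi.add_apply, Pi.add_apply, mul_add, h₁ I, h₂ I, ← RingHom.map_add]
    · rw [wedgeCoeff_add]
      exact dvd_add (d₁ α hα J) (d₂ α hα J)
  zero_mem' := by
    refine ⟨0, fun I => by simp, fun α hα J => ?_⟩
    have : wedgeCoeff α (0 : PIdx ℓ p → Spoly ℓ) J = 0 := by
      unfold wedgeCoeff; simp
    simp [this]
  smul_mem' := by
    rintro c ω ⟨ψ, h, d⟩
    refine ⟨c • ψ, fun I => ?_, fun α hα J => ?_⟩
    · have hc : (c • ω) I = algebraMap (Spoly ℓ) (Frac ℓ) c * ω I := by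
        rw [Pi.smul_apply]; exact Algebra.smul_def c (ω I)
      rw [hc, mul_left_comm, h I]
      simp [smul_eq_mul, map_mul]
    · rw [wedgeCoeff_smul]
      exact (d α hα J).mul_left c
/-- A rational function is homogeneous of degree `d ∈ ℤ` if it is a quotient of
homogeneous polynomials whose degrees differ by `d`. -/
def IsHomogFrac (f : Frac ℓ) (d : ℤ) : Prop :=
  ∃ (g h : Spoly ℓ) (a b : ℕ), h ≠ 0 ∧ g.IsHomogeneous a ∧ h.IsHomogeneous b ∧
    d = (a : ℤ) - (b : ℤ) ∧ algebraMap (Spoly ℓ) (Frac ℓ) h * f =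
      algebraMap (Spoly ℓ) (Frac ℓ) g

/-- A rational form is homogeneous of degree `d` if all its coefficients are. -/
def IsHomogForm {p : ℕ} (ω : RForm ℓ p) (d : ℤ) : Prop :=
  ∀ I, IsHomogFrac (ω I) d

/-- Two submodules of rational `p`-forms are isomorphic as graded `S`-modules. -/
def GradedIsoForms {p : ℕ} (M N : Submodule (Spoly ℓ) (RForm ℓ p)) : Prop :=
  ∃ e : M ≃ₗ[Spoly ℓ] N,
    ∀ (ω : M) (d : ℤ), IsHomogForm (ω : RForm ℓ p) d ↔ IsHomogForm ((e ω : RForm ℓ p)) d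


abbrev VV (ℓ : ℕ) := Fin ℓ → Frac ℓ

abbrev toK (s : Spoly ℓ) : Frac ℓ := algebraMap (Spoly ℓ) (Frac ℓ) s

def RS (ℓ : ℕ) : Subring (Frac ℓ) := (algebraMap (Spoly ℓ) (Frac ℓ)).range

lemma toK_mem (s : Spoly ℓ) : toK s ∈ RS ℓ := ⟨s, rfl⟩

lemma toK_inj {s t : Spoly ℓ} (h : toK s = toK t) : s = t :=
  IsFractionRing.injective (Spoly ℓ) (Frac ℓ) h

lemma toK_ne {s : Spoly ℓ} (h : s ≠ 0) : toK s ≠ 0 := by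
  intro h0
  exact h (toK_inj (by rw [h0]; simp [toK]))

lemma local_global (f : Frac ℓ)
    (h : ∀ π : Spoly ℓ, Prime π → ∃ c, ¬ π ∣ c ∧ toK c * f ∈ RS ℓ) : f ∈ RS ℓ := by
  obtain ⟨n, d, hr, rfl⟩ := IsFractionRing.exists_reduced_fraction (Spoly ℓ) f
  by_cases hd : IsUnit (d : Spoly ℓ)
  · obtain ⟨u, hu⟩ := hd
    refine ⟨n * (↑u⁻¹ : Spoly ℓ), ?_⟩
    rw [IsLocalization.eq_mk'_iff_mul_eq, ← map_mul, ← hu, mul_assoc]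
    simp
  · have hd0 : (d : Spoly ℓ) ≠ 0 := nonZeroDivisors.ne_zero d.2
    obtain ⟨π, hπ, hπd⟩ := WfDvdMonoid.exists_irreducible_factor hd hd0
    obtain ⟨c, hc, s, hs⟩ := h π hπ.prime
    exfalso
    have : c * n = s * d := by
      apply toK_inj
      have h2 := IsLocalization.mk'_spec (Frac ℓ) n d
      simp only [toK, map_mul] at *
      rw [hs, mul_assoc, h2]
    have h3 : π ∣ c * n := this ▸ hπd.mul_left s
    have h4 : π ∣ n := (hπ.prime.dvd_or_dvd h3).resolve_left hc
    exact hπ.not_isUnit (hr h4 hπd)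

def Qp (A : Finset (Spoly ℓ)) (m : Spoly ℓ → ℕ) (α : Spoly ℓ) : Spoly ℓ :=
  ∏ β ∈ A.erase α, β ^ m β

lemma Q_eq {A : Finset (Spoly ℓ)} (m : Spoly ℓ → ℕ) {α : Spoly ℓ} (h : α ∈ A) :
    Qpoly A m = α ^ m α * Qp A m α := by
  unfold Qpoly Qp
  rw [Finset.mul_prod_erase A (fun β => β ^ m β) h]

lemma lin_coeffs {α : Spoly ℓ} (h : α.IsHomogeneous 1) (h0 : α ≠ 0) :
    ∃ a : Fin ℓ → ℂ, (∀ i, pderiv i α = C (a i)) ∧ ∃ j, a j ≠ 0 := by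
  have h1 : ∀ i, ∃ c, pderiv i α = C c := fun i => by
    have := (h.pderiv (i := i)).totalDegree_le
    exact ⟨_, totalDegree_eq_zero_iff_eq_C.1 (by omega)⟩
  choose a ha using h1
  refine ⟨a, ha, ?_⟩
  by_contra hcon
  push Not at hcon
  have := h.sum_X_mul_pderiv
  simp [ha, hcon] at this
  exact h0 this.symm

lemma lin_prime {α : Spoly ℓ} (h : α.IsHomogeneous 1) (h0 : α ≠ 0) : Prime α := by
  apply Irreducible.prime
  apply MvPolynomial.irreducible_of_totalDegree_eq_one (h.totalDegree h0)
  intro x hx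
  obtain ⟨d, hd⟩ := MvPolynomial.ne_zero_iff.1 h0
  rw [isUnit_iff_ne_zero]
  rintro rfl
  exact hd (zero_dvd_iff.1 (hx d))

lemma not_both {A : Finset (Spoly ℓ)} (hA : IsArrangement A) (m : Spoly ℓ → ℕ) {α : Spoly ℓ}
    (hα : α ∈ A) {π : Spoly ℓ} (hπ : Prime π) (h : π ∣ α) : ¬ π ∣ Qp A m α := by
  intro hd
  obtain ⟨β, hβ, hd⟩ := (hπ.dvd_finsetProd_iff _).1 hd
  have hd := hπ.dvd_of_dvd_pow hd
  obtain ⟨hne, hβ⟩ := Finset.mem_erase.1 hβ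
  have pα := lin_prime (hA.1 α hα).1 (hA.1 α hα).2
  have pβ := lin_prime (hA.1 β hβ).1 (hA.1 β hβ).2
  have e1 := (hπ.associated_of_dvd pα h)
  have e2 := (hπ.associated_of_dvd pβ hd)
  obtain ⟨u, hu⟩ := e2.symm.trans e1
  obtain ⟨c, hc, hcu⟩ := MvPolynomial.isUnit_iff_eq_C_of_isReduced.1 u.isUnit
  apply hA.2 α hα β hβ (Ne.symm hne) c
  rw [← hu, hcu, mul_comm, MvPolynomial.C_mul']

lemma pick {A : Finset (Spoly ℓ)} (m : Spoly ℓ → ℕ) {π : Spoly ℓ} (hπ : Prime π)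
    (h : π ∣ Qpoly A m) : ∃ α ∈ A, π ∣ α := by
  obtain ⟨β, hβ, hd⟩ := (hπ.dvd_finsetProd_iff _).1 h
  exact ⟨β, hβ, hπ.dvd_of_dvd_pow hd⟩

lemma glob {A : Finset (Spoly ℓ)} (hA : IsArrangement A) (m : Spoly ℓ → ℕ) (N : ℕ) (f : Frac ℓ)
    (h1 : toK (Qpoly A m) ^ N * f ∈ RS ℓ) (h2 : ∀ α ∈ A, toK (Qp A m α) ^ N * f ∈ RS ℓ) :
    f ∈ RS ℓ := by
  apply local_global
  intro π hπ
  by_cases hQ : π ∣ Qpoly A m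
  · obtain ⟨α, hα, hd⟩ := pick m hπ hQ
    refine ⟨Qp A m α ^ N, fun hh => not_both hA m hα hπ hd (hπ.dvd_of_dvd_pow hh), ?_⟩
    simpa [toK] using h2 α hα
  · refine ⟨Qpoly A m ^ N, fun hh => hQ (hπ.dvd_of_dvd_pow hh), ?_⟩
    simpa [toK] using h1

lemma glob2 {A : Finset (Spoly ℓ)} (hA : IsArrangement A) (m : Spoly ℓ → ℕ) (N : ℕ) (f : Frac ℓ)
    {α : Spoly ℓ} (hα : α ∈ A)
    (h1 : toK (α ^ m α) * f ∈ RS ℓ) (h2 : toK (Qp A m α) ^ N * f ∈ RS ℓ) :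
    f ∈ RS ℓ := by
  apply local_global
  intro π hπ
  by_cases hQ : π ∣ α
  · refine ⟨Qp A m α ^ N, fun hh => not_both hA m hα hπ hQ (hπ.dvd_of_dvd_pow hh), ?_⟩
    simpa [toK] using h2
  · exact ⟨α ^ m α, fun hh => hQ (hπ.dvd_of_dvd_pow hh), h1⟩


def emb {p : ℕ} (I : PIdx ℓ p) : Fin p ↪o Fin ℓ := I.1.orderEmbOfFin I.2

def bv (i : Fin ℓ) : VV ℓ := Pi.single i 1

def ev {p : ℕ} (ω : RForm ℓ p) : VV ℓ [⋀^Fin p]→ₗ[Frac ℓ] Frac ℓ :=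
  ∑ I : PIdx ℓ p, ω I •
    (Matrix.detRowAlternating (n := Fin p) (R := Frac ℓ)).compLinearMap
      (LinearMap.funLeft (Frac ℓ) (Frac ℓ) (emb I))

lemma ev_apply {p : ℕ} (ω : RForm ℓ p) (v : Fin p → VV ℓ) :
    ev ω v = ∑ I : PIdx ℓ p, ω I * (Matrix.of fun a b => v a (emb I b)).det := by
  unfold ev
  have h : ∀ (s : Finset (PIdx ℓ p)) (G : PIdx ℓ p → VV ℓ [⋀^Fin p]→ₗ[Frac ℓ] Frac ℓ),
      (∑ I ∈ s, G I) v = ∑ I ∈ s, G I v := by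
    intro s G
    induction s using Finset.induction_on with
    | empty => simp
    | insert a s ha ih => rw [Finset.sum_insert ha, Finset.sum_insert ha, AlternatingMap.add_apply, ih]
  rw [h]
  rfl

lemma emb_image {p : ℕ} (I : PIdx ℓ p) : Set.range (emb I) = (I.1 : Set (Fin ℓ)) :=
  Finset.range_orderEmbOfFin _ _

lemma emb_mem {p : ℕ} (I : PIdx ℓ p) (a : Fin p) : emb I a ∈ I.1 :=
  Finset.orderEmbOfFin_mem _ _ _

lemma ev_basis {p : ℕ} (ω : RForm ℓ p) (J : PIdx ℓ p) :
    ev ω (fun a => bv (emb J a)) = ω J := by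
  rw [ev_apply, Finset.sum_eq_single J]
  · have : (Matrix.of fun a b => bv (emb J a) (emb J b)) = (1 : Matrix (Fin p) (Fin p) (Frac ℓ)) := by
      ext a b
      simp only [Matrix.of_apply, bv, Matrix.one_apply, Pi.single_apply]
      simp [eq_comm]
    rw [this]; simp
  · intro I _ hI
    have : ∃ a, emb J a ∉ I.1 := by
      by_contra hcon
      push Not at hcon
      apply hI
      have : J.1 ⊆ I.1 := by
        intro x hx
        have : x ∈ Set.range (emb J) := by rw [emb_image]; exact hx
        obtain ⟨a, rfl⟩ := this
        exact hcon a
      exact Subtype.ext (Finset.eq_of_subset_of_card_le this (by rw [I.2, J.2])).symm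
    obtain ⟨a, ha⟩ := this
    rw [Matrix.det_eq_zero_of_row_eq_zero a, mul_zero]
    intro b
    simp only [Matrix.of_apply, bv, Pi.single_apply]
    rw [if_neg]
    intro h
    apply ha
    rw [← h]
    exact Finset.orderEmbOfFin_mem _ _ _
  · simp

lemma basis_red {p : ℕ} (f : Fin p → Fin ℓ) :
    (∀ F : VV ℓ [⋀^Fin p]→ₗ[Frac ℓ] Frac ℓ, F (fun a => bv (f a)) = 0) ∨
    ∃ (J : PIdx ℓ p) (u : ℤˣ), ∀ F : VV ℓ [⋀^Fin p]→ₗ[Frac ℓ] Frac ℓ,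
      F (fun a => bv (f a)) = u • F (fun a => bv (emb J a)) := by
  by_cases hf : Function.Injective f
  · right
    let J : PIdx ℓ p := ⟨Finset.univ.image f, by
      rw [Finset.card_image_of_injective _ hf]; simp⟩
    have h1 : ∀ a, ∃ b, emb J b = f a := by
      intro a
      have : f a ∈ Set.range (emb J) := by
        rw [emb_image]
        simp [J]
      exact this
    choose σ hσ using h1
    have hσi : Function.Injective σ := by
      intro a b hab
      apply hf
      rw [← hσ, ← hσ, hab]
    let τ : Equiv.Perm (Fin p) := Equiv.ofBijective σ (Finite.injective_iff_bijective.1 hσi)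
    refine ⟨J, Equiv.Perm.sign τ, fun F => ?_⟩
    rw [← F.map_perm]
    congr 1
    funext a
    simp [τ, hσ]
  · left
    intro F
    apply F.map_eq_zero_of_not_injective
    intro h
    exact hf (Function.Injective.of_comp (f := bv) h)

lemma alt_ext {p : ℕ} {F G : VV ℓ [⋀^Fin p]→ₗ[Frac ℓ] Frac ℓ}
    (h : ∀ J : PIdx ℓ p, F (fun a => bv (emb J a)) = G (fun a => bv (emb J a))) : F = G := by
  apply Module.Basis.ext_alternating (Pi.basisFun (Frac ℓ) (Fin ℓ))
  intro v _
  have hb : ∀ i, Pi.basisFun (Frac ℓ) (Fin ℓ) i = bv i := fun i => by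
    rw [Pi.basisFun_apply, bv]
  simp only [hb]
  rcases basis_red v with h0 | ⟨J, u, hJ⟩
  · rw [h0, h0]
  · rw [hJ, hJ, h]

def coef {p : ℕ} (F : VV ℓ [⋀^Fin p]→ₗ[Frac ℓ] Frac ℓ) : RForm ℓ p :=
  fun J => F (fun a => bv (emb J a))

lemma ev_coef {p : ℕ} (F : VV ℓ [⋀^Fin p]→ₗ[Frac ℓ] Frac ℓ) : ev (coef F) = F :=
  alt_ext fun J => by rw [ev_basis]; rfl

lemma coef_ev {p : ℕ} (ω : RForm ℓ p) : coef (ev ω) = ω := funext fun J => ev_basis ω J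

lemma ev_add {p : ℕ} (ω ω' : RForm ℓ p) : ev (ω + ω') = ev ω + ev ω' :=
  alt_ext fun J => by simp [ev_basis]

lemma ev_smul {p : ℕ} (c : Frac ℓ) (ω : RForm ℓ p) : ev (c • ω) = c • ev ω :=
  alt_ext fun J => by simp [ev_basis]

lemma RS_units {u : ℤˣ} {c x : Frac ℓ} (h : c * x ∈ RS ℓ) : c * (u • x) ∈ RS ℓ := by
  rcases Int.units_eq_one_or u with rfl | rfl
  · simpa using h
  · simpa using h

lemma basis_vals {p : ℕ} (F : VV ℓ [⋀^Fin p]→ₗ[Frac ℓ] Frac ℓ) (c : Frac ℓ)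
    (h : ∀ J : PIdx ℓ p, c * F (fun a => bv (emb J a)) ∈ RS ℓ) (f : Fin p → Fin ℓ) :
    c * F (fun a => bv (f a)) ∈ RS ℓ := by
  rcases basis_red f with h0 | ⟨J, u, hJ⟩
  · rw [h0, mul_zero]; exact zero_mem _
  · rw [hJ]; exact RS_units (h J)

lemma smul_toK {M : Type*} [AddCommGroup M] [Module (Spoly ℓ) M] [Module (Frac ℓ) M]
    [IsScalarTower (Spoly ℓ) (Frac ℓ) M] (s : Spoly ℓ) (x : M) : s • x = toK s • x :=
  (algebraMap_smul (Frac ℓ) s x).symm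

lemma span_vals {p : ℕ} (F : VV ℓ [⋀^Fin p]→ₗ[Frac ℓ] Frac ℓ) (c : Frac ℓ) (B : Set (VV ℓ))
    (h : ∀ w : Fin p → VV ℓ, (∀ a, w a ∈ B) → c * F w ∈ RS ℓ) (v : Fin p → VV ℓ)
    (hv : ∀ a, v a ∈ Submodule.span (Spoly ℓ) B) : c * F v ∈ RS ℓ := by
  have key : ∀ s : Finset (Fin p), ∀ v : Fin p → VV ℓ,
      (∀ a ∈ s, v a ∈ Submodule.span (Spoly ℓ) B) → (∀ a, a ∉ s → v a ∈ B) →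
      c * F v ∈ RS ℓ := by
    intro s
    induction s using Finset.induction_on with
    | empty => intro v _ h2; exact h v fun a => h2 a (by simp)
    | insert a s ha ih =>
      intro v h1 h2
      have main : ∀ x ∈ Submodule.span (Spoly ℓ) B, c * F (Function.update v a x) ∈ RS ℓ := by
        intro x hx
        induction hx using Submodule.span_induction with
        | mem x hx =>
          apply ih
          · intro b hb
            have : b ≠ a := by rintro rfl; exact ha hb
            rw [Function.update_of_ne this]
            exact h1 b (by simp [hb])
          · intro b hb
            by_cases hba : b = a
            · subst hba; simpa using hx
            · rw [Function.update_of_ne hba]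
              exact h2 b (by simp [hb, hba])
        | zero => rw [F.map_update_zero, mul_zero]; exact zero_mem _
        | add x y _ _ hx hy =>
          rw [F.map_update_add, mul_add]; exact add_mem hx hy
        | smul s x _ hx =>
          rw [smul_toK, F.map_update_smul, smul_eq_mul, mul_left_comm]
          exact mul_mem (toK_mem s) hx
      have := main (v a) (h1 a (by simp))
      rwa [Function.update_eq_self] at this
  exact key Finset.univ v (fun a _ => hv a) (fun a ha => absurd (Finset.mem_univ a) ha)

lemma poly_span {v : VV ℓ} (hv : ∀ i, v i ∈ RS ℓ) :
    v ∈ Submodule.span (Spoly ℓ) (Set.range (bv (ℓ := ℓ))) := by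
  choose s hs using hv
  have : v = ∑ i, s i • bv i := by
    funext k
    simp only [Finset.sum_apply, Pi.smul_apply, bv, Pi.single_apply]
    simp only [smul_toK]
    simp [toK, hs]
  rw [this]
  exact Submodule.sum_mem _ fun i _ => Submodule.smul_mem _ _ (Submodule.subset_span ⟨i, rfl⟩)

lemma poly_vals {p : ℕ} (F : VV ℓ [⋀^Fin p]→ₗ[Frac ℓ] Frac ℓ) (c : Frac ℓ)
    (h : ∀ J : PIdx ℓ p, c * F (fun a => bv (emb J a)) ∈ RS ℓ) (v : Fin p → VV ℓ)
    (hv : ∀ a i, v a i ∈ RS ℓ) : c * F v ∈ RS ℓ := by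
  apply span_vals F c (Set.range (bv (ℓ := ℓ))) _ v fun a => poly_span (hv a)
  intro w hw
  choose f hf using hw
  have : w = fun a => bv (f a) := funext fun a => (hf a).symm
  rw [this]
  exact basis_vals F c h f

def dform (α : Spoly ℓ) : VV ℓ →ₗ[Frac ℓ] Frac ℓ :=
  ∑ j, toK (pderiv j α) • LinearMap.proj j

lemma dform_apply (α : Spoly ℓ) (v : VV ℓ) : dform α v = ∑ j, toK (pderiv j α) * v j := by
  simp only [dform, LinearMap.sum_apply, LinearMap.smul_apply, LinearMap.proj_apply, smul_eq_mul]

lemma dform_bv (α : Spoly ℓ) (i : Fin ℓ) : dform α (bv i) = toK (pderiv i α) := by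
  rw [dform_apply]
  simp [bv, Pi.single_apply]

def wdg {p : ℕ} (α : Spoly ℓ) (F : VV ℓ [⋀^Fin p]→ₗ[Frac ℓ] Frac ℓ) :
    VV ℓ [⋀^Fin (p+1)]→ₗ[Frac ℓ] Frac ℓ :=
  AlternatingMap.alternatizeUncurryFin ((dform α).smulRight F)

lemma wdg_apply {p : ℕ} (α : Spoly ℓ) (F : VV ℓ [⋀^Fin p]→ₗ[Frac ℓ] Frac ℓ)
    (v : Fin (p+1) → VV ℓ) :
    wdg α F v = ∑ k : Fin (p+1), (-1) ^ (k : ℕ) * (dform α (v k) * F (k.removeNth v)) := by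
  unfold wdg
  rw [AlternatingMap.alternatizeUncurryFin_apply]
  refine Finset.sum_congr rfl fun k _ => ?_
  simp

lemma wdg_smul {p : ℕ} (α : Spoly ℓ) (c : Frac ℓ) (F : VV ℓ [⋀^Fin p]→ₗ[Frac ℓ] Frac ℓ)
    (v : Fin (p+1) → VV ℓ) : wdg α (c • F) v = c * wdg α F v := by
  rw [wdg_apply, wdg_apply, Finset.mul_sum]
  refine Finset.sum_congr rfl fun k _ => ?_
  simp only [AlternatingMap.smul_apply, smul_eq_mul]
  ring

lemma wedgeCoeff_eq {p : ℕ} (α : Spoly ℓ) (ψ : PIdx ℓ p → Spoly ℓ) (J : PIdx ℓ (p+1)) :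
    toK (wedgeCoeff α ψ J) = wdg α (ev fun I => toK (ψ I)) (fun a => bv (emb J a)) := by
  rw [wdg_apply, wedgeCoeff, toK, map_sum]
  symm
  refine Finset.sum_bij (fun k _ => (⟨emb J k, Finset.orderEmbOfFin_mem _ _ _⟩ : {x // x ∈ J.1}))
    (fun k _ => Finset.mem_attach _ _) ?_ ?_ ?_
  · intro a _ b _ hab
    exact (emb J).injective (Subtype.ext_iff.1 hab)
  · rintro ⟨j, hj⟩ _
    have : j ∈ Set.range (emb J) := by rw [emb_image]; exact hj
    obtain ⟨a, rfl⟩ := this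
    exact ⟨a, Finset.mem_univ _, rfl⟩
  · intro k _
    have hcard : (J.1.filter (fun i => i < emb J k)).card = k := by
      have : J.1.filter (fun i => i < emb J k) = (Finset.Iio k).image (emb J) := by
        ext x
        simp only [Finset.mem_filter, Finset.mem_image, Finset.mem_Iio]
        constructor
        · rintro ⟨hx, hlt⟩
          have : x ∈ Set.range (emb J) := by rw [emb_image]; exact hx
          obtain ⟨a, rfl⟩ := this
          exact ⟨a, (emb J).lt_iff_lt.1 hlt, rfl⟩
        · rintro ⟨a, ha, rfl⟩
          exact ⟨Finset.orderEmbOfFin_mem _ _ _, (emb J).lt_iff_lt.2 ha⟩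
      rw [this, Finset.card_image_of_injective _ (emb J).injective, Fin.card_Iio]
    have hE : ∀ I : PIdx ℓ p, I.1 = J.1.erase (emb J k) →
        ev (fun I => toK (ψ I)) (k.removeNth fun a => bv (emb J a)) = toK (ψ I) := by
      intro I hI
      have : (fun a => emb J (k.succAbove a)) = emb I := by
        apply Finset.orderEmbOfFin_unique
        · intro a
          rw [hI, Finset.mem_erase]
          exact ⟨fun h => k.succAbove_ne a ((emb J).injective h), Finset.orderEmbOfFin_mem _ _ _⟩
        · exact (emb J).strictMono.comp (Fin.strictMono_succAbove k)
      have h2 : (k.removeNth fun a => bv (emb J a)) = fun a => bv (ℓ := ℓ) (emb I a) := by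
        funext a
        rw [← this]
        rfl
      rw [h2, ev_basis]
    rw [hE ⟨J.1.erase (emb J k), by
      rw [Finset.card_erase_of_mem (emb_mem J k), J.2]; rfl⟩ rfl, dform_bv]
    simp only [hcard]
    simp [toK, mul_assoc]


lemma mem_omega {A : Finset (Spoly ℓ)} (hA : IsArrangement A) (m : Spoly ℓ → ℕ) {p : ℕ}
    (ω : RForm ℓ p) : ω ∈ OmegaMod A m p ↔ (∀ I, toK (Qpoly A m) * ω I ∈ RS ℓ) ∧
      ∀ α ∈ A, ∀ J : PIdx ℓ (p+1),
        toK (Qp A m α) * wdg α (ev ω) (fun a => bv (emb J a)) ∈ RS ℓ := by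
  have key : ∀ ψ : PIdx ℓ p → Spoly ℓ, (∀ I, toK (Qpoly A m) * ω I = toK (ψ I)) →
      ∀ α ∈ A, ∀ J : PIdx ℓ (p+1), (α ^ m α ∣ wedgeCoeff α ψ J ↔
        toK (Qp A m α) * wdg α (ev ω) (fun a => bv (emb J a)) ∈ RS ℓ) := by
    intro ψ hψ α hα J
    have h1 : (fun I => toK (ψ I)) = toK (Qpoly A m) • ω := by
      funext I
      rw [← hψ]; rfl
    have h2 := wedgeCoeff_eq α ψ J
    have h3 : toK (α ^ m α) ≠ 0 := toK_ne (pow_ne_zero _ (hA.1 α hα).2)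
    rw [h1, ev_smul, wdg_smul, Q_eq m hα, toK, toK, map_mul, mul_assoc] at h2
    constructor
    · rintro ⟨s, hs⟩
      refine ⟨s, ?_⟩
      rw [hs, map_mul] at h2
      exact mul_left_cancel₀ h3 h2
    · rintro ⟨s, hs⟩
      refine ⟨s, toK_inj ?_⟩
      rw [toK, h2, ← hs, toK, map_mul]
  constructor
  · rintro ⟨ψ, h1, h2⟩
    exact ⟨fun I => ⟨ψ I, (h1 I).symm⟩, fun α hα J => (key ψ h1 α hα J).1 (h2 α hα J)⟩
  · rintro ⟨h1, h2⟩
    choose ψ hψ using h1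
    exact ⟨ψ, fun I => (hψ I).symm,
      fun α hα J => (key ψ (fun I => (hψ I).symm) α hα J).2 (h2 α hα J)⟩

def DD (A : Finset (Spoly ℓ)) (m : Spoly ℓ → ℕ) : Set (VV ℓ) :=
  {θ | ∀ ω ∈ OmegaMod A m 1, ev ω (fun _ => θ) ∈ RS ℓ}

/-- one-form attached to a covector -/
def one (u : VV ℓ) : RForm ℓ 1 := fun I => u (emb I 0)

lemma ev_one (u θ : VV ℓ) : ev (one u) (fun _ => θ) = ∑ i, u i * θ i := by
  let F : VV ℓ [⋀^Fin 1]→ₗ[Frac ℓ] Frac ℓ :=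
    AlternatingMap.ofSubsingleton (Frac ℓ) (VV ℓ) (Frac ℓ) (0 : Fin 1)
      (∑ j, u j • LinearMap.proj j)
  have hF : ∀ v, F v = ∑ i, u i * v 0 i := by
    intro v
    simp [F]
  have : ev (one u) = F := by
    apply alt_ext
    intro J
    rw [ev_basis, hF]
    simp [bv, Pi.single_apply, one]
  rw [this, hF]

lemma toK_smul_apply (s : Spoly ℓ) (u : VV ℓ) (i : Fin ℓ) : (s • u) i = toK s * u i := by
  rw [smul_toK]; rfl

lemma poly_one_mem {A : Finset (Spoly ℓ)} (hA : IsArrangement A) (m : Spoly ℓ → ℕ) (i : Fin ℓ) :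
    one (bv i) ∈ OmegaMod A m 1 := by
  rw [mem_omega hA]
  have hv : ∀ i k : Fin ℓ, bv i k ∈ RS ℓ := by
    intro i k
    unfold bv
    rw [Pi.single_apply]
    split_ifs
    · exact one_mem _
    · exact zero_mem _
  refine ⟨fun I => mul_mem (toK_mem _) (hv _ _), fun α hα J => mul_mem (toK_mem _) ?_⟩
  rw [wdg_apply]
  refine sum_mem fun k _ => mul_mem (pow_mem (neg_mem (one_mem _)) _) (mul_mem ?_ ?_)
  · rw [dform_bv]; exact toK_mem _
  · have := poly_vals (ev (one (bv i))) 1 (fun J => by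
      rw [ev_basis, one_mul]; exact hv _ _) (k.removeNth fun a => bv (emb J a))
      (fun a j => hv _ _)
    rwa [one_mul] at this

lemma dlog_mem {A : Finset (Spoly ℓ)} (hA : IsArrangement A) (m : Spoly ℓ → ℕ) {α : Spoly ℓ}
    (hα : α ∈ A) :
    one (fun i => (toK (α ^ m α))⁻¹ * toK (pderiv i α)) ∈ OmegaMod A m 1 := by
  rw [mem_omega hA]
  have h3 : toK (α ^ m α) ≠ 0 := toK_ne (pow_ne_zero _ (hA.1 α hα).2)
  have hval : ∀ v : Fin 1 → VV ℓ,
      ev (one (fun i => (toK (α ^ m α))⁻¹ * toK (pderiv i α))) v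
        = (toK (α ^ m α))⁻¹ * dform α (v 0) := by
    intro v
    have : v = fun _ => v 0 := funext fun a => by rw [Subsingleton.elim a 0]
    rw [this, ev_one, dform_apply, Finset.mul_sum]
    refine Finset.sum_congr rfl fun i _ => by ring
  refine ⟨fun I => ?_, fun β hβ J => ?_⟩
  · have : toK (Qpoly A m) * one (fun i => (toK (α ^ m α))⁻¹ * toK (pderiv i α)) I
        = toK (Qp A m α * pderiv (emb I 0) α) := by
      have e : toK (Qpoly A m) = toK (α ^ m α) * toK (Qp A m α) := by
        rw [Q_eq m hα, toK, map_mul]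
      have e' : toK (Qp A m α * pderiv (emb I 0) α)
          = toK (Qp A m α) * toK (pderiv (emb I 0) α) := map_mul _ _ _
      rw [e, e', one]
      field_simp
    rw [this]; exact toK_mem _
  · rw [wdg_apply]
    simp only [hval]
    by_cases hab : β = α
    · subst hab
      rw [Fin.sum_univ_two]
      convert zero_mem (RS ℓ)
      simp [Fin.removeNth]
      right
      ring
    · have hd : α ^ m α ∣ Qp A m β :=
        Finset.dvd_prod_of_mem (fun β => β ^ m β) (Finset.mem_erase.2 ⟨Ne.symm hab, hα⟩)
      obtain ⟨q, hq⟩ := hd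
      rw [Finset.mul_sum]
      refine sum_mem fun k _ => ?_
      have : toK (Qp A m β) * ((-1) ^ (k : ℕ) * (dform β (bv (emb J k)) *
          ((toK (α ^ m α))⁻¹ * dform α (k.removeNth (fun a => bv (emb J a)) 0))))
          = (-1) ^ (k : ℕ) * (toK q * (dform β (bv (emb J k)) *
            dform α (bv (emb J (k.succAbove 0))))) := by
        rw [hq, toK, map_mul]
        change _ * (_ * (_ * (_ * dform α (bv (emb J (k.succAbove 0)))))) = _
        field_simp
      rw [this, dform_bv, dform_bv]
      exact mul_mem (pow_mem (neg_mem (one_mem _)) _)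
        (mul_mem (toK_mem _) (mul_mem (toK_mem _) (toK_mem _)))

lemma DD_poly {A : Finset (Spoly ℓ)} (hA : IsArrangement A) (m : Spoly ℓ → ℕ) {θ : VV ℓ}
    (hθ : θ ∈ DD A m) (i : Fin ℓ) : θ i ∈ RS ℓ := by
  have := hθ _ (poly_one_mem hA m i)
  rw [ev_one] at this
  simpa [bv, Pi.single_apply] using this

lemma DD_dlog {A : Finset (Spoly ℓ)} (hA : IsArrangement A) (m : Spoly ℓ → ℕ) {θ : VV ℓ}
    (hθ : θ ∈ DD A m) {α : Spoly ℓ} (hα : α ∈ A) :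
    ∃ s : Spoly ℓ, dform α θ = toK (α ^ m α) * toK s := by
  obtain ⟨s, hs⟩ := hθ _ (dlog_mem hA m hα)
  have h3 : toK (α ^ m α) ≠ 0 := toK_ne (pow_ne_zero _ (hA.1 α hα).2)
  refine ⟨s, ?_⟩
  rw [ev_one] at hs
  rw [toK, toK, hs, Finset.mul_sum, dform_apply]
  refine Finset.sum_congr rfl fun i _ => ?_
  field_simp

lemma one_surj (ω : RForm ℓ 1) : ∃ u, ω = one u := by
  refine ⟨fun i => ev ω (fun _ => bv i), ?_⟩
  funext I
  rw [one, ← ev_basis ω I]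
  congr 1
  funext a
  rw [Subsingleton.elim a 0]

lemma const_one_vals (ω : RForm ℓ 1) (i : Fin ℓ) : ∃ I : PIdx ℓ 1, ev ω (fun _ => bv i) = ω I := by
  refine ⟨⟨{i}, rfl⟩, ?_⟩
  rw [← ev_basis ω]
  congr 1
  funext a
  have := emb_mem (⟨{i}, rfl⟩ : PIdx ℓ 1) a
  rw [Finset.mem_singleton] at this
  rw [this]

lemma Q_DD {A : Finset (Spoly ℓ)} (hA : IsArrangement A) (m : Spoly ℓ → ℕ) (i : Fin ℓ) :
    toK (Qpoly A m) • bv i ∈ DD A m := by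
  intro ω hω
  have h := ((mem_omega hA m ω).1 hω).1
  obtain ⟨I, hI⟩ := const_one_vals ω i
  have : ev ω (fun _ => toK (Qpoly A m) • bv i) = toK (Qpoly A m) * ev ω (fun _ => bv i) := by
    have := (ev ω).map_smul_univ (fun _ => toK (Qpoly A m)) (fun _ => bv i)
    simpa using this
  rw [this, hI]
  exact h I

def eta (α : Spoly ℓ) (j i : Fin ℓ) : VV ℓ := toK (pderiv j α) • bv i - toK (pderiv i α) • bv j

lemma dform_eta (α : Spoly ℓ) (j i : Fin ℓ) : dform α (eta α j i) = 0 := by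
  simp only [eta, map_sub, map_smul, dform_bv, smul_eq_mul]
  ring

lemma eta_DD {A : Finset (Spoly ℓ)} (hA : IsArrangement A) (m : Spoly ℓ → ℕ) {α : Spoly ℓ}
    (hα : α ∈ A) (j i : Fin ℓ) : toK (Qp A m α) • eta α j i ∈ DD A m := by
  intro ω hω
  have h := ((mem_omega hA m ω).1 hω).2 α hα
  have h2 := basis_vals (wdg α (ev ω)) _ h ![j, i]
  obtain ⟨u, rfl⟩ := one_surj ω
  rw [wdg_apply, Fin.sum_univ_two] at h2
  have e0 : (Fin.removeNth 0 fun a => bv (![j, i] a)) = fun _ : Fin 1 => bv (ℓ := ℓ) i := by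
    funext a; rw [Subsingleton.elim a 0]; rfl
  have e1 : (Fin.removeNth 1 fun a => bv (![j, i] a)) = fun _ : Fin 1 => bv (ℓ := ℓ) j := by
    funext a; rw [Subsingleton.elim a 0]; rfl
  rw [e0, e1, ev_one, ev_one] at h2
  simp only [dform_bv] at h2
  rw [ev_one]
  convert h2 using 1
  have hs : ∀ i, ∑ k, u k * bv i k = u i := fun i => by simp [bv, Pi.single_apply]
  simp only [Fin.isValue, Matrix.cons_val_zero, Matrix.cons_val_one]
  rw [hs, hs]
  have : ∀ k, u k * (toK (Qp A m α) • eta α j i) k =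
      toK (Qp A m α) * (toK (pderiv j α) * (u k * bv i k) - toK (pderiv i α) * (u k * bv j k)) := by
    intro k
    simp only [eta, Pi.smul_apply, Pi.sub_apply, smul_eq_mul]
    ring
  simp only [this]
  rw [← Finset.mul_sum, Finset.sum_sub_distrib, ← Finset.mul_sum, ← Finset.mul_sum, hs, hs]
  congr 1
  simp only [Fin.val_zero, Fin.val_one, pow_zero, pow_one]
  ring


lemma ev_mem_of_omega {A : Finset (Spoly ℓ)} (hA : IsArrangement A) (m : Spoly ℓ → ℕ) {p : ℕ}
    {ω : RForm ℓ p} (hω : ω ∈ OmegaMod A m p) (θ : Fin p → VV ℓ) (hθ : ∀ a, θ a ∈ DD A m) :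
    ev ω θ ∈ RS ℓ := by
  obtain ⟨h1, h2⟩ := (mem_omega hA m ω).1 hω
  have hQ : ∀ v : Fin p → VV ℓ, (∀ a i, v a i ∈ RS ℓ) → toK (Qpoly A m) * ev ω v ∈ RS ℓ :=
    fun v hv => poly_vals (ev ω) _ (fun J => by rw [ev_basis]; exact h1 J) v hv
  have hb : ∀ i k : Fin ℓ, bv i k ∈ RS ℓ := by
    intro i k
    unfold bv
    rw [Pi.single_apply]
    split_ifs
    · exact one_mem _
    · exact zero_mem _
  have hp : ∀ a i, θ a i ∈ RS ℓ := fun a i => DD_poly hA m (hθ a) i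
  apply glob hA m 1
  · rw [pow_one]; exact hQ θ hp
  · intro α hα
    rw [pow_one]
    obtain ⟨a, ha, j, hj⟩ := lin_coeffs (hA.1 α hα).1 (hA.1 α hα).2
    let W : Fin (p+1) → VV ℓ := Fin.cons (bv j) θ
    have hc : ∀ b k, W b k ∈ RS ℓ := by
      intro b k
      refine Fin.cases ?_ (fun b => ?_) b
      · exact hb _ _
      · exact hp _ _
    have hw := poly_vals (wdg α (ev ω)) _ (h2 α hα) W hc
    rw [wdg_apply, Fin.sum_univ_succ, mul_add] at hw
    have hrest : toK (Qp A m α) * ∑ k : Fin p, (-1) ^ ((Fin.succ k : Fin (p+1)) : ℕ) *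
        (dform α (W k.succ) * ev ω (k.succ.removeNth W)) ∈ RS ℓ := by
      rw [Finset.mul_sum]
      refine sum_mem fun k _ => ?_
      have hWk : W k.succ = θ k := rfl
      rw [hWk]
      obtain ⟨s, hs⟩ := DD_dlog hA m (hθ k) hα
      have e : toK (Qpoly A m) = toK (α ^ m α) * toK (Qp A m α) := by
        rw [Q_eq m hα, toK, map_mul]
      have := hQ (k.succ.removeNth W) (fun b i => hc _ _)
      rw [e] at this
      rw [hs]
      have h3 := mul_mem (mul_mem (pow_mem (neg_mem (one_mem (RS ℓ))) (k.succ : ℕ)) (toK_mem s)) this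
      convert h3 using 1
      ring
    have h0 := sub_mem hw hrest
    rw [add_sub_cancel_right] at h0
    have er : (Fin.removeNth 0 W) = θ := by
      funext b; rfl
    have hW0 : W 0 = bv j := rfl
    rw [er, hW0] at h0
    simp only [Fin.val_zero, pow_zero, one_mul, dform_bv, ha] at h0
    have h4 := mul_mem (toK_mem (C (a j)⁻¹ : Spoly ℓ)) h0
    convert h4 using 1
    have : toK (C (a j)⁻¹ : Spoly ℓ) * toK (C (a j)) = 1 := by
      rw [toK, toK, ← map_mul, ← map_mul, inv_mul_cancel₀ hj]; simp
    linear_combination (-(toK (Qp A m α) * ev ω θ)) * this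

lemma omega_of_ev {A : Finset (Spoly ℓ)} (hA : IsArrangement A) (m : Spoly ℓ → ℕ) {p : ℕ}
    {ω : RForm ℓ p} (H : ∀ θ : Fin p → VV ℓ, (∀ a, θ a ∈ DD A m) → ev ω θ ∈ RS ℓ) :
    ω ∈ OmegaMod A m p := by
  have hQQ : ∀ f : Fin p → Fin ℓ, toK (Qpoly A m) ^ p * ev ω (fun a => bv (f a)) ∈ RS ℓ := by
    intro f
    have := H (fun a => toK (Qpoly A m) • bv (f a)) (fun a => Q_DD hA m _)
    rw [(ev ω).map_smul_univ (fun _ => toK (Qpoly A m)) (fun a => bv (f a))] at this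
    simpa using this
  have loc : ∀ α ∈ A,
      (∀ I, toK (Qp A m α) ^ p * toK (α ^ m α) * ω I ∈ RS ℓ) ∧
      ∀ J : PIdx ℓ (p+1),
        toK (Qp A m α) ^ p * wdg α (ev ω) (fun a => bv (emb J a)) ∈ RS ℓ := by
    intro α hα
    obtain ⟨a, ha, j, hj⟩ := lin_coeffs (hA.1 α hα).1 (hA.1 α hα).2
    let B : Set (VV ℓ) := insert (bv j) (Set.range (eta α j))
    have hB : ∀ i, bv i ∈ Submodule.span (Spoly ℓ) B := by
      intro i
      have : bv i = (C (a j)⁻¹ : Spoly ℓ) • (eta α j i + (C (a i) : Spoly ℓ) • bv j) := by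
        have h1 : toK (C (a j)⁻¹ : Spoly ℓ) * toK (C (a j)) = 1 := by
          rw [toK, toK, ← map_mul, ← map_mul, inv_mul_cancel₀ hj]; simp
        rw [eta, ha, ha, smul_toK, smul_toK, sub_add_cancel, smul_smul, h1, one_smul]
      rw [this]
      refine Submodule.smul_mem _ _ (Submodule.add_mem _ ?_ (Submodule.smul_mem _ _ ?_))
      · exact Submodule.subset_span (Set.mem_insert_of_mem _ ⟨i, rfl⟩)
      · exact Submodule.subset_span (Set.mem_insert _ _)
    have c1 : ∀ w : Fin p → VV ℓ, (∀ b, w b ∈ Set.range (eta α j)) →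
        toK (Qp A m α) ^ p * ev ω w ∈ RS ℓ := by
      intro w hw
      have := H (fun b => toK (Qp A m α) • w b) (fun b => by
        obtain ⟨i, hi⟩ := hw b
        rw [← hi]
        exact eta_DD hA m hα j i)
      rw [(ev ω).map_smul_univ (fun _ => toK (Qp A m α)) w] at this
      simpa using this
    constructor
    · intro I
      rw [← ev_basis ω I]
      apply span_vals (ev ω) _ B _ _ (fun b => hB _)
      intro w hw
      by_cases hinj : Function.Injective w
      · by_cases hall : ∀ b, w b ∈ Set.range (eta α j)
        · rw [mul_right_comm]
          exact mul_mem (c1 w hall) (toK_mem _)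
        · push Not at hall
          obtain ⟨b₀, hb₀⟩ := hall
          have hb₀' : w b₀ = bv j := (hw b₀).resolve_right hb₀
          let c : Fin p → Frac ℓ := fun b => toK (Qp A m α) * if b = b₀ then toK (α ^ m α) else 1
          have := H (fun b => c b • w b) (fun b => by
            by_cases hb : b = b₀
            · subst hb
              have e : c b = toK (Qpoly A m) := by
                simp only [c, if_pos]
                rw [Q_eq m hα, toK, toK, toK, map_mul, mul_comm]
              simp only [e, hb₀']
              exact Q_DD hA m j
            · have : w b ≠ bv j := fun h => hb (hinj (h.trans hb₀'.symm))
              obtain ⟨i, hi⟩ := (hw b).resolve_left this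
              simp only [c, if_neg hb, mul_one]
              rw [← hi]
              exact eta_DD hA m hα j i)
          rw [(ev ω).map_smul_univ c w] at this
          have hc : ∏ b, c b = toK (Qp A m α) ^ p * toK (α ^ m α) := by
            simp only [c]
            rw [Finset.prod_mul_distrib, Finset.prod_ite_eq']
            simp
          rw [hc] at this
          exact this
      · rw [(ev ω).map_eq_zero_of_not_injective w hinj, mul_zero]
        exact zero_mem _
    · intro J
      apply span_vals (wdg α (ev ω)) _ B _ _ (fun b => hB _)
      intro w hw
      by_cases hinj : Function.Injective w
      · rw [wdg_apply, Finset.mul_sum]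
        refine sum_mem fun k _ => ?_
        rcases hw k with hk | ⟨i, hi⟩
        · have := c1 (k.removeNth w) (fun b => by
            refine (hw (k.succAbove b)).resolve_left fun h => ?_
            exact k.succAbove_ne b (hinj (h.trans hk.symm)))
          rw [hk, dform_bv]
          have h3 := mul_mem (mul_mem (pow_mem (neg_mem (one_mem (RS ℓ))) (k : ℕ))
            (toK_mem (pderiv j α))) this
          convert h3 using 1
          ring
        · rw [← hi, dform_eta, zero_mul, mul_zero, mul_zero]
          exact zero_mem _
      · rw [(wdg α (ev ω)).map_eq_zero_of_not_injective w hinj, mul_zero]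
        exact zero_mem _
  have e : ∀ α ∈ A, toK (Qpoly A m) = toK (α ^ m α) * toK (Qp A m α) := fun α hα => by
    rw [Q_eq m hα, toK, map_mul]
  have hQ : ∀ I, toK (Qpoly A m) * ω I ∈ RS ℓ := by
    intro I
    apply glob hA m p
    · have := hQQ (emb I)
      rw [ev_basis] at this
      rw [mul_left_comm]
      exact mul_mem (toK_mem _) this
    · intro α hα
      have := mul_mem (toK_mem (Qp A m α)) ((loc α hα).1 I)
      rw [e α hα]
      convert this using 1
      ring
  rw [mem_omega hA]
  refine ⟨hQ, fun α hα J => ?_⟩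
  apply glob2 hA m p _ hα
  · rw [← mul_assoc, ← e α hα, wdg_apply, Finset.mul_sum]
    refine sum_mem fun k _ => ?_
    have := basis_vals (ev ω) _ (fun J => by rw [ev_basis]; exact hQ J)
      (fun a => emb J (k.succAbove a))
    rw [dform_bv]
    have h3 := mul_mem (mul_mem (pow_mem (neg_mem (one_mem (RS ℓ))) (k : ℕ))
      (toK_mem (pderiv (emb J k) α))) this
    convert h3 using 1
    change _ * (_ * (_ * ev ω (fun a => bv (emb J (k.succAbove a))))) = _
    ring
  · rw [mul_left_comm]
    exact mul_mem (toK_mem _) ((loc α hα).2 J)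


lemma hom_mul {f g : Frac ℓ} {d e : ℤ} (hf : IsHomogFrac f d) (hg : IsHomogFrac g e) :
    IsHomogFrac (f * g) (d + e) := by
  obtain ⟨n, h, a, b, h0, hn, hh, hd, he⟩ := hf
  obtain ⟨n', h', a', b', h0', hn', hh', hd', he'⟩ := hg
  refine ⟨n * n', h * h', a + a', b + b', mul_ne_zero h0 h0', hn.mul hn', hh.mul hh', ?_, ?_⟩
  · push_cast; omega
  · rw [map_mul, map_mul, ← he, ← he']; ring

lemma hom_add {f g : Frac ℓ} {d : ℤ} (hf : IsHomogFrac f d) (hg : IsHomogFrac g d) :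
    IsHomogFrac (f + g) d := by
  obtain ⟨n, h, a, b, h0, hn, hh, hd, he⟩ := hf
  obtain ⟨n', h', a', b', h0', hn', hh', hd', he'⟩ := hg
  refine ⟨n * h' + n' * h, h * h', a + b', b + b', mul_ne_zero h0 h0',
    (hn.mul hh').add ?_, hh.mul hh', ?_, ?_⟩
  · have : a + b' = a' + b := by omega
    rw [this]
    exact hn'.mul hh
  · push_cast; omega
  · rw [map_mul, map_add, map_mul, map_mul, ← he, ← he']; ring

lemma hom_neg {f : Frac ℓ} {d : ℤ} (hf : IsHomogFrac f d) : IsHomogFrac (-f) d := by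
  obtain ⟨n, h, a, b, h0, hn, hh, hd, he⟩ := hf
  exact ⟨-n, h, a, b, h0, hn.neg, hh, hd, by rw [map_neg, ← he]; ring⟩

lemma hom_one : IsHomogFrac (1 : Frac ℓ) 0 :=
  ⟨1, 1, 0, 0, one_ne_zero, isHomogeneous_one _ _, isHomogeneous_one _ _, by simp, by simp⟩

lemma hom_zero : IsHomogFrac (0 : Frac ℓ) 0 :=
  ⟨0, 1, 0, 0, one_ne_zero, isHomogeneous_zero _ _ _, isHomogeneous_one _ _, by simp, by simp⟩

lemma hom_det {p : ℕ} (M : Matrix (Fin p) (Fin p) (Frac ℓ)) (h : ∀ a b, IsHomogFrac (M a b) 0) :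
    IsHomogFrac M.det 0 := by
  rw [Matrix.det_apply]
  refine Finset.sum_induction_nonempty _ (fun x => IsHomogFrac x 0) (fun _ _ => hom_add)
    Finset.univ_nonempty fun σ _ => ?_
  have hp : IsHomogFrac (∏ i, M (σ i) i) 0 :=
    Finset.prod_induction _ (fun x => IsHomogFrac x 0)
      (fun _ _ h1 h2 => by simpa using hom_mul h1 h2) hom_one (fun i _ => h _ _)
  rcases Int.units_eq_one_or (Equiv.Perm.sign σ) with hs | hs
  · rw [hs]; simpa using hp
  · rw [hs]; simpa using hom_neg hp

def Phi {p : ℕ} (τ : VV ℓ →ₗ[Frac ℓ] VV ℓ) (ω : RForm ℓ p) : RForm ℓ p :=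
  coef ((ev ω).compLinearMap τ)

lemma ev_Phi {p : ℕ} (τ : VV ℓ →ₗ[Frac ℓ] VV ℓ) (ω : RForm ℓ p) :
    ev (Phi τ ω) = (ev ω).compLinearMap τ := ev_coef _

lemma Phi_add {p : ℕ} (τ : VV ℓ →ₗ[Frac ℓ] VV ℓ) (ω ω' : RForm ℓ p) :
    Phi τ (ω + ω') = Phi τ ω + Phi τ ω' := by
  funext J
  simp only [Phi, coef, ev_add]
  rfl

lemma Phi_smul {p : ℕ} (τ : VV ℓ →ₗ[Frac ℓ] VV ℓ) (c : Spoly ℓ) (ω : RForm ℓ p) :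
    Phi τ (c • ω) = c • Phi τ ω := by
  rw [smul_toK, smul_toK]
  funext J
  simp only [Phi, coef, ev_smul]
  rfl

lemma Phi_inv {p : ℕ} (τ τ' : VV ℓ →ₗ[Frac ℓ] VV ℓ) (h : ∀ θ, τ (τ' θ) = θ) (ω : RForm ℓ p) :
    Phi τ' (Phi τ ω) = ω := by
  unfold Phi
  rw [ev_coef]
  conv_rhs => rw [← coef_ev ω]
  congr 1
  ext v
  simp [h]

lemma Phi_hom {p : ℕ} (τ : VV ℓ →ₗ[Frac ℓ] VV ℓ) (h : ∀ i j, IsHomogFrac (τ (bv i) j) 0)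
    (ω : RForm ℓ p) (d : ℤ) (hω : IsHomogForm ω d) : IsHomogForm (Phi τ ω) d := by
  intro J
  have : Phi τ ω J = ∑ I : PIdx ℓ p, ω I *
      (Matrix.of fun a b => τ (bv (emb J a)) (emb I b)).det := by
    unfold Phi coef
    rw [AlternatingMap.compLinearMap_apply, ev_apply]
  rw [this]
  refine Finset.sum_induction_nonempty _ (fun x => IsHomogFrac x d) (fun _ _ => hom_add)
    ⟨J, Finset.mem_univ _⟩ fun I _ => ?_
  have := hom_mul (hω I) (hom_det (Matrix.of fun a b => τ (bv (emb J a)) (emb I b))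
    (fun a b => h _ _))
  simpa using this

lemma one_bv_hom (j : Fin ℓ) : IsHomogForm (one (bv j)) 0 := by
  intro I
  simp only [one, bv, Pi.single_apply]
  split_ifs
  · exact hom_one
  · exact hom_zero

def dx {A : Finset (Spoly ℓ)} (hA : IsArrangement A) (m : Spoly ℓ → ℕ) (j : Fin ℓ) :
    OmegaMod A m 1 := ⟨one (bv j), poly_one_mem hA m j⟩

lemma exists_transpose {A₁ A₂ : Finset (Spoly ℓ)} (h₁ : IsArrangement A₁)
    (m₁ m₂ : Spoly ℓ → ℕ)
    (e : OmegaMod A₁ m₁ 1 →ₗ[Spoly ℓ] OmegaMod A₂ m₂ 1) :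
    ∃ τ : VV ℓ →ₗ[Frac ℓ] VV ℓ,
      (∀ (ω : OmegaMod A₁ m₁ 1) θ, ev (e ω : RForm ℓ 1) (fun _ => θ) =
        ev (ω : RForm ℓ 1) (fun _ => τ θ)) ∧
      ∀ j θ, τ θ j = ev (e (dx h₁ m₁ j) : RForm ℓ 1) (fun _ => θ) := by
  choose u hu using fun j => one_surj (e (dx h₁ m₁ j) : RForm ℓ 1)
  have hτ : ∀ j θ, (Matrix.of u).mulVecLin θ j
      = ev (e (dx h₁ m₁ j) : RForm ℓ 1) (fun _ => θ) := by
    intro j θ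
    rw [hu, ev_one]
    rfl
  refine ⟨(Matrix.of u).mulVecLin, ?_, hτ⟩
  intro ω θ
  obtain ⟨v, hv⟩ := one_surj (ω : RForm ℓ 1)
  have hpol : ∀ j, toK (Qpoly A₁ m₁) * v j ∈ RS ℓ := by
    intro j
    obtain ⟨I, hI⟩ := const_one_vals (ω : RForm ℓ 1) j
    have h1 := ((mem_omega h₁ m₁ (ω : RForm ℓ 1)).1 ω.2).1 I
    rw [← hI, hv, ev_one] at h1
    simpa [bv, Pi.single_apply] using h1
  choose s hs using hpol
  have hsum : Qpoly A₁ m₁ • ω = ∑ j, s j • dx h₁ m₁ j := by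
    apply Subtype.ext
    rw [Submodule.coe_smul, Submodule.coe_sum, hv]
    funext I
    rw [Finset.sum_apply, smul_toK]
    simp only [Submodule.coe_smul, dx, Pi.smul_apply, one, smul_toK]
    simp [bv, Pi.single_apply, toK, hs]
  have he := congrArg (fun x : OmegaMod A₂ m₂ 1 => (x : RForm ℓ 1)) (congrArg e hsum)
  simp only [map_smul, map_sum, Submodule.coe_smul, Submodule.coe_sum] at he
  have evs : ∀ (t : Finset (Fin ℓ)) (G : Fin ℓ → RForm ℓ 1),
      ev (∑ j ∈ t, G j) (fun _ => θ) = ∑ j ∈ t, ev (G j) (fun _ => θ) := by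
    intro t G
    induction t using Finset.induction_on with
    | empty => simp [ev_apply]
    | insert a t ha ih =>
      rw [Finset.sum_insert ha, Finset.sum_insert ha, ev_add, AlternatingMap.add_apply, ih]
  have he2 := congrArg (fun x : RForm ℓ 1 => ev x (fun _ => θ)) he
  simp only [smul_toK, ev_smul, AlternatingMap.smul_apply, evs, smul_eq_mul] at he2
  have hQ0 : toK (Qpoly A₁ m₁) ≠ 0 :=
    toK_ne (Finset.prod_ne_zero_iff.2 fun α hα => pow_ne_zero _ (h₁.1 α hα).2)
  apply mul_left_cancel₀ hQ0
  rw [he2, hv, ev_one, Finset.mul_sum]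
  refine Finset.sum_congr rfl fun j _ => ?_
  rw [hτ, ← mul_assoc, ← hs]

lemma Phi_mem {A₁ A₂ : Finset (Spoly ℓ)} (h₁ : IsArrangement A₁) (h₂ : IsArrangement A₂)
    (m₁ m₂ : Spoly ℓ → ℕ) (e : OmegaMod A₁ m₁ 1 →ₗ[Spoly ℓ] OmegaMod A₂ m₂ 1)
    (τ : VV ℓ →ₗ[Frac ℓ] VV ℓ)
    (hτ : ∀ (ω : OmegaMod A₁ m₁ 1) θ, ev (e ω : RForm ℓ 1) (fun _ => θ) =
        ev (ω : RForm ℓ 1) (fun _ => τ θ)) {p : ℕ} {ω : RForm ℓ p} (hω : ω ∈ OmegaMod A₁ m₁ p) :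
    Phi τ ω ∈ OmegaMod A₂ m₂ p := by
  apply omega_of_ev h₂
  intro θ hθ
  rw [ev_Phi, AlternatingMap.compLinearMap_apply]
  apply ev_mem_of_omega h₁ m₁ hω
  intro a η hη
  have := hθ a (e ⟨η, hη⟩ : RForm ℓ 1) (e ⟨η, hη⟩).2
  rw [hτ] at this
  exact this

/-- If `Ω¹(𝒜₁, m₁) ≅ Ω¹(𝒜₂, m₂)` as graded `S`-modules, then
`Ω^p(𝒜₁, m₁) ≅ Ω^p(𝒜₂, m₂)` as graded `S`-modules for every `p`. -/
theorem omega_p_graded_iso (ℓ : ℕ) (A₁ A₂ : Finset (Spoly ℓ))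
    (h₁ : IsArrangement A₁) (h₂ : IsArrangement A₂) (m₁ m₂ : Spoly ℓ → ℕ)
    (h : GradedIsoForms (OmegaMod A₁ m₁ 1) (OmegaMod A₂ m₂ 1)) :
    ∀ p : ℕ, GradedIsoForms (OmegaMod A₁ m₁ p) (OmegaMod A₂ m₂ p) := by
  intro p
  obtain ⟨e, he⟩ := h
  obtain ⟨τ, hτ, hτj⟩ := exists_transpose h₁ m₁ m₂ e.toLinearMap
  obtain ⟨τ', hτ', hτj'⟩ := exists_transpose h₂ m₂ m₁ e.symm.toLinearMap
  have inv1 : ∀ θ, τ (τ' θ) = θ := by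
    intro θ
    funext j
    rw [hτj, ← hτ']
    simp [dx, ev_one, bv, Pi.single_apply]
  have inv2 : ∀ θ, τ' (τ θ) = θ := by
    intro θ
    funext j
    rw [hτj', ← hτ]
    simp [dx, ev_one, bv, Pi.single_apply]
  have hom1 : ∀ i j, IsHomogFrac (τ (bv i) j) 0 := by
    intro i j
    rw [hτj]
    obtain ⟨I, hI⟩ := const_one_vals (e.toLinearMap (dx h₁ m₁ j) : RForm ℓ 1) i
    rw [hI]
    exact (he (dx h₁ m₁ j) 0).1 (one_bv_hom j) I
  have hom2 : ∀ i j, IsHomogFrac (τ' (bv i) j) 0 := by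
    intro i j
    rw [hτj']
    obtain ⟨I, hI⟩ := const_one_vals (e.symm.toLinearMap (dx h₂ m₂ j) : RForm ℓ 1) i
    rw [hI]
    refine (he (e.symm (dx h₂ m₂ j)) 0).2 ?_ I
    rw [LinearEquiv.apply_symm_apply]
    exact one_bv_hom j
  refine ⟨{ toFun := fun ω => ⟨Phi τ ω.1, Phi_mem h₁ h₂ m₁ m₂ e.toLinearMap τ hτ ω.2⟩
            map_add' := fun x y => Subtype.ext (Phi_add τ _ _)
            map_smul' := fun c x => Subtype.ext (Phi_smul τ c _)
            invFun := fun ω => ⟨Phi τ' ω.1, Phi_mem h₂ h₁ m₂ m₁ e.symm.toLinearMap τ' hτ' ω.2⟩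
            left_inv := fun x => Subtype.ext (Phi_inv τ τ' inv1 _)
            right_inv := fun x => Subtype.ext (Phi_inv τ' τ inv2 _) }, ?_⟩
  intro ω d
  constructor
  · intro hω
    exact Phi_hom τ hom1 _ d hω
  · intro hω
    have := Phi_hom τ' hom2 _ d hω
    change IsHomogForm (Phi τ' (Phi τ ω.1)) d at this
    rwa [Phi_inv τ τ' inv1] at this
end
end

section
/- (Solomon–Terao formula) Let A be a central arrangement in ℂ^ℓ. Let H(Ω^p(A), x) denote the Hilbert series of the graded S-module Ω^p(A) = Ω^p(A, 1) (a formal Laurent series in x), and set Φ(A; x, y) = Σ_{p=0}^ℓ H(Ω^p(A), x)·y^p. Then Φ(A; x, t(1−x)−1), regarded as a polynomial in t whose coefficients are rational functions of x, is regular at x = 1, and χ(A, t) = lim_{x→1} Φ(A; x, t(1−x)−1). -/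
open MvPolynomial

noncomputable section

attribute [local instance] Classical.propDecidable

variable {ℓ : ℕ}

def linFun (α : Spoly ℓ) : (Fin ℓ → ℂ) →ₗ[ℂ] ℂ :=
  ∑ i, MvPolynomial.coeff (Finsupp.single i 1) α • LinearMap.proj i

/-- The intersection lattice `L(𝒜)`. -/
def LA (A : Finset (Spoly ℓ)) : Finset (Submodule ℂ (Fin ℓ → ℂ)) :=
  A.powerset.image (fun B => ⨅ α ∈ B, LinearMap.ker (linFun α))

/-- `μ` is the Möbius function of `L(𝒜)` (ordered by reverse inclusion). -/
def IsMoebius (A : Finset (Spoly ℓ)) (μ : Submodule ℂ (Fin ℓ → ℂ) → ℤ) : Prop :=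
  μ ⊤ = 1 ∧
    ∀ Z ∈ LA A, Z ≠ ⊤ → ∑ Y ∈ (LA A).filter (fun Y => Z ≤ Y), μ Y = 0

/-- The degree-`d` graded piece of `Ω^p(𝒜, m)` (the `ℂ`-span of its homogeneous
degree-`d` elements). -/
def OmegaPiece (A : Finset (Spoly ℓ)) (m : Spoly ℓ → ℕ) (p : ℕ) (d : ℤ) :
    Submodule ℂ (RForm ℓ p) :=
  Submodule.span ℂ {ω : RForm ℓ p | ω ∈ OmegaMod A m p ∧ IsHomogForm ω d}

namespace ST
section ext
variable {ι : Type*} [LinearOrder ι] {N : Type*} [AddCommGroup N]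

lemma card_ins {i : ι} {I : Finset ι} (h : i ∉ I) : (insert i I).card = I.card + 1 :=
  Finset.card_insert_of_notMem h

lemma card_er {i : ι} {I : Finset ι} (h : i ∈ I) : (I.erase i).card + 1 = I.card :=
  Finset.card_erase_add_one h

def sg (i : ι) (I : Finset ι) : ℤ := (-1) ^ (I.filter (fun j => j < i)).card

lemma sg_mul_self (i : ι) (I : Finset ι) : sg i I * sg i I = 1 := by
  unfold sg; rw [← mul_pow]; simp

lemma sg_insert (i j : ι) (I : Finset ι) (h : j ∉ I) :
    sg i (insert j I) = (if j < i then -1 else 1) * sg i I := by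
  unfold sg
  rw [Finset.filter_insert]
  split_ifs with h1
  · rw [Finset.card_insert_of_notMem (by simp [h]), pow_succ]; ring
  · simp

lemma sg_insert_self (i : ι) (I : Finset ι) : sg i (insert i I) = sg i I := by
  by_cases h : i ∈ I
  · rw [Finset.insert_eq_of_mem h]
  · rw [sg_insert _ _ _ h]; simp

lemma sg_erase (i j : ι) (I : Finset ι) (h : j ∈ I) :
    sg i (I.erase j) = (if j < i then -1 else 1) * sg i I := by
  conv_rhs => rw [← Finset.insert_erase h]
  rw [sg_insert _ _ _ (by simp)]
  split_ifs <;> ring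

lemma sg_erase_self (i : ι) (I : Finset ι) : sg i (I.erase i) = sg i I := by
  by_cases h : i ∈ I
  · rw [sg_erase _ _ _ h]; simp
  · rw [Finset.erase_eq_of_notMem h]

/-- left multiplication by `e_i` -/
def W (i : ι) (f : Finset ι → N) : Finset ι → N :=
  fun I => if i ∈ I then sg i I • f (I.erase i) else 0

/-- contraction by `e_i` -/
def D (i : ι) (f : Finset ι → N) : Finset ι → N :=
  fun I => if i ∈ I then 0 else sg i I • f (insert i I)

lemma lt_neg {i j : ι} (h : i ≠ j) :
    (if j < i then (-1 : ℤ) else 1) = - (if i < j then -1 else 1) := by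
  rcases lt_or_gt_of_ne h with h1 | h1
  · simp [h1, h1.le, not_lt.mpr h1.le]
  · simp [h1, not_lt.mpr h1.le]

lemma WW (i j : ι) (f : Finset ι → N) : W i (W j f) = - W j (W i f) := by
  funext I
  simp only [W, Pi.neg_apply, Finset.mem_erase]
  by_cases hij : i = j
  · subst hij; simp
  by_cases hi : i ∈ I <;> by_cases hj : j ∈ I <;> simp [hi, hj, hij, Ne.symm hij]
  rw [sg_erase _ _ _ hi, sg_erase _ _ _ hj, Finset.erase_right_comm, smul_smul, smul_smul,
    ← neg_smul, lt_neg hij]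
  congr 1; ring

lemma DD (i j : ι) (f : Finset ι → N) : D i (D j f) = - D j (D i f) := by
  funext I
  simp only [D, Pi.neg_apply, Finset.mem_insert]
  by_cases hij : i = j
  · subst hij; simp
  by_cases hi : i ∈ I <;> by_cases hj : j ∈ I <;> simp [hi, hj, hij, Ne.symm hij]
  rw [sg_insert _ _ _ hi, sg_insert _ _ _ hj, Finset.insert_comm, smul_smul, smul_smul,
    ← neg_smul, lt_neg hij]
  congr 1; ring

lemma WD_ne (i j : ι) (hij : i ≠ j) (f : Finset ι → N) : W i (D j f) = - D j (W i f) := by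
  funext I
  simp only [W, D, Pi.neg_apply, Finset.mem_insert, Finset.mem_erase]
  by_cases hi : i ∈ I <;> by_cases hj : j ∈ I <;> simp [hi, hj, hij, Ne.symm hij]
  rw [sg_erase _ _ _ hi, sg_insert _ _ _ hj, smul_smul, smul_smul,
    ← neg_smul, lt_neg hij]
  have : (insert j I).erase i = insert j (I.erase i) := by
    ext x; simp only [Finset.mem_erase, Finset.mem_insert]; constructor
    · rintro ⟨h1, h2 | h2⟩ <;> simp [*]
    · rintro (h2 | ⟨h1, h2⟩)
      · subst h2; exact ⟨Ne.symm hij, Or.inl rfl⟩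
      · exact ⟨h1, Or.inr h2⟩
  rw [this]
  congr 1; ring

lemma WD_self (i : ι) (f : Finset ι → N) : W i (D i f) + D i (W i f) = f := by
  funext I
  simp only [W, D, Pi.add_apply]
  by_cases hi : i ∈ I
  · simp [hi, sg_erase_self, smul_smul, sg_mul_self, Finset.insert_erase]
  · simp [hi, sg_insert_self, smul_smul, sg_mul_self, Finset.erase_insert]

variable {R : Type*} [CommRing R] [Module R N]

lemma W_add (i : ι) (f g : Finset ι → N) : W i (f + g) = W i f + W i g := by
  funext I; simp only [W, Pi.add_apply]; split_ifs <;> simp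
lemma D_add (i : ι) (f g : Finset ι → N) : D i (f + g) = D i f + D i g := by
  funext I; simp only [D, Pi.add_apply]; split_ifs <;> simp
lemma W_smul (i : ι) (r : R) (f : Finset ι → N) : W i (r • f) = r • W i f := by
  funext I; simp only [W, Pi.smul_apply]; split_ifs
  · rw [smul_comm]
  · simp
lemma D_smul (i : ι) (r : R) (f : Finset ι → N) : D i (r • f) = r • D i f := by
  funext I; simp only [D, Pi.smul_apply]; split_ifs
  · simp
  · rw [smul_comm]

variable [Fintype ι]

/-- `a ∧ -` -/
def wedge (a : ι → R) : (Finset ι → N) →ₗ[R] (Finset ι → N) where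
  toFun f := ∑ i, a i • W i f
  map_add' f g := by simp [W_add, Finset.sum_add_distrib]
  map_smul' r f := by
    simp only [W_smul, RingHom.id_apply, Finset.smul_sum]
    exact Finset.sum_congr rfl fun i _ => smul_comm _ _ _

/-- contraction by `v` -/
def contr (v : ι → R) : (Finset ι → N) →ₗ[R] (Finset ι → N) where
  toFun f := ∑ i, v i • D i f
  map_add' f g := by simp [D_add, Finset.sum_add_distrib]
  map_smul' r f := by
    simp only [D_smul, RingHom.id_apply, Finset.smul_sum]
    exact Finset.sum_congr rfl fun i _ => smul_comm _ _ _

lemma wedge_apply (a : ι → R) (f : Finset ι → N) : wedge a f = ∑ i, a i • W i f := rfl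
lemma contr_apply (a : ι → R) (f : Finset ι → N) : contr a f = ∑ i, a i • D i f := rfl

def Wl (i : ι) : (Finset ι → N) →ₗ[R] (Finset ι → N) :=
  ⟨⟨W i, W_add i⟩, fun r f => W_smul i r f⟩
def Dl (i : ι) : (Finset ι → N) →ₗ[R] (Finset ι → N) :=
  ⟨⟨D i, D_add i⟩, fun r f => D_smul i r f⟩

lemma W_sum (i : ι) (a : ι → R) (g : ι → Finset ι → N) :
    W i (∑ j, a j • g j) = ∑ j, a j • W i (g j) := by
  have := map_sum (Wl (R := R) (N := N) i) (fun j => a j • g j) Finset.univ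
  simp only [map_smul] at this
  exact this
lemma D_sum (i : ι) (a : ι → R) (g : ι → Finset ι → N) :
    D i (∑ j, a j • g j) = ∑ j, a j • D i (g j) := by
  have := map_sum (Dl (R := R) (N := N) i) (fun j => a j • g j) Finset.univ
  simp only [map_smul] at this
  exact this

lemma wedge_wedge (a b : ι → R) (f : Finset ι → N) :
    wedge a (wedge b f) = - wedge b (wedge a f) := by
  simp only [wedge_apply, W_sum, Finset.smul_sum]
  rw [Finset.sum_comm, ← Finset.sum_neg_distrib]
  refine Finset.sum_congr rfl fun i _ => ?_
  rw [← Finset.sum_neg_distrib]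
  refine Finset.sum_congr rfl fun j _ => ?_
  rw [WW j i, smul_comm]; simp

lemma contr_contr (a b : ι → R) (f : Finset ι → N) :
    contr a (contr b f) = - contr b (contr a f) := by
  simp only [contr_apply, D_sum, Finset.smul_sum]
  rw [Finset.sum_comm, ← Finset.sum_neg_distrib]
  refine Finset.sum_congr rfl fun i _ => ?_
  rw [← Finset.sum_neg_distrib]
  refine Finset.sum_congr rfl fun j _ => ?_
  rw [DD j i, smul_comm]; simp

lemma wedge_contr (a v : ι → R) (f : Finset ι → N) :
    wedge a (contr v f) + contr v (wedge a f) = (∑ i, a i * v i) • f := by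
  simp only [wedge_apply, contr_apply, D_sum, W_sum, Finset.smul_sum]
  rw [Finset.sum_comm (s := Finset.univ) (t := Finset.univ) (f := fun i j => v i • a j • D i (W j f)),
    ← Finset.sum_add_distrib, Finset.sum_smul]
  refine Finset.sum_congr rfl fun i _ => ?_
  rw [← Finset.sum_add_distrib, Finset.sum_eq_single i]
  · rw [smul_comm (v i), ← smul_add, ← smul_add, WD_self, smul_smul]
  · intro j _ hj
    rw [WD_ne i j (Ne.symm hj), smul_comm (v j)]; simp
  · simp

lemma self_neg_zero [Module ℚ N] {f : Finset ι → N} (h : f = - f) : f = 0 := by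
  have h2 : (2 : ℚ) • f = 0 := by rw [two_smul]; nth_rw 1 [h]; simp
  simpa using h2

lemma wedge_self [Module ℚ N] (a : ι → R) (f : Finset ι → N) : wedge a (wedge a f) = 0 :=
  self_neg_zero (wedge_wedge a a f)
lemma contr_self [Module ℚ N] (a : ι → R) (f : Finset ι → N) : contr a (contr a f) = 0 :=
  self_neg_zero (contr_contr a a f)

lemma wedge_coeff (a : ι → R) (f : Finset ι → N) (J : Finset ι) :
    wedge a f J = ∑ j ∈ J, a j • (sg j J • f (J.erase j)) := by
  rw [wedge_apply, Finset.sum_apply]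
  simp only [Pi.smul_apply, W, smul_ite, smul_zero]
  rw [Finset.sum_ite_mem, Finset.univ_inter]

lemma contr_coeff (a : ι → R) (f : Finset ι → N) (J : Finset ι) :
    contr a f J = ∑ j, if j ∈ J then 0 else a j • (sg j J • f (insert j J)) := by
  rw [contr_apply, Finset.sum_apply]
  simp only [Pi.smul_apply, D, smul_ite, smul_zero]
end ext
end ST

namespace ST
section gr
variable {ℓ : ℕ} {ι : Type*}

/-- componentwise homogeneous component -/
def hc (d : ℕ) : (ι → Spoly ℓ) →ₗ[ℂ] (ι → Spoly ℓ) where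
  toFun ψ := fun i => homogeneousComponent d (ψ i)
  map_add' f g := by funext i; simp
  map_smul' r f := by funext i; simp

lemma hc_apply (d : ℕ) (ψ : ι → Spoly ℓ) (i : ι) : hc d ψ i = homogeneousComponent d (ψ i) := rfl

def Fd (ι : Type*) (ℓ d : ℕ) : Submodule ℂ (ι → Spoly ℓ) where
  carrier := {ψ | ∀ i, (ψ i).IsHomogeneous d}
  add_mem' h1 h2 := fun i => (h1 i).add (h2 i)
  zero_mem' := fun i => isHomogeneous_zero _ _ _
  smul_mem' r f h := fun i => by
    have := (h i).C_mul r
    rwa [← smul_eq_C_mul] at this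

lemma mem_Fd {d : ℕ} {ψ : ι → Spoly ℓ} : ψ ∈ Fd ι ℓ d ↔ ∀ i, (ψ i).IsHomogeneous d := Iff.rfl

lemma hc_mem_Fd (d : ℕ) (ψ : ι → Spoly ℓ) : hc d ψ ∈ Fd ι ℓ d :=
  fun _ => homogeneousComponent_isHomogeneous _ _

lemma hc_of_mem {d : ℕ} {ψ : ι → Spoly ℓ} (h : ψ ∈ Fd ι ℓ d) : hc d ψ = ψ := by
  funext i
  rw [hc_apply, homogeneousComponent_of_mem (h i), if_pos rfl]

lemma homog_mul {a : ℕ} {f : Spoly ℓ} (hf : f.IsHomogeneous a) (g : Spoly ℓ) (d : ℕ) :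
    homogeneousComponent d (f * g) =
      if a ≤ d then f * homogeneousComponent (d - a) g else 0 := by
  conv_lhs => rw [← sum_homogeneousComponent g, Finset.mul_sum, map_sum]
  have h1 : ∀ i, homogeneousComponent d (f * homogeneousComponent i g) =
      if a + i = d then f * homogeneousComponent i g else 0 := by
    intro i
    rw [homogeneousComponent_of_mem (hf.mul (homogeneousComponent_isHomogeneous i g))]
    simp only [eq_comm]
  simp only [h1]
  split_ifs with h
  · obtain ⟨b, rfl⟩ := Nat.exists_eq_add_of_le h
    simp only [add_right_inj, add_tsub_cancel_left]
    rw [Finset.sum_ite_eq']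
    split_ifs with h2
    · rfl
    · rw [homogeneousComponent_eq_zero, mul_zero]
      simpa using h2
  · apply Finset.sum_eq_zero
    intro i _
    rw [if_neg]; omega

lemma hc_smul {a : ℕ} {f : Spoly ℓ} (hf : f.IsHomogeneous a) (ψ : ι → Spoly ℓ) (d : ℕ) :
    hc d (f • ψ) = if a ≤ d then f • hc (d - a) ψ else 0 := by
  funext i
  rw [hc_apply, Pi.smul_apply, smul_eq_mul, homog_mul hf]
  split_ifs <;> rfl

lemma smul_mem_Fd {a d : ℕ} {f : Spoly ℓ} (hf : f.IsHomogeneous a) {ψ : ι → Spoly ℓ}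
    (h : ψ ∈ Fd ι ℓ d) : f • ψ ∈ Fd ι ℓ (d + a) := fun i => by
  rw [add_comm]; exact hf.mul (h i)

def IsGr (N : Submodule (Spoly ℓ) (ι → Spoly ℓ)) : Prop := ∀ ψ ∈ N, ∀ d, hc d ψ ∈ N

lemma IsGr.inf {N N' : Submodule (Spoly ℓ) (ι → Spoly ℓ)} (h : IsGr N) (h' : IsGr N') :
    IsGr (N ⊓ N') := fun ψ hψ d => ⟨h ψ hψ.1 d, h' ψ hψ.2 d⟩

lemma IsGr.sup {N N' : Submodule (Spoly ℓ) (ι → Spoly ℓ)} (h : IsGr N) (h' : IsGr N') :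
    IsGr (N ⊔ N') := by
  intro ψ hψ d
  obtain ⟨a, ha, b, hb, rfl⟩ := Submodule.mem_sup.1 hψ
  rw [map_add]
  exact Submodule.add_mem_sup (h a ha d) (h' b hb d)

lemma isGr_bot : IsGr (⊥ : Submodule (Spoly ℓ) (ι → Spoly ℓ)) := by
  intro ψ hψ d
  rw [Submodule.mem_bot] at *
  simp [hψ]

/-- degree `d` piece -/
def pc (N : Submodule (Spoly ℓ) (ι → Spoly ℓ)) (d : ℕ) : Submodule ℂ (ι → Spoly ℓ) :=
  N.restrictScalars ℂ ⊓ Fd ι ℓ d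

lemma mem_pc {N : Submodule (Spoly ℓ) (ι → Spoly ℓ)} {d : ℕ} {ψ : ι → Spoly ℓ} :
    ψ ∈ pc N d ↔ ψ ∈ N ∧ ψ ∈ Fd ι ℓ d := Iff.rfl

lemma pc_mono {N N' : Submodule (Spoly ℓ) (ι → Spoly ℓ)} (h : N ≤ N') (d : ℕ) :
    pc N d ≤ pc N' d := fun _ hx => ⟨h hx.1, hx.2⟩

instance fin_hom (d : ℕ) : FiniteDimensional ℂ (homogeneousSubmodule (Fin ℓ) ℂ d) :=
  Module.Finite.iff_fg.mpr (homogeneousSubmodule_fg _ _ d)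

instance fin_Fd [Finite ι] (d : ℕ) : FiniteDimensional ℂ (Fd ι ℓ d) := by
  let φ : Fd ι ℓ d →ₗ[ℂ] (ι → homogeneousSubmodule (Fin ℓ) ℂ d) :=
    { toFun := fun ψ i => ⟨ψ.1 i, ψ.2 i⟩
      map_add' := fun _ _ => rfl
      map_smul' := fun _ _ => rfl }
  refine Module.Finite.of_injective φ ?_
  intro a b h
  ext1; funext i
  exact congrArg Subtype.val (congrFun h i)

instance fin_pc [Finite ι] (N : Submodule (Spoly ℓ) (ι → Spoly ℓ)) (d : ℕ) :
    FiniteDimensional ℂ (pc N d) :=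
  Submodule.finiteDimensional_of_le (inf_le_right : pc N d ≤ Fd ι ℓ d)

/-- Hilbert function -/
def hf (N : Submodule (Spoly ℓ) (ι → Spoly ℓ)) (d : ℕ) : ℕ := Module.finrank ℂ (pc N d)

/-- Hilbert series -/
def hs (N : Submodule (Spoly ℓ) (ι → Spoly ℓ)) : PowerSeries ℚ := PowerSeries.mk fun d => (hf N d : ℚ)

lemma rankNull {V V' : Type*} [AddCommGroup V] [Module ℂ V] [AddCommGroup V'] [Module ℂ V']
    (T : V →ₗ[ℂ] V') (P : Submodule ℂ V) [FiniteDimensional ℂ P] :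
    Module.finrank ℂ P = Module.finrank ℂ (P ⊓ LinearMap.ker T : Submodule ℂ V)
      + Module.finrank ℂ (P.map T) := by
  have h := LinearMap.finrank_range_add_finrank_ker (T.domRestrict P)
  rw [LinearMap.range_domRestrict, LinearMap.ker_domRestrict] at h
  have e : Module.finrank ℂ (P ⊓ LinearMap.ker T : Submodule ℂ V) =
      Module.finrank ℂ ((LinearMap.ker T).comap P.subtype) := by
    rw [← Submodule.map_comap_subtype]
    exact Submodule.finrank_map_subtype_eq _ _
  omega

/-- multiplication by a polynomial as a `ℂ`-linear map -/
def mulL (ι : Type*) (y : Spoly ℓ) : (ι → Spoly ℓ) →ₗ[ℂ] (ι → Spoly ℓ) where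
  toFun ψ := y • ψ
  map_add' := smul_add y
  map_smul' r ψ := smul_comm y r ψ

/-- `N ⊓ (N' : y)` -/
def colonK (N N' : Submodule (Spoly ℓ) (ι → Spoly ℓ)) (y : Spoly ℓ) :
    Submodule (Spoly ℓ) (ι → Spoly ℓ) := N ⊓ N'.comap (LinearMap.lsmul (Spoly ℓ) _ y)

def yN (N : Submodule (Spoly ℓ) (ι → Spoly ℓ)) (y : Spoly ℓ) :
    Submodule (Spoly ℓ) (ι → Spoly ℓ) := N.map (LinearMap.lsmul (Spoly ℓ) _ y)

lemma hc_lin {y : Spoly ℓ} (hy : y.IsHomogeneous 1) (ψ : ι → Spoly ℓ) (d : ℕ) :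
    hc (d + 1) (y • ψ) = y • hc d ψ := by
  rw [hc_smul hy]; simp

lemma hc_lin0 {y : Spoly ℓ} (hy : y.IsHomogeneous 1) (ψ : ι → Spoly ℓ) :
    hc 0 (y • ψ) = 0 := by
  rw [hc_smul hy]; simp

lemma colonK_gr {N N' : Submodule (Spoly ℓ) (ι → Spoly ℓ)} (h : IsGr N) (h' : IsGr N')
    {y : Spoly ℓ} (hy : y.IsHomogeneous 1) : IsGr (colonK N N' y) := by
  rintro ψ ⟨h1, h2⟩ d
  refine ⟨h ψ h1 d, ?_⟩
  have := h' _ h2 (d + 1)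
  simp only [LinearMap.lsmul_apply] at this
  rw [hc_lin hy] at this
  simpa using this

lemma yN_gr {N : Submodule (Spoly ℓ) (ι → Spoly ℓ)} (h : IsGr N)
    {y : Spoly ℓ} (hy : y.IsHomogeneous 1) : IsGr (yN N y) := by
  rintro ψ ⟨n, hn, rfl⟩ d
  simp only [LinearMap.lsmul_apply]
  cases d with
  | zero => rw [hc_lin0 hy]; exact zero_mem _
  | succ d => rw [hc_lin hy]; exact ⟨_, h n hn d, rfl⟩

lemma dim_step [Finite ι] {N N' : Submodule (Spoly ℓ) (ι → Spoly ℓ)} (h : IsGr N) (h' : IsGr N')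
    {y : Spoly ℓ} (hy : y.IsHomogeneous 1) (d : ℕ) :
    hf (N' ⊔ yN N y) (d + 1) + hf (colonK N N' y) d = hf N' (d + 1) + hf N d := by
  let T := (pc N' (d+1)).mkQ.comp (mulL ι y)
  have e1 := rankNull T (pc N d)
  have e2 := rankNull (pc N' (d+1)).mkQ (pc (N' ⊔ yN N y) (d+1))
  have h1 : pc N d ⊓ LinearMap.ker T = pc (colonK N N' y) d := by
    ext ψ
    simp only [T, Submodule.mem_inf, LinearMap.mem_ker, LinearMap.comp_apply, Submodule.mkQ_apply,
      Submodule.Quotient.mk_eq_zero, mem_pc, colonK, Submodule.mem_comap, LinearMap.lsmul_apply]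
    constructor
    · rintro ⟨⟨a, b⟩, c, -⟩; exact ⟨⟨a, c⟩, b⟩
    · rintro ⟨⟨a, c⟩, b⟩; exact ⟨⟨a, b⟩, c, smul_mem_Fd hy b⟩
  have h2 : pc (N' ⊔ yN N y) (d+1) ⊓ LinearMap.ker (pc N' (d+1)).mkQ = pc N' (d+1) := by
    rw [Submodule.ker_mkQ, inf_eq_right]
    exact pc_mono le_sup_left _
  have h3 : (pc (N' ⊔ yN N y) (d+1)).map (pc N' (d+1)).mkQ = (pc N d).map T := by
    apply le_antisymm
    · rintro _ ⟨ψ, ⟨hψ, hd⟩, rfl⟩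
      obtain ⟨a, ha, b, ⟨n, hn, rfl⟩, hab⟩ := Submodule.mem_sup.1 hψ
      refine ⟨hc d n, ⟨h n hn d, hc_mem_Fd d n⟩, ?_⟩
      simp only [T, LinearMap.comp_apply, Submodule.mkQ_apply]
      rw [Submodule.Quotient.eq]
      have : ψ = hc (d+1) a + y • hc d n := by
        rw [← hc_of_mem hd, ← hab, map_add]
        simp only [LinearMap.lsmul_apply]
        rw [hc_lin hy]
      rw [this]
      have e : (mulL ι y) (hc d n) - (hc (d + 1) a + y • hc d n) = - hc (d+1) a := by
        change y • hc d n - _ = _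
        abel
      rw [e]
      exact neg_mem ⟨h' a ha _, hc_mem_Fd _ _⟩
    · rintro _ ⟨ψ, ⟨hψ, hd⟩, rfl⟩
      exact ⟨y • ψ, ⟨Submodule.mem_sup_right ⟨ψ, hψ, rfl⟩, smul_mem_Fd hy hd⟩, rfl⟩
  rw [h1] at e1
  rw [h2, h3] at e2
  unfold hf
  omega

lemma dim_step0 {N N' : Submodule (Spoly ℓ) (ι → Spoly ℓ)} 
    {y : Spoly ℓ} (hy : y.IsHomogeneous 1) (h' : IsGr N') :
    hf (N' ⊔ yN N y) 0 = hf N' 0 := by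
  have : pc (N' ⊔ yN N y) 0 = pc N' 0 := by
    apply le_antisymm _ (pc_mono le_sup_left _)
    rintro ψ ⟨hψ, hd⟩
    obtain ⟨a, ha, b, ⟨n, hn, rfl⟩, hab⟩ := Submodule.mem_sup.1 hψ
    have : ψ = hc 0 a := by
      rw [← hc_of_mem hd, ← hab, map_add]
      simp only [LinearMap.lsmul_apply]
      rw [hc_lin0 hy, add_zero]
    rw [this]
    exact ⟨h' a ha _, hc_mem_Fd _ _⟩
  unfold hf; rw [this]

lemma ps_poly (f : PowerSeries ℚ) (D : ℕ) (h : ∀ d ≥ D, PowerSeries.coeff d f = 0) :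
    ∃ g : Polynomial ℚ, f = (g : PowerSeries ℚ) := by
  refine ⟨f.trunc D, ?_⟩
  ext d
  rw [Polynomial.coeff_coe, PowerSeries.coeff_trunc]
  split_ifs with h1
  · rfl
  · exact h d (not_lt.1 h1)

lemma hs_base [Finite ι] {N N' : Submodule (Spoly ℓ) (ι → Spoly ℓ)} (h : IsGr N)
    (hle : N' ≤ N) (J : Ideal (Spoly ℓ)) (hJ : ∀ q ∈ J, ∀ n ∈ N, q • n ∈ N') (e : ℕ)
    (he : ∀ a ≥ e, ∀ f : Spoly ℓ, f.IsHomogeneous a → f ∈ J) :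
    ∃ g : Polynomial ℚ, hs N - hs N' = (g : PowerSeries ℚ) := by
  obtain ⟨s, hs'⟩ := (IsNoetherian.noetherian N : N.FG)
  obtain ⟨D, hD⟩ : ∃ D, ∀ n ∈ s, ∀ i, (n i).totalDegree ≤ D := by
    cases nonempty_fintype ι
    refine ⟨s.sup fun n => Finset.univ.sup fun i => (n i).totalDegree, fun n hn i => ?_⟩
    exact (Finset.le_sup (f := fun i => (n i).totalDegree) (Finset.mem_univ i)).trans
      (Finset.le_sup (f := fun n : ι → Spoly ℓ => Finset.univ.sup fun i => (n i).totalDegree) hn)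
  refine ps_poly _ (D + e) fun d hd => ?_
  have : pc N d = pc N' d := by
    apply le_antisymm _ (pc_mono hle _)
    rintro ψ ⟨hψ, hψd⟩
    refine ⟨?_, hψd⟩
    change ψ ∈ N'
    rw [← hc_of_mem hψd]
    have hψ' : ψ ∈ Submodule.span (Spoly ℓ) (s : Set (ι → Spoly ℓ)) := by rw [hs']; exact hψ
    obtain ⟨c, -, hc'⟩ := Submodule.mem_span_finset.1 hψ'
    rw [← hc', map_sum]
    refine Submodule.sum_mem _ fun n hn => ?_
    rw [← sum_homogeneousComponent (c n), Finset.sum_smul, map_sum]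
    refine Submodule.sum_mem _ fun a _ => ?_
    rw [hc_smul (homogeneousComponent_isHomogeneous _ _)]
    split_ifs with h1
    · by_cases h2 : e ≤ a
      · apply hJ _ (he a h2 _ (homogeneousComponent_isHomogeneous _ _))
        apply h
        rw [← hs']; exact Submodule.subset_span hn
      · have : hc (d - a) n = 0 := by
          funext i
          rw [hc_apply, homogeneousComponent_eq_zero]; rfl
          have := hD n hn i
          omega
        rw [this, smul_zero]; exact zero_mem _
    · exact zero_mem _
  simp only [hs, hf, map_sub, PowerSeries.coeff_mk]
  rw [this, sub_self]

/-- Hilbert–Serre for subquotients of free modules -/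
theorem hilbert_serre [Finite ι] (ys : List (Spoly ℓ)) (hy : ∀ y ∈ ys, y.IsHomogeneous 1) :
    ∀ (N N' : Submodule (Spoly ℓ) (ι → Spoly ℓ)) (_ : IsGr N) (_ : IsGr N')
    (_ : N' ≤ N) (J : Ideal (Spoly ℓ)) (_ : ∀ q ∈ J, ∀ n ∈ N, q • n ∈ N') (e : ℕ)
    (_ : ∀ a ≥ e, ∀ f : Spoly ℓ, f.IsHomogeneous a → f ∈ J ⊔ Ideal.span {y | y ∈ ys}),
    ∃ g : Polynomial ℚ, (1 - PowerSeries.X) ^ ys.length * (hs N - hs N') = (g : PowerSeries ℚ) := by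
  induction ys with
  | nil =>
    intro N N' h h' hle J hJ e he
    obtain ⟨g, hg⟩ := hs_base h hle J hJ e (by simpa using he)
    exact ⟨g, by simpa using hg⟩
  | cons y ys ih =>
    intro N N' h h' hle J hJ e he
    have hy1 := hy y (by simp)
    have hy2 : ∀ y ∈ ys, y.IsHomogeneous 1 := fun z hz => hy z (by simp [hz])
    have he' : ∀ a ≥ e, ∀ f : Spoly ℓ, f.IsHomogeneous a →
        f ∈ (J ⊔ Ideal.span {y}) ⊔ Ideal.span {y | y ∈ ys} := by
      intro a ha f hf
      have := he a ha f hf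
      rw [sup_assoc, ← Ideal.span_union]
      convert this using 3
      ext z; simp
    have hyN : ∀ n ∈ N, y • n ∈ N' ⊔ yN N y := fun n hn => Submodule.mem_sup_right ⟨n, hn, rfl⟩
    obtain ⟨g1, hg1⟩ := ih hy2 N (N' ⊔ yN N y) h (h'.sup (yN_gr h hy1))
      (sup_le hle (by rintro _ ⟨n, hn, rfl⟩; exact N.smul_mem _ hn)) (J ⊔ Ideal.span {y})
      (by
        intro q hq n hn
        obtain ⟨a, ha, b, hb, rfl⟩ := Submodule.mem_sup.1 hq
        obtain ⟨b, rfl⟩ := Ideal.mem_span_singleton'.1 hb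
        rw [add_smul, mul_smul]
        exact add_mem (Submodule.mem_sup_left (hJ a ha n hn)) (Submodule.smul_mem _ _ (hyN n hn)))
      e he'
    obtain ⟨g2, hg2⟩ := ih hy2 (colonK N N' y) N' (colonK_gr h h' hy1) h'
      (fun n hn => ⟨hle hn, by simpa using N'.smul_mem y hn⟩) (J ⊔ Ideal.span {y})
      (by
        intro q hq n hn
        obtain ⟨a, ha, b, hb, rfl⟩ := Submodule.mem_sup.1 hq
        obtain ⟨b, rfl⟩ := Ideal.mem_span_singleton'.1 hb
        rw [add_smul, mul_smul]
        exact add_mem (hJ a ha n hn.1) (Submodule.smul_mem _ _ hn.2))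
      e he'
    refine ⟨g1 - Polynomial.X * g2, ?_⟩
    have key : (1 - PowerSeries.X) * (hs N - hs N') =
        (hs N - hs (N' ⊔ yN N y)) - PowerSeries.X * (hs (colonK N N' y) - hs N') := by
      ext d
      rw [sub_mul, one_mul]
      simp only [map_sub]
      cases d with
      | zero =>
        have := dim_step0 (N := N) hy1 h'
        simp [hs, this]
      | succ d =>
        rw [PowerSeries.coeff_succ_X_mul, PowerSeries.coeff_succ_X_mul]
        have := dim_step h h' hy1 d
        have : (hf (N' ⊔ yN N y) (d + 1) : ℚ) + hf (colonK N N' y) d = hf N' (d + 1) + hf N d := by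
          exact_mod_cast this
        simp only [hs, PowerSeries.coeff_mk, map_sub]
        linarith
    rw [List.length_cons, pow_succ, mul_assoc, key, mul_sub, hg1, mul_left_comm, hg2]
    simp

/-- Nullstellensatz -/
lemma nulls (I : Ideal (Spoly ℓ)) (h : ∀ v : Fin ℓ → ℂ, (∀ f ∈ I, eval v f = 0) → v = 0) :
    ∃ e : ℕ, ∀ a ≥ e, ∀ f : Spoly ℓ, f.IsHomogeneous a → f ∈ I := by
  have h1 : idealOfVars (Fin ℓ) ℂ ≤ I.radical := by
    rw [← vanishingIdeal_zeroLocus_eq_radical (K := ℂ), Ideal.span_le]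
    rintro _ ⟨i, rfl⟩
    simp only [SetLike.mem_coe, mem_vanishingIdeal_iff]
    intro v hv
    have := h v (fun f hf => by simpa [aeval_eq_eval] using (mem_zeroLocus_iff.1 hv) f hf)
    simp [this]
  obtain ⟨e, he⟩ := Ideal.exists_radical_pow_le_of_fg I (IsNoetherian.noetherian _)
  refine ⟨e, fun a ha f hf => he (Ideal.pow_right_mono h1 e ?_)⟩
  rw [mem_pow_idealOfVars_iff]
  intro x hx
  have := hf.degree_eq_sum_deg_support hx
  have h2 : x.degree = a := by
    by_contra hne
    exact (mem_support_iff.1 hx) (hf.coeff_eq_zero hne)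
  omega

end gr
end ST

namespace ST
section forms
variable {ℓ : ℕ}

abbrev Form (ℓ : ℕ) := Finset (Fin ℓ) → Spoly ℓ

def cf (α : Spoly ℓ) : Fin ℓ → Spoly ℓ := fun i => C (coeff (Finsupp.single i 1) α)
def cv (v : Fin ℓ → ℂ) : Fin ℓ → Spoly ℓ := fun i => C (v i)
/-- `dα ∧ -` -/
def dw (α : Spoly ℓ) : Form ℓ →ₗ[Spoly ℓ] Form ℓ := wedge (cf α)
/-- contraction with the Euler field -/
def eu : Form ℓ →ₗ[Spoly ℓ] Form ℓ := contr (fun i => (X i : Spoly ℓ))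

lemma lin_eq {α : Spoly ℓ} (h : α.IsHomogeneous 1) : ∑ i, cf α i * X i = α := by
  have h1 : α ∈ homogeneousSubmodule (Fin ℓ) ℂ 1 := h
  rw [homogeneousSubmodule_one_eq_span_X] at h1
  refine Submodule.span_induction ?_ ?_ ?_ ?_ h1
  · rintro _ ⟨j, rfl⟩
    rw [Finset.sum_eq_single j]
    · simp [cf]
    · intro i _ hij
      simp [cf, coeff_X, Finsupp.single_left_inj, Ne.symm hij]
    · simp
  · simp [cf]
  · intro a b _ _ ha hb
    conv_rhs => rw [← ha, ← hb]
    simp [cf, add_mul, Finset.sum_add_distrib]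
  · intro r a _ ha
    conv_rhs => rw [← ha]
    simp [cf, Finset.smul_sum, smul_eq_C_mul, mul_assoc]

lemma cf_cv (α : Spoly ℓ) (v : Fin ℓ → ℂ) : ∑ i, cf α i * cv v i = C (linFun α v) := by
  simp [cf, cv, linFun, LinearMap.sum_apply]

lemma eval_lin {α : Spoly ℓ} (h : α.IsHomogeneous 1) (v : Fin ℓ → ℂ) :
    eval v α = linFun α v := by
  conv_lhs => rw [← lin_eq h]
  simp [cf, linFun, LinearMap.sum_apply]

lemma dvd_wedge {α : Spoly ℓ} (a : Fin ℓ → Spoly ℓ) {φ : Form ℓ} (h : ∀ I, α ∣ φ I) (J) :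
    α ∣ wedge a φ J := by
  rw [wedge_coeff]
  refine Finset.dvd_sum fun j _ => ?_
  rw [smul_eq_mul, zsmul_eq_mul]
  exact ((h _).mul_left _).mul_left _

lemma dvd_contr {α : Spoly ℓ} (a : Fin ℓ → Spoly ℓ) {φ : Form ℓ} (h : ∀ I, α ∣ φ I) (J) :
    α ∣ contr a φ J := by
  rw [contr_coeff]
  refine Finset.dvd_sum fun j _ => ?_
  split_ifs
  · simp
  rw [smul_eq_mul, zsmul_eq_mul]
  exact ((h _).mul_left _).mul_left _

lemma hc_zsmul {d : ℕ} (z : ℤ) (f : Spoly ℓ) :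
    homogeneousComponent d (z • f) = z • homogeneousComponent d f := map_zsmul _ _ _

lemma hc_wedge (a : Fin ℓ → ℂ) (d : ℕ) (φ : Form ℓ) :
    hc d (wedge (cv a) φ) = wedge (cv a) (hc d φ) := by
  funext J
  rw [hc_apply, wedge_coeff, wedge_coeff, map_sum]
  refine Finset.sum_congr rfl fun j _ => ?_
  rw [smul_eq_mul, smul_eq_mul, cv, homogeneousComponent_C_mul, hc_zsmul, hc_apply]

lemma hc_contr (a : Fin ℓ → ℂ) (d : ℕ) (φ : Form ℓ) :
    hc d (contr (cv a) φ) = contr (cv a) (hc d φ) := by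
  funext J
  rw [hc_apply, contr_coeff, contr_coeff, map_sum]
  refine Finset.sum_congr rfl fun j _ => ?_
  split_ifs
  · simp
  rw [smul_eq_mul, smul_eq_mul, cv, homogeneousComponent_C_mul, hc_zsmul, hc_apply]

lemma hc_dw (α : Spoly ℓ) (d : ℕ) (φ : Form ℓ) : hc d (dw α φ) = dw α (hc d φ) :=
  hc_wedge _ d φ

lemma homog_zsmul {d : ℕ} (z : ℤ) {f : Spoly ℓ} (h : f.IsHomogeneous d) :
    (z • f).IsHomogeneous d := 
  zsmul_mem (show f ∈ homogeneousSubmodule (Fin ℓ) ℂ d from h) z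

lemma wedge_Fd (a : Fin ℓ → ℂ) {d : ℕ} {φ : Form ℓ} (h : φ ∈ Fd _ ℓ d) :
    wedge (cv a) φ ∈ Fd _ ℓ d := by
  rw [← hc_of_mem h, ← hc_wedge]; exact hc_mem_Fd _ _

lemma contr_Fd (a : Fin ℓ → ℂ) {d : ℕ} {φ : Form ℓ} (h : φ ∈ Fd _ ℓ d) :
    contr (cv a) φ ∈ Fd _ ℓ d := by
  rw [← hc_of_mem h, ← hc_contr]; exact hc_mem_Fd _ _

lemma eu_Fd {d : ℕ} {φ : Form ℓ} (h : φ ∈ Fd _ ℓ d) : eu φ ∈ Fd _ ℓ (d + 1) := by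
  intro J
  rw [eu, contr_coeff]
  refine IsHomogeneous.sum _ _ _ fun j _ => ?_
  split_ifs
  · exact isHomogeneous_zero _ _ _
  · rw [smul_eq_mul, add_comm]
    exact (isHomogeneous_X _ _).mul (homog_zsmul _ (h _))

/-- forms of degree `p` -/
def supp (ℓ p : ℕ) : Submodule (Spoly ℓ) (Form ℓ) where
  carrier := {ψ | ∀ I, I.card ≠ p → ψ I = 0}
  add_mem' h1 h2 I hI := by simp [h1 I hI, h2 I hI]
  zero_mem' I _ := rfl
  smul_mem' r f h I hI := by simp [h I hI]

lemma supp_gr (p : ℕ) : IsGr (supp ℓ p) := by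
  intro ψ h d I hI
  rw [hc_apply, h I hI, map_zero]

lemma wedge_supp (a : Fin ℓ → Spoly ℓ) {p : ℕ} {φ : Form ℓ} (h : φ ∈ supp ℓ p) :
    wedge a φ ∈ supp ℓ (p + 1) := by
  intro J hJ
  rw [wedge_coeff]
  refine Finset.sum_eq_zero fun j hj => ?_
  rw [h, smul_zero, smul_zero]
  have := card_er hj
  omega

lemma contr_supp (a : Fin ℓ → Spoly ℓ) {p : ℕ} {φ : Form ℓ} (h : φ ∈ supp ℓ (p + 1)) :
    contr a φ ∈ supp ℓ p := by
  intro J hJ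
  rw [contr_coeff]
  refine Finset.sum_eq_zero fun j hj => ?_
  split_ifs with h1
  · rfl
  rw [h, smul_zero, smul_zero]
  rw [card_ins h1]
  omega

lemma contr_supp0 (a : Fin ℓ → Spoly ℓ) {φ : Form ℓ} (h : φ ∈ supp ℓ 0) :
    contr a φ = 0 := by
  funext J
  rw [contr_coeff]
  refine Finset.sum_eq_zero fun j hj => ?_
  split_ifs with h1
  · rfl
  rw [h, smul_zero, smul_zero]
  rw [card_ins h1]
  omega

lemma supp_big {p : ℕ} (h : ℓ < p) {φ : Form ℓ} (hφ : φ ∈ supp ℓ p) : φ = 0 := by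
  funext I
  apply hφ
  have := Finset.card_le_univ I
  simp at this
  omega

/-- `Q(A)·Ω(B)` for `B ⊆ A` -/
def MB (A B : Finset (Spoly ℓ)) : Submodule (Spoly ℓ) (Form ℓ) where
  carrier := {ψ | (∀ α ∈ B, ∀ J, α ∣ dw α ψ J) ∧ ∀ α ∈ A, α ∉ B → ∀ J, α ∣ ψ J}
  add_mem' h1 h2 := ⟨fun α hα J => by rw [map_add]; exact dvd_add (h1.1 α hα J) (h2.1 α hα J),
    fun α hα hB J => dvd_add (h1.2 α hα hB J) (h2.2 α hα hB J)⟩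
  zero_mem' := ⟨fun α hα J => by simp, fun α _ _ J => by simp⟩
  smul_mem' r f h := ⟨fun α hα J => by
      rw [map_smul]; exact (h.1 α hα J).mul_left _,
    fun α hα hB J => (h.2 α hα hB J).mul_left _⟩

variable {A B : Finset (Spoly ℓ)}

lemma dvd_hcomp {α f : Spoly ℓ} (hα : α.IsHomogeneous 1) (h : α ∣ f) (d : ℕ) :
    α ∣ homogeneousComponent d f := by
  obtain ⟨g, rfl⟩ := h
  rw [homog_mul hα]
  split_ifs
  · exact dvd_mul_right _ _
  · simp

lemma MB_gr (hA : ∀ α ∈ A, α.IsHomogeneous 1) (hB : B ⊆ A) : IsGr (MB A B) := by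
  rintro ψ ⟨h1, h2⟩ d
  refine ⟨fun α hα J => ?_, fun α hα hαB J => ?_⟩
  · rw [← hc_dw]
    exact dvd_hcomp (hA α (hB hα)) (h1 α hα J) d
  · exact dvd_hcomp (hA α hα) (h2 α hα hαB J) d

lemma MB_wedge (a : Fin ℓ → Spoly ℓ) {ψ : Form ℓ} (h : ψ ∈ MB A B) : wedge a ψ ∈ MB A B := by
  refine ⟨fun α hα J => ?_, fun α hα hαB J => dvd_wedge a (h.2 α hα hαB) J⟩
  rw [dw, wedge_wedge, Pi.neg_apply, dvd_neg]
  exact dvd_wedge a (h.1 α hα) J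

lemma dw_contr (α : Spoly ℓ) (v : Fin ℓ → Spoly ℓ) (ψ : Form ℓ) :
    dw α (contr v ψ) = (∑ i, cf α i * v i) • ψ - contr v (dw α ψ) := by
  rw [← wedge_contr, dw]; abel

lemma MB_contr {v : Fin ℓ → ℂ} (hv : ∀ α ∈ B, linFun α v = 0) {ψ : Form ℓ} (h : ψ ∈ MB A B) :
    contr (cv v) ψ ∈ MB A B := by
  refine ⟨fun α hα J => ?_, fun α hα hαB J => dvd_contr _ (h.2 α hα hαB) J⟩
  rw [dw_contr, cf_cv, hv α hα]
  simp only [map_zero, zero_smul, zero_sub, Pi.neg_apply, dvd_neg]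
  exact dvd_contr _ (h.1 α hα) J

lemma MB_eu (hB : ∀ α ∈ B, α.IsHomogeneous 1) {ψ : Form ℓ} (h : ψ ∈ MB A B) :
    eu ψ ∈ MB A B := by
  refine ⟨fun α hα J => ?_, fun α hα hαB J => dvd_contr _ (h.2 α hα hαB) J⟩
  rw [eu, dw_contr, lin_eq (hB α hα)]
  exact dvd_sub (dvd_mul_right _ _) (dvd_contr _ (h.1 α hα) J)

lemma lin_prime {α : Spoly ℓ} (h : α.IsHomogeneous 1) (h0 : α ≠ 0) : Prime α := by
  apply Irreducible.prime
  apply irreducible_of_totalDegree_eq_one (h.totalDegree h0)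
  intro x hx
  rw [isUnit_iff_ne_zero]
  rintro rfl
  apply h0
  ext m
  simpa using hx m

lemma lin_dvd {α β : Spoly ℓ} (h : α.IsHomogeneous 1) (hβ : β.IsHomogeneous 1)
    (hd : α ∣ β) : ∃ c : ℂ, β = c • α := by
  obtain ⟨g, rfl⟩ := hd
  have := homog_mul h g 1
  rw [homogeneousComponent_of_mem hβ, if_pos rfl, if_pos le_rfl, Nat.sub_self,
    homogeneousComponent_zero] at this
  exact ⟨_, by rw [this, smul_eq_C_mul, mul_comm]⟩

lemma arr_prime (hA : IsArrangement A) {α : Spoly ℓ} (h : α ∈ A) : Prime α :=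
  lin_prime (hA.1 α h).1 (hA.1 α h).2

lemma arr_dvd (hA : IsArrangement A) {α β f : Spoly ℓ} (h : α ∈ A) (h' : β ∈ A) (hne : α ≠ β)
    (hd : α ∣ β * f) : α ∣ f := by
  rcases (arr_prime hA h).dvd_or_dvd hd with h1 | h1
  · obtain ⟨c, hc⟩ := lin_dvd (hA.1 α h).1 (hA.1 β h').1 h1
    exact absurd hc (hA.2 β h' α h (Ne.symm hne) c)
  · exact h1

/-- `(dα/α) ∧ -` preserves log forms -/
lemma MB_eta (hA : IsArrangement A) (hB : B ⊆ A) {α : Spoly ℓ} (hα : α ∈ B) {ψ : Form ℓ}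
    (h : ψ ∈ MB A B) : ∃ ψ' ∈ MB A B, α • ψ' = dw α ψ := by
  choose ψ' hψ' using h.1 α hα
  have e : α • ψ' = dw α ψ := by funext J; rw [hψ' J]; rfl
  have hα0 := (hA.1 α (hB hα)).2
  refine ⟨ψ', ⟨fun β hβ J => ?_, fun β hβ hβB J => ?_⟩, e⟩
  · have e2 : α * dw β ψ' J = dw β (dw α ψ) J := by rw [← e, map_smul]; rfl
    by_cases hne : β = α
    · subst hne
      have : dw β (dw β ψ) = 0 := wedge_self _ _
      rw [this, Pi.zero_apply, mul_eq_zero] at e2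
      rw [e2.resolve_left hα0]; exact dvd_zero _
    · apply arr_dvd hA (hB hβ) (hB hα) hne
      rw [e2, dw, dw, wedge_wedge, Pi.neg_apply, dvd_neg]
      exact dvd_wedge _ (h.1 β hβ) J
  · apply arr_dvd hA hβ (hB hα) (by rintro rfl; exact hβB hα)
    rw [← hψ']
    exact dvd_wedge _ (h.2 β hβ hβB) J

lemma smul_cancel {α : Spoly ℓ} (h0 : α ≠ 0) {φ ψ : Form ℓ} (h : α • φ = α • ψ) : φ = ψ := by
  funext J
  exact mul_left_cancel₀ h0 (congrFun h J)

def ZB (A B : Finset (Spoly ℓ)) (p : ℕ) : Submodule (Spoly ℓ) (Form ℓ) :=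
  (MB A B ⊓ supp ℓ p) ⊓ LinearMap.ker eu

lemma eu_eu (ψ : Form ℓ) : eu (eu ψ) = 0 := contr_self _ _

lemma ZB_exact (hA : IsArrangement A) (hB : B ⊆ A) {α : Spoly ℓ} (hα : α ∈ B) {p d : ℕ} {w : Form ℓ}
    (hw : w ∈ pc (ZB A B p) d) : ∃ u : Form ℓ, eu u = w ∧ u ∈ MB A B ∧ u ∈ supp ℓ (p + 1) ∧
      ((∃ d', d = d' + 1 ∧ u ∈ Fd _ ℓ d') ∨ (d = 0 ∧ u = 0)) := by
  obtain ⟨⟨⟨hM, hs⟩, hk⟩, hd⟩ := hw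
  have hα0 := (hA.1 α (hB hα)).2
  have hα1 := (hA.1 α (hB hα)).1
  obtain ⟨u, hu, e⟩ := MB_eta hA hB hα hM
  refine ⟨u, ?_, hu, ?_, ?_⟩
  · apply smul_cancel hα0
    have := dw_contr α (fun i => (X i : Spoly ℓ)) w
    change dw α (eu w) = _ - eu (dw α w) at this
    rw [LinearMap.mem_ker.1 hk, map_zero, lin_eq hα1] at this
    rw [← map_smul, e]
    exact (sub_eq_zero.1 this.symm).symm
  · intro J hJ
    have := congrFun e J
    rw [show dw α w J = 0 from wedge_supp (cf α) hs J hJ] at this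
    exact (mul_eq_zero.1 this).resolve_left hα0
  · have h2 : dw α w ∈ Fd _ ℓ d := wedge_Fd _ hd
    rw [← e] at h2
    cases d with
    | zero =>
      right; refine ⟨rfl, ?_⟩
      apply smul_cancel hα0
      rw [← hc_of_mem h2, hc_lin0 hα1, smul_zero]
    | succ d =>
      left; refine ⟨d, rfl, ?_⟩
      have : u = hc d u := by
        apply smul_cancel hα0
        rw [← hc_lin hα1, hc_of_mem h2]
      rw [this]; exact hc_mem_Fd _ _

lemma eu_step (hA : IsArrangement A) (hB : B ⊆ A) {α : Spoly ℓ} (hα : α ∈ B) (p d : ℕ) :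
    hf (MB A B ⊓ supp ℓ (p + 1)) d = hf (ZB A B (p + 1)) d + hf (ZB A B p) (d + 1) := by
  have h := rankNull (eu.restrictScalars ℂ) (pc (MB A B ⊓ supp ℓ (p+1)) d)
  have h1 : pc (MB A B ⊓ supp ℓ (p+1)) d ⊓ LinearMap.ker (eu.restrictScalars ℂ) =
      pc (ZB A B (p+1)) d := by
    ext ψ; constructor
    · rintro ⟨⟨a, b⟩, c⟩; exact ⟨⟨a, c⟩, b⟩
    · rintro ⟨⟨a, c⟩, b⟩; exact ⟨⟨a, b⟩, c⟩
  have h2 : (pc (MB A B ⊓ supp ℓ (p+1)) d).map (eu.restrictScalars ℂ) = pc (ZB A B p) (d+1) := by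
    apply le_antisymm
    · rintro _ ⟨ψ, ⟨⟨h1, h2⟩, h3⟩, rfl⟩
      exact ⟨⟨⟨MB_eu (fun α hα => (hA.1 α (hB hα)).1) h1, contr_supp _ h2⟩, eu_eu ψ⟩, eu_Fd h3⟩
    · intro w hw
      obtain ⟨u, h1, h2, h3, ⟨d', h4, h5⟩ | h4⟩ := ZB_exact hA hB hα hw
      · obtain rfl : d = d' := by omega
        exact ⟨u, ⟨⟨h2, h3⟩, h5⟩, h1⟩
      · omega
  rw [h1, h2] at h
  exact h

lemma eu_step0 (hA : IsArrangement A) (hB : B ⊆ A) {α : Spoly ℓ} (hα : α ∈ B) (p : ℕ) :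
    hf (ZB A B p) 0 = 0 := by
  have : pc (ZB A B p) 0 = ⊥ := by
    rw [eq_bot_iff]
    intro w hw
    obtain ⟨u, h1, h2, h3, ⟨d', h4, h5⟩ | h4⟩ := ZB_exact hA hB hα hw
    · omega
    · rw [← h1, h4.2]; simp
  unfold hf; rw [this]; simp

lemma ZB_zero : ZB A B 0 = MB A B ⊓ supp ℓ 0 := by
  unfold ZB
  rw [inf_eq_left]
  exact fun ψ hψ => contr_supp0 _ hψ.2

lemma hf_big {p : ℕ} (hp : ℓ < p) (d : ℕ) {N : Submodule (Spoly ℓ) (Form ℓ)} (h : N ≤ supp ℓ p) :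
    hf N d = 0 := by
  have : pc N d = ⊥ := by
    rw [eq_bot_iff]
    intro w hw
    rw [supp_big hp (h hw.1)]; simp
  unfold hf; rw [this]; simp

/-- vanishing at `t = 1` -/
lemma euler_vanish (hA : IsArrangement A) (hB : B ⊆ A) {α : Spoly ℓ} (hα : α ∈ B) :
    ∑ p ∈ Finset.range (ℓ + 1), hs (MB A B ⊓ supp ℓ p) * (-PowerSeries.X) ^ p = 0 := by
  have step : ∀ p, PowerSeries.X * hs (MB A B ⊓ supp ℓ (p+1)) =
      PowerSeries.X * hs (ZB A B (p+1)) + hs (ZB A B p) := by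
    intro p
    ext d
    rw [map_add]
    cases d with
    | zero => simp [hs, eu_step0 hA hB hα]
    | succ d =>
      rw [PowerSeries.coeff_succ_X_mul, PowerSeries.coeff_succ_X_mul]
      simp [hs, eu_step hA hB hα p d]
  have tel : ∀ n, ∑ p ∈ Finset.range (n + 1), hs (MB A B ⊓ supp ℓ p) * (-PowerSeries.X) ^ p =
      hs (ZB A B n) * (-PowerSeries.X) ^ n := by
    intro n
    induction n with
    | zero => simp [ZB_zero]
    | succ n ih =>
      rw [Finset.sum_range_succ, ih, pow_succ]
      linear_combination (-(-PowerSeries.X) ^ n) * step n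
  rw [tel]
  have : hs (ZB A B ℓ) = 0 := by
    ext d
    cases d with
    | zero => simp [hs, eu_step0 hA hB hα]
    | succ d =>
      have h1 := eu_step hA hB hα ℓ d
      rw [hf_big (Nat.lt_succ_self ℓ) d inf_le_right] at h1
      have : hf (ZB A B ℓ) (d+1) = 0 := by omega
      simp [hs, this]
  rw [this, zero_mul]

/-- forms in `M_B` killed by contraction with `v_0,…,v_{j-1}` -/
def bs {k : ℕ} (v : Fin k → Fin ℓ → ℂ) (j : ℕ) : Submodule (Spoly ℓ) (Form ℓ) where
  carrier := {ψ | ∀ i : Fin k, i.1 < j → contr (cv (v i)) ψ = 0}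
  add_mem' h1 h2 i hi := by rw [map_add, h1 i hi, h2 i hi, add_zero]
  zero_mem' i _ := map_zero _
  smul_mem' r f h i hi := by rw [map_smul, h i hi, smul_zero]

lemma bs_gr {k : ℕ} (v : Fin k → Fin ℓ → ℂ) (j : ℕ) : IsGr (bs v j) := by
  intro ψ h d i hi
  rw [← hc_contr, h i hi, map_zero]

def KB {k : ℕ} (A B : Finset (Spoly ℓ)) (v : Fin k → Fin ℓ → ℂ) (j p : ℕ) :
    Submodule (Spoly ℓ) (Form ℓ) := (MB A B ⊓ supp ℓ p) ⊓ bs v j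

lemma KB_step0 {k : ℕ} (v : Fin k → Fin ℓ → ℂ) (j : ℕ) :
    KB A B v j 0 = MB A B ⊓ supp ℓ 0 := by
  unfold KB
  rw [inf_eq_left]
  exact fun ψ hψ i _ => contr_supp0 _ hψ.2

lemma KB_zero {k : ℕ} (v : Fin k → Fin ℓ → ℂ) (p : ℕ) :
    KB A B v 0 p = MB A B ⊓ supp ℓ p := by
  unfold KB
  rw [inf_eq_left]
  exact fun ψ hψ i hi => absurd hi (Nat.not_lt_zero _)

lemma cv_cv (a b : Fin ℓ → ℂ) : ∑ i, cv a i * cv b i = C (∑ i, a i * b i) := by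
  simp [cv]

lemma KB_step {k : ℕ} (v β : Fin k → Fin ℓ → ℂ)
    (hv : ∀ i, ∀ α ∈ B, linFun α (v i) = 0)
    (hβ : ∀ i j, ∑ s, β i s * v j s = if i = j then 1 else 0) (j : Fin k) (p d : ℕ) :
    hf (KB A B v j.1 (p + 1)) d = hf (KB A B v (j.1 + 1) (p + 1)) d + hf (KB A B v (j.1 + 1) p) d := by
  have h := rankNull ((contr (cv (v j)) : Form ℓ →ₗ[Spoly ℓ] Form ℓ).restrictScalars ℂ)
    (pc (KB A B v j.1 (p+1)) d)
  have h1 : pc (KB A B v j.1 (p+1)) d ⊓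
      LinearMap.ker ((contr (cv (v j)) : Form ℓ →ₗ[Spoly ℓ] Form ℓ).restrictScalars ℂ) =
      pc (KB A B v (j.1+1) (p+1)) d := by
    ext ψ; constructor
    · rintro ⟨⟨⟨a, b⟩, c⟩, e⟩
      refine ⟨⟨a, fun i hi => ?_⟩, c⟩
      rcases Nat.lt_succ_iff_lt_or_eq.1 hi with h | h
      · exact b i h
      · obtain rfl : i = j := Fin.ext h
        exact e
    · rintro ⟨⟨a, b⟩, c⟩
      exact ⟨⟨⟨a, fun i hi => b i (by omega)⟩, c⟩, b j (by omega)⟩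
  have h2 : (pc (KB A B v j.1 (p+1)) d).map
      ((contr (cv (v j)) : Form ℓ →ₗ[Spoly ℓ] Form ℓ).restrictScalars ℂ) =
      pc (KB A B v (j.1+1) p) d := by
    apply le_antisymm
    · rintro _ ⟨ψ, ⟨⟨⟨h1, h2⟩, h4⟩, h3⟩, rfl⟩
      refine ⟨⟨⟨MB_contr (hv j) h1, contr_supp _ h2⟩, fun i hi => ?_⟩, contr_Fd _ h3⟩
      rcases Nat.lt_succ_iff_lt_or_eq.1 hi with h | h
      · change contr _ (contr _ ψ) = 0
        rw [contr_contr, h4 i h, map_zero, neg_zero]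
      · obtain rfl : i = j := Fin.ext h
        exact contr_self _ _
    · rintro w ⟨⟨⟨h1, h2⟩, h4⟩, h3⟩
      have key : ∀ i : Fin k, i.1 < j.1 + 1 → contr (cv (v i)) (wedge (cv (β j)) w) =
          (if j = i then 1 else 0 : ℂ) • w := by
        intro i hi
        have := wedge_contr (cv (β j)) (cv (v i)) w
        rw [h4 i hi, map_zero, zero_add, cv_cv, hβ] at this
        rw [this]
        split_ifs <;> simp
      refine ⟨wedge (cv (β j)) w, ⟨⟨⟨MB_wedge _ h1, wedge_supp _ h2⟩, fun i hi => ?_⟩,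
        wedge_Fd _ h3⟩, ?_⟩
      · rw [key i (by omega), if_neg (by rintro rfl; omega), zero_smul]
      · change contr _ _ = _
        rw [key j (by omega), if_pos rfl, one_smul]
  rw [h1, h2] at h
  exact h

lemma poly_step {R : Type*} [CommRing R] (g f : ℕ → R) (h0 : g 0 = f 0)
    (h : ∀ p, g (p + 1) = f (p + 1) + f p) (n : ℕ) :
    ∑ p ∈ Finset.range (n + 1), Polynomial.C (g p) * Polynomial.X ^ p =
      (1 + Polynomial.X) * ∑ p ∈ Finset.range (n + 1), Polynomial.C (f p) * Polynomial.X ^ p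
        - Polynomial.C (f n) * Polynomial.X ^ (n + 1) := by
  induction n with
  | zero => simp [h0]; ring
  | succ n ih =>
    rw [Finset.sum_range_succ, ih, Finset.sum_range_succ _ (n + 1), h, Polynomial.C_add]
    ring

lemma KB_poly {k : ℕ} (v β : Fin k → Fin ℓ → ℂ)
    (hv : ∀ i, ∀ α ∈ B, linFun α (v i) = 0)
    (hβ : ∀ i j, ∑ s, β i s * v j s = if i = j then 1 else 0) (j : ℕ) (hj : j ≤ k) :
    ∑ p ∈ Finset.range (ℓ + 1), Polynomial.C (hs (MB A B ⊓ supp ℓ p)) * Polynomial.X ^ p =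
      (1 + Polynomial.X) ^ j * ∑ p ∈ Finset.range (ℓ + 1), Polynomial.C (hs (KB A B v j p)) * Polynomial.X ^ p := by
  induction j with
  | zero => simp [KB_zero]
  | succ j ih =>
    rw [ih (by omega)]
    have st := KB_step (A := A) v β hv hβ ⟨j, by omega⟩
    rw [poly_step (fun p => hs (KB A B v j p)) (fun p => hs (KB A B v (j+1) p))]
    · have : hs (KB A B v (j + 1) ℓ) = 0 := by
        ext d
        have h1 := st ℓ d
        have h2 := hf_big (N := KB A B v j (ℓ+1)) (Nat.lt_succ_self ℓ) d (inf_le_left.trans inf_le_right)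
        have : hf (KB A B v (j+1) ℓ) d = 0 := by simp only at h1; omega
        simp [hs, this]
      rw [this]; simp; ring
    · simp only [KB_step0]
    · intro p
      ext d
      have := st p d
      simp only at this
      simp [hs, this]
end forms
end ST

namespace ST
section koszul
variable {ℓ r : ℕ} {κ : Type} [Fintype κ]

abbrev KF (r : ℕ) (κ : Type) (ℓ : ℕ) := Finset (Fin r) × κ → Spoly ℓ

def cur (ψ : KF r κ ℓ) : Finset (Fin r) → (κ → Spoly ℓ) := fun S j => ψ (S, j)
def unc (φ : Finset (Fin r) → (κ → Spoly ℓ)) : KF r κ ℓ := fun x => φ x.1 x.2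

/-- the Koszul-type differential -/
def dk : KF r κ ℓ →ₗ[Spoly ℓ] KF r κ ℓ where
  toFun ψ := unc (contr (fun _ => (1 : Spoly ℓ)) (cur ψ))
  map_add' f g := by
    have : cur (f + g) = cur f + cur g := rfl
    rw [this, map_add]; rfl
  map_smul' c f := by
    have : cur (c • f) = c • cur f := rfl
    rw [this, map_smul]; rfl

lemma cur_dk (ψ : KF r κ ℓ) : cur (dk ψ) = contr (fun _ => (1 : Spoly ℓ)) (cur ψ) := rfl
lemma cur_inj {ψ φ : KF r κ ℓ} (h : cur ψ = cur φ) : ψ = φ := by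
  funext x; exact congrFun (congrFun h x.1) x.2

lemma dk_dk (ψ : KF r κ ℓ) : dk (dk ψ) = 0 := by
  apply cur_inj
  rw [cur_dk, cur_dk, contr_self]; rfl

lemma cur_dk_apply (ψ : KF r κ ℓ) (S : Finset (Fin r)) : cur (dk ψ) S =
    ∑ j, if j ∈ S then 0 else (sg j S • cur ψ (insert j S)) := by
  rw [cur_dk, contr_coeff]; simp only [one_smul]
  refine Finset.sum_congr rfl fun j _ => ?_
  congr!

lemma dk_hc (d : ℕ) (ψ : KF r κ ℓ) : hc d (dk ψ) = dk (hc d ψ) := by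
  funext ⟨S, j⟩
  have h1 := congrFun (cur_dk_apply ψ S) j
  have h2 := congrFun (cur_dk_apply (hc d ψ) S) j
  simp only [cur] at h1 h2
  rw [hc_apply, h1, h2, Finset.sum_apply, Finset.sum_apply, map_sum]
  refine Finset.sum_congr rfl fun i _ => ?_
  split_ifs
  · simp
  · simp only [Pi.smul_apply, hc_zsmul]; rfl

/-- homotopies -/
def hk (i : Fin r) (q : Spoly ℓ) (ψ : KF r κ ℓ) : KF r κ ℓ :=
  unc (wedge (fun j => if j = i then q else 0) (cur ψ))

lemma cur_hk (i : Fin r) (q : Spoly ℓ) (ψ : KF r κ ℓ) (S : Finset (Fin r)) :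
    cur (hk i q ψ) S = if i ∈ S then q • sg i S • cur ψ (S.erase i) else 0 := by
  have : cur (hk i q ψ) = wedge (fun j => if j = i then q else 0) (cur ψ) := rfl
  rw [this, wedge_coeff]
  simp only [ite_smul, zero_smul, Finset.sum_ite_eq']
  congr!

lemma dk_hk (i : Fin r) (q : Spoly ℓ) (ψ : KF r κ ℓ) (h : dk ψ = 0) :
    dk (hk i q ψ) = q • ψ := by
  apply cur_inj
  have := wedge_contr (fun j => if j = i then q else 0) (fun _ => (1 : Spoly ℓ)) (cur ψ)
  rw [← cur_dk, h] at this
  have h0 : cur (0 : KF r κ ℓ) = 0 := rfl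
  rw [h0, map_zero, zero_add] at this
  rw [cur_dk]
  change contr _ (wedge _ (cur ψ)) = _
  rw [this]
  simp
  rfl

variable (K : Finset (Fin r) → Submodule (Spoly ℓ) (κ → Spoly ℓ))

def KK (e : ℕ) (S : Finset (Fin r)) : Submodule (Spoly ℓ) (κ → Spoly ℓ) :=
  if S.card % 2 = e then K S else ⊥

def CC (e : ℕ) : Submodule (Spoly ℓ) (KF r κ ℓ) where
  carrier := {ψ | ∀ S, cur ψ S ∈ KK K e S}
  add_mem' h1 h2 S := (KK K e S).add_mem (h1 S) (h2 S)
  zero_mem' S := (KK K e S).zero_mem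
  smul_mem' c f h S := (KK K e S).smul_mem c (h S)

variable {K}

lemma CC_gr (hK : ∀ S, IsGr (K S)) (e : ℕ) : IsGr (CC K e) := by
  intro ψ hψ d S
  have : cur (hc d ψ) S = hc d (cur ψ S) := rfl
  rw [this]
  have h := hψ S
  unfold KK at *
  split_ifs at * with h1
  · exact hK S _ h d
  · exact isGr_bot _ h d

lemma hf_CC (e d : ℕ) : hf (CC K e) d = ∑ S, hf (KK K e S) d := by
  unfold hf
  rw [← Module.finrank_pi_fintype ℂ]
  refine LinearEquiv.finrank_eq
    { toFun := fun ψ S => ⟨cur ψ.1 S, ψ.2.1 S, fun j => ψ.2.2 (S, j)⟩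
      map_add' := fun _ _ => rfl
      map_smul' := fun _ _ => rfl
      invFun := fun φ => ⟨unc fun S => (φ S).1, fun S => (φ S).2.1, fun x => (φ x.1).2.2 x.2⟩
      left_inv := fun _ => rfl
      right_inv := fun _ => rfl }

lemma dk_CC (hanti : ∀ S i, K (insert i S) ≤ K S) {e e' : ℕ} (he : e + e' = 1) {ψ : KF r κ ℓ}
    (h : ψ ∈ CC K e) : dk ψ ∈ CC K e' := by
  intro S
  rw [cur_dk_apply]
  refine Submodule.sum_mem _ fun i _ => ?_
  split_ifs with h1
  · exact zero_mem _
  refine zsmul_mem ?_ _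
  have h2 := h (insert i S)
  unfold KK at *
  rw [Finset.card_insert_of_notMem h1] at h2
  by_cases h3 : (S.card + 1) % 2 = e
  · rw [if_pos h3] at h2
    rw [if_pos (by omega)]
    exact hanti _ _ h2
  · rw [if_neg h3, Submodule.mem_bot] at h2
    rw [h2]; exact zero_mem _

lemma hk_CC {i : Fin r} {q : Spoly ℓ} (hq : ∀ S, ∀ ψ ∈ K S, q • ψ ∈ K (insert i S))
    {e e' : ℕ} (he : e + e' = 1) {ψ : KF r κ ℓ}
    (h : ψ ∈ CC K e) : hk i q ψ ∈ CC K e' := by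
  intro S
  rw [cur_hk]
  split_ifs with h1
  swap
  · exact zero_mem _
  rw [smul_comm]
  refine zsmul_mem ?_ _
  have h2 := h (S.erase i)
  have h4 := Finset.card_erase_add_one h1
  unfold KK at *
  by_cases h3 : (S.erase i).card % 2 = e
  · rw [if_pos h3] at h2
    rw [if_pos (by omega)]
    have := hq _ _ h2
    rwa [Finset.insert_erase h1] at this
  · rw [if_neg h3, Submodule.mem_bot] at h2
    rw [h2, smul_zero]; exact zero_mem _

lemma hs_split (hK : ∀ S, IsGr (K S)) (e : ℕ) :
    hs (CC K e) = hs (CC K e ⊓ LinearMap.ker dk) + hs ((CC K e).map dk) := by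
  ext d
  have h := rankNull (dk.restrictScalars ℂ) (pc (CC K e) d)
  have h1 : pc (CC K e) d ⊓ LinearMap.ker (dk.restrictScalars ℂ) =
      pc (CC K e ⊓ LinearMap.ker dk) d := by
    ext ψ; constructor
    · rintro ⟨⟨a, b⟩, c⟩; exact ⟨⟨a, c⟩, b⟩
    · rintro ⟨⟨a, c⟩, b⟩; exact ⟨⟨a, b⟩, c⟩
  have h2 : (pc (CC K e) d).map (dk.restrictScalars ℂ) = pc ((CC K e).map dk) d := by
    apply le_antisymm
    · rintro _ ⟨ψ, ⟨h1, h2⟩, rfl⟩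
      refine ⟨⟨ψ, h1, rfl⟩, ?_⟩
      change dk ψ ∈ _
      rw [← hc_of_mem h2, ← dk_hc]; exact hc_mem_Fd _ _
    · rintro _ ⟨⟨ψ, h1, rfl⟩, h2⟩
      refine ⟨hc d ψ, ⟨CC_gr hK e _ h1 d, hc_mem_Fd _ _⟩, ?_⟩
      change dk _ = _
      rw [← dk_hc, hc_of_mem h2]
  rw [h1, h2] at h
  simp only [hs, map_add, PowerSeries.coeff_mk, hf]
  exact_mod_cast h

lemma hom_poly (hK : ∀ S, IsGr (K S)) (hanti : ∀ S i, K (insert i S) ≤ K S)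
    (q : Fin r → Spoly ℓ) (hq : ∀ i S, ∀ ψ ∈ K S, q i • ψ ∈ K (insert i S))
    (ys : List (Spoly ℓ)) (hy : ∀ y ∈ ys, y.IsHomogeneous 1) (n : ℕ)
    (hn : ∀ a ≥ n, ∀ f : Spoly ℓ, f.IsHomogeneous a →
      f ∈ Ideal.span (Set.range q) ⊔ Ideal.span {y | y ∈ ys})
    {e e' : ℕ} (he : e + e' = 1) : ∃ g : Polynomial ℚ, (1 - PowerSeries.X) ^ ys.length *
      (hs (CC K e ⊓ LinearMap.ker dk) - hs ((CC K e').map dk)) = (g : PowerSeries ℚ) := by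
  refine hilbert_serre ys hy _ _ ?_ ?_ ?_ (Ideal.span (Set.range q)) ?_ n hn
  · refine (CC_gr hK e).inf fun ψ hψ d => ?_
    rw [LinearMap.mem_ker] at *
    rw [← dk_hc, hψ, map_zero]
  · rintro _ ⟨ψ, h, rfl⟩ d
    rw [dk_hc]
    exact ⟨_, CC_gr hK e' _ h d, rfl⟩
  · rintro _ ⟨ψ, h, rfl⟩
    exact ⟨dk_CC hanti (by omega) h, dk_dk ψ⟩
  · intro p hp w hw
    refine Submodule.span_induction ?_ ?_ ?_ ?_ hp
    · rintro _ ⟨i, rfl⟩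
      exact ⟨hk i (q i) w, hk_CC (hq i) he hw.1, dk_hk _ _ _ hw.2⟩
    · simp
    · intro a b _ _ ha hb
      rw [add_smul]; exact add_mem ha hb
    · intro a b _ hb
      rw [smul_eq_mul, mul_smul]
      exact Submodule.smul_mem _ a hb

theorem koszul_poly (hK : ∀ S, IsGr (K S)) (hanti : ∀ S i, K (insert i S) ≤ K S)
    (q : Fin r → Spoly ℓ) (hq : ∀ i S, ∀ ψ ∈ K S, q i • ψ ∈ K (insert i S))
    (ys : List (Spoly ℓ)) (hy : ∀ y ∈ ys, y.IsHomogeneous 1) (n : ℕ)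
    (hn : ∀ a ≥ n, ∀ f : Spoly ℓ, f.IsHomogeneous a →
      f ∈ Ideal.span (Set.range q) ⊔ Ideal.span {y | y ∈ ys}) :
    ∃ g : Polynomial ℚ, (1 - PowerSeries.X) ^ ys.length *
      (∑ S : Finset (Fin r), (-1) ^ S.card * hs (K S)) = (g : PowerSeries ℚ) := by
  obtain ⟨g0, h0⟩ := hom_poly hK hanti q hq ys hy n hn (e := 0) (e' := 1) rfl
  obtain ⟨g1, h1⟩ := hom_poly hK hanti q hq ys hy n hn (e := 1) (e' := 0) rfl
  refine ⟨g0 - g1, ?_⟩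
  have key : ∑ S : Finset (Fin r), (-1) ^ S.card * hs (K S) = hs (CC K 0) - hs (CC K 1) := by
    ext d
    rw [map_sum]
    simp only [hs, map_sub, PowerSeries.coeff_mk, hf_CC]
    push_cast
    rw [← Finset.sum_sub_distrib]
    refine Finset.sum_congr rfl fun S _ => ?_
    have hb : hf (⊥ : Submodule (Spoly ℓ) (κ → Spoly ℓ)) d = 0 := by
      have : pc (⊥ : Submodule (Spoly ℓ) (κ → Spoly ℓ)) d = ⊥ := by
        rw [eq_bot_iff]; intro w hw; exact hw.1
      unfold hf; rw [this]; simp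
    unfold KK
    rcases Nat.mod_two_eq_zero_or_one S.card with h | h
    · rw [if_pos h, if_neg (by omega), hb, (Nat.even_iff.2 h).neg_one_pow]; simp
    · rw [if_neg (by omega), if_pos h, hb, (Nat.odd_iff.2 h).neg_one_pow]; simp
  rw [key, hs_split hK 0, hs_split hK 1]
  rw [Polynomial.coe_sub, ← h0, ← h1]
  ring
end koszul
end ST

namespace ST
section vals

lemma coe_mul' (u v : Polynomial ℚ) : ((u * v : Polynomial ℚ) : PowerSeries ℚ) = u * v := 
  Polynomial.coe_mul _ _

/-- pairs (series, its value at 1) -/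
def HV : Subring (PowerSeries ℚ × ℚ) where
  carrier := {x | ∃ u v : Polynomial ℚ, v.eval 1 ≠ 0 ∧ x.1 * (v : PowerSeries ℚ) = u ∧
    x.2 * v.eval 1 = u.eval 1}
  mul_mem' := by
    rintro x y ⟨u, v, h1, h2, h3⟩ ⟨u', v', h1', h2', h3'⟩
    refine ⟨u * u', v * v', by simp [h1, h1'], ?_, ?_⟩
    · simp only [Polynomial.coe_mul, Prod.fst_mul, ← h2, ← h2']; ring
    · simp only [Polynomial.eval_mul, Prod.snd_mul, ← h3, ← h3']; ring
  one_mem' := ⟨1, 1, by simp, by simp, by simp⟩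
  add_mem' := by
    rintro x y ⟨u, v, h1, h2, h3⟩ ⟨u', v', h1', h2', h3'⟩
    refine ⟨u * v' + u' * v, v * v', by simp [h1, h1'], ?_, ?_⟩
    · simp only [Polynomial.coe_mul, Polynomial.coe_add, Prod.fst_add, ← h2, ← h2']; ring
    · simp only [Polynomial.eval_mul, Polynomial.eval_add, Prod.snd_add, ← h3, ← h3']; ring
  zero_mem' := ⟨0, 1, by simp, by simp, by simp⟩
  neg_mem' := by
    rintro x ⟨u, v, h1, h2, h3⟩
    refine ⟨-u, v, h1, ?_, ?_⟩
    · rw [Polynomial.coe_neg, ← h2, Prod.fst_neg]; ring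
    · rw [Polynomial.eval_neg, ← h3, Prod.snd_neg]; ring

def hv1 : HV →+* PowerSeries ℚ := (RingHom.fst _ _).comp HV.subtype
def hv2 : HV →+* ℚ := (RingHom.snd _ _).comp HV.subtype

def ofPoly (g : Polynomial ℚ) : HV :=
  ⟨((g : PowerSeries ℚ), g.eval 1), g, 1, by simp, by simp, by simp⟩

@[simp] lemma hv1_ofPoly (g : Polynomial ℚ) : hv1 (ofPoly g) = (g : PowerSeries ℚ) := rfl
@[simp] lemma hv2_ofPoly (g : Polynomial ℚ) : hv2 (ofPoly g) = g.eval 1 := rfl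

lemma hv_uniq {x : HV} (h : hv1 x = 0) : hv2 x = 0 := by
  obtain ⟨⟨a, b⟩, u, v, h1, h2, h3⟩ := x
  change a = 0 at h
  change b = 0
  simp only at h2 h3
  rw [h, zero_mul] at h2
  have : u = 0 := by
    apply Polynomial.coe_injective ℚ
    rw [← h2]; simp
  rw [this] at h3
  simpa [h1] using h3

/-- polynomials over power series with a limit polynomial -/
def HVP (P : Polynomial (PowerSeries ℚ)) (c : Polynomial ℚ) : Prop :=
  ∃ R : Polynomial HV, R.map hv1 = P ∧ R.map hv2 = c

lemma HVP.add {P P' c c'} (h : HVP P c) (h' : HVP P' c') : HVP (P + P') (c + c') := by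
  obtain ⟨R, rfl, rfl⟩ := h
  obtain ⟨R', rfl, rfl⟩ := h'
  exact ⟨R + R', by simp, by simp⟩
lemma HVP.sub {P P' c c'} (h : HVP P c) (h' : HVP P' c') : HVP (P - P') (c - c') := by
  obtain ⟨R, rfl, rfl⟩ := h
  obtain ⟨R', rfl, rfl⟩ := h'
  exact ⟨R - R', by simp, by simp⟩
lemma HVP.mul {P P' c c'} (h : HVP P c) (h' : HVP P' c') : HVP (P * P') (c * c') := by
  obtain ⟨R, rfl, rfl⟩ := h
  obtain ⟨R', rfl, rfl⟩ := h'
  exact ⟨R * R', by simp, by simp⟩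
lemma HVP.pow {P c} (h : HVP P c) (n : ℕ) : HVP (P ^ n) (c ^ n) := by
  obtain ⟨R, rfl, rfl⟩ := h
  exact ⟨R ^ n, by simp, by simp⟩
lemma HVP.one : HVP 1 1 := ⟨1, by simp, by simp⟩
lemma HVP.neg_one : HVP (-1) (-1) := ⟨-1, by simp, by simp⟩
lemma HVP.X : HVP Polynomial.X Polynomial.X := ⟨Polynomial.X, by simp, by simp⟩
lemma HVP.C (g : Polynomial ℚ) : HVP (Polynomial.C (g : PowerSeries ℚ)) (Polynomial.C (g.eval 1)) :=
  ⟨Polynomial.C (ofPoly g), by simp, by simp⟩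
lemma HVP.sum {ι : Type*} (s : Finset ι) {P : ι → Polynomial (PowerSeries ℚ)} {c : ι → Polynomial ℚ}
    (h : ∀ i ∈ s, HVP (P i) (c i)) : HVP (∑ i ∈ s, P i) (∑ i ∈ s, c i) := by
  induction s using Finset.induction_on with
  | empty => exact ⟨0, by simp, by simp⟩
  | insert a s ha ih =>
    rw [Finset.sum_insert ha, Finset.sum_insert ha]
    exact (h a (by simp)).add (ih fun i hi => h i (by simp [hi]))

lemma HVP.eval_one {P c} (h : HVP P c) (h0 : P.eval 1 = 0) : c.eval 1 = 0 := by
  obtain ⟨R, rfl, rfl⟩ := h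
  have h1 : hv1 (R.eval 1) = 0 := by
    rw [← h0]
    have := Polynomial.eval_map_apply hv1 (p := R) 1
    rw [map_one] at this
    exact this.symm
  have := hv_uniq h1
  rw [← this]
  have := Polynomial.eval_map_apply hv2 (p := R) 1
  rwa [map_one] at this

/-- the substitution `y = t(1-x)-1` -/
def LL : Polynomial (PowerSeries ℚ) := Polynomial.C (1 - PowerSeries.X) * Polynomial.X - 1

lemma HVP_LL : HVP LL (-1) := by
  have h := ((HVP.C (1 - Polynomial.X)).mul HVP.X).sub HVP.one
  simpa [LL] using h

lemma HVP.coeff {P c} (h : HVP P c) (k : ℕ) : ∃ u v : Polynomial ℚ, v.eval 1 ≠ 0 ∧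
    P.coeff k * (v : PowerSeries ℚ) = u ∧ c.coeff k * v.eval 1 = u.eval 1 := by
  obtain ⟨R, rfl, rfl⟩ := h
  rw [Polynomial.coeff_map, Polynomial.coeff_map]
  exact (R.coeff k).2
end vals

section geom
variable {ℓ : ℕ}

lemma exists_dual (Y : Submodule ℂ (Fin ℓ → ℂ)) :
    ∃ v β : Fin (Module.finrank ℂ Y) → Fin ℓ → ℂ, (∀ i, v i ∈ Y) ∧
      (∀ i j, ∑ s, β i s * v j s = if i = j then 1 else 0) ∧
      ∀ x ∈ Y, (∀ i, ∑ s, β i s * x s = 0) → x = 0 := by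
  let b := Module.finBasis ℂ Y
  choose g hg using fun i => LinearMap.exists_extend (b.coord i)
  have key : ∀ i (x : Fin ℓ → ℂ), ∑ s, g i (Pi.single s 1) * x s = g i x := by
    intro i x
    conv_rhs => rw [← Finset.univ_sum_single x]
    rw [map_sum]
    refine Finset.sum_congr rfl fun s _ => ?_
    have : (Pi.single s (x s) : Fin ℓ → ℂ) = x s • Pi.single s 1 := by
      rw [← Pi.single_smul]; simp
    rw [this, map_smul, smul_eq_mul, mul_comm]
  have key2 : ∀ i (x : Y), g i x = b.coord i x := fun i x => LinearMap.congr_fun (hg i) x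
  refine ⟨fun i => b i, fun i s => g i (Pi.single s 1), fun i => (b i).2, fun i j => ?_, ?_⟩
  · rw [key, key2]
    simp [Finsupp.single_apply, eq_comm]
  · intro x hx h
    have : (⟨x, hx⟩ : Y) = 0 := by
      apply b.ext_elem
      intro i
      have := h i
      rw [key, key2 i ⟨x, hx⟩] at this
      simpa using this
    exact congrArg Subtype.val this

def AY (A : Finset (Spoly ℓ)) (Y : Submodule ℂ (Fin ℓ → ℂ)) : Finset (Spoly ℓ) :=
  A.filter fun α => Y ≤ LinearMap.ker (linFun α)

lemma mem_AY {A : Finset (Spoly ℓ)} {Y : Submodule ℂ (Fin ℓ → ℂ)} {α : Spoly ℓ} :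
    α ∈ AY A Y ↔ α ∈ A ∧ Y ≤ LinearMap.ker (linFun α) := Finset.mem_filter

def ints (C : Finset (Spoly ℓ)) : Submodule ℂ (Fin ℓ → ℂ) := ⨅ α ∈ C, LinearMap.ker (linFun α)

lemma le_ints {C : Finset (Spoly ℓ)} {Y : Submodule ℂ (Fin ℓ → ℂ)} :
    Y ≤ ints C ↔ ∀ α ∈ C, Y ≤ LinearMap.ker (linFun α) := by
  unfold ints; simp only [le_iInf_iff]

lemma ints_le {C : Finset (Spoly ℓ)} {α : Spoly ℓ} (h : α ∈ C) :
    ints C ≤ LinearMap.ker (linFun α) := le_ints.1 le_rfl α h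

lemma mem_LA {A : Finset (Spoly ℓ)} {Y : Submodule ℂ (Fin ℓ → ℂ)} :
    Y ∈ LA A ↔ ∃ C ⊆ A, ints C = Y := by
  unfold LA ints; simp

variable {A : Finset (Spoly ℓ)} {Y : Submodule ℂ (Fin ℓ → ℂ)} {r : ℕ}

def BS (A : Finset (Spoly ℓ)) (Y : Submodule ℂ (Fin ℓ → ℂ)) (τ : Fin r → Submodule ℂ (Fin ℓ → ℂ))
    (S : Finset (Fin r)) : Finset (Spoly ℓ) :=
  (AY A Y).filter fun α => ∀ i ∈ S, τ i ≤ LinearMap.ker (linFun α)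

lemma mem_BS {τ : Fin r → Submodule ℂ (Fin ℓ → ℂ)} {S : Finset (Fin r)} {α : Spoly ℓ} :
    α ∈ BS A Y τ S ↔ α ∈ A ∧ Y ≤ LinearMap.ker (linFun α) ∧
      ∀ i ∈ S, τ i ≤ LinearMap.ker (linFun α) := by
  unfold BS; rw [Finset.mem_filter, mem_AY, and_assoc]

lemma MB_mono {B B' : Finset (Spoly ℓ)} (hBA : B ⊆ A) (h : B' ⊆ B) : MB A B' ≤ MB A B := by
  rintro ψ ⟨h1, h2⟩
  refine ⟨fun α hα J => ?_, fun α hα hB J => h2 α hα (fun h3 => hB (h h3)) J⟩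
  by_cases h3 : α ∈ B'
  · exact h1 α h3 J
  · exact dvd_wedge _ (h2 α (hBA hα) h3) J

def qq (A : Finset (Spoly ℓ)) (Y Z : Submodule ℂ (Fin ℓ → ℂ)) : Spoly ℓ :=
  ∏ α ∈ (AY A Y).filter (fun α => ¬ Z ≤ LinearMap.ker (linFun α)), α

theorem local_poly (hA : IsArrangement A) (hY : Y ∈ LA A) (τ : Fin r → Submodule ℂ (Fin ℓ → ℂ))
    (hτ : ∀ Z, (∃ i, τ i = Z) ↔ Z ∈ LA A ∧ Y < Z)
    {k : ℕ} (v β : Fin k → Fin ℓ → ℂ)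
    (hβ2 : ∀ x ∈ Y, (∀ i, ∑ s, β i s * x s = 0) → x = 0) (p : ℕ) :
    ∃ g : Polynomial ℚ, (1 - PowerSeries.X) ^ k *
      (∑ S : Finset (Fin r), (-1) ^ S.card * hs (KB A (BS A Y τ S) v k p)) = (g : PowerSeries ℚ) := by
  have hsub : ∀ S, BS A Y τ S ⊆ A := fun S α h => (mem_BS.1 h).1
  let ys := List.ofFn fun i => ∑ s, C (β i s) * (X s : Spoly ℓ)
  have hlen : ys.length = k := List.length_ofFn
  have hyh : ∀ y ∈ ys, y.IsHomogeneous 1 := by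
    intro y hy
    obtain ⟨i, rfl⟩ := List.mem_ofFn.1 hy
    exact IsHomogeneous.sum _ _ _ fun s _ => (isHomogeneous_X _ _).C_mul _
  let q : Fin r → Spoly ℓ := fun i => qq A Y (τ i)
  obtain ⟨n, hn⟩ := nulls (Ideal.span (Set.range q) ⊔ Ideal.span {y | y ∈ ys}) (by
    intro x hx
    have hx1 : ∀ i, eval x (q i) = 0 := fun i =>
      hx _ (Ideal.mem_sup_left (Ideal.subset_span ⟨i, rfl⟩))
    have hx2 : ∀ i, ∑ s, β i s * x s = 0 := by
      intro i
      have := hx (∑ s, C (β i s) * (X s : Spoly ℓ))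
        (Ideal.mem_sup_right (Ideal.subset_span (List.mem_ofFn.2 ⟨i, rfl⟩)))
      simpa using this
    refine hβ2 x ?_ hx2
    by_contra hxY
    let Cx := (AY A Y).filter fun α => linFun α x = 0
    have hCA : Cx ⊆ A := fun α h => (mem_AY.1 (Finset.mem_filter.1 h).1).1
    have h1 : Y ≤ ints Cx := le_ints.2 fun α h => (mem_AY.1 (Finset.mem_filter.1 h).1).2
    have h2 : x ∈ ints Cx := by
      unfold ints
      simp only [Submodule.mem_iInf, LinearMap.mem_ker]
      exact fun α h => (Finset.mem_filter.1 h).2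
    have h3 : Y < ints Cx := lt_of_le_of_ne h1 (by intro h; rw [h] at hxY; exact hxY h2)
    obtain ⟨i, hi⟩ := (hτ (ints Cx)).2 ⟨mem_LA.2 ⟨Cx, hCA, rfl⟩, h3⟩
    have h4 := hx1 i
    simp only [q, qq] at h4
    rw [map_prod, Finset.prod_eq_zero_iff] at h4
    obtain ⟨α, h5, h6⟩ := h4
    obtain ⟨h7, h8⟩ := Finset.mem_filter.1 h5
    rw [eval_lin (hA.1 α (mem_AY.1 h7).1).1] at h6
    apply h8
    rw [hi]
    exact ints_le (Finset.mem_filter.2 ⟨h7, h6⟩))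
  have := koszul_poly (K := fun S => KB A (BS A Y τ S) v k p)
    (fun S => ((MB_gr (fun α h => (hA.1 α h).1) (hsub S)).inf (supp_gr p)).inf (bs_gr v k))
    (fun S i ψ hψ => ⟨⟨MB_mono (hsub S) (fun α h => by
      rw [mem_BS] at *
      exact ⟨h.1, h.2.1, fun j hj => h.2.2 j (by simp [hj])⟩) hψ.1.1, hψ.1.2⟩, hψ.2⟩)
    q
    (fun i S ψ hψ => ⟨⟨⟨fun α hα J => ?_, fun α hα hαB J => ?_⟩, Submodule.smul_mem _ _ hψ.1.2⟩,
      Submodule.smul_mem _ _ hψ.2⟩) ys hyh n hn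
  · rw [hlen] at this; exact this
  · rw [map_smul, Pi.smul_apply, smul_eq_mul]
    refine (hψ.1.1.1 α ?_ J).mul_left _
    rw [mem_BS] at *
    exact ⟨hα.1, hα.2.1, fun j hj => hα.2.2 j (by simp [hj])⟩
  · rw [Pi.smul_apply, smul_eq_mul]
    by_cases h : α ∈ BS A Y τ S
    · refine (Finset.dvd_prod_of_mem (fun α => α) ?_).mul_right _
      rw [mem_BS] at *
      rw [Finset.mem_filter, mem_AY]
      refine ⟨⟨h.1, h.2.1⟩, fun h2 => hαB ⟨h.1, h.2.1, fun j hj => ?_⟩⟩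
      rcases Finset.mem_insert.1 hj with rfl | h3
      · exact h2
      · exact h.2.2 j h3
    · exact (hψ.1.1.2 α hα h J).mul_left _
end geom
end ST

namespace ST
section base
variable {ℓ : ℕ} {A : Finset (Spoly ℓ)}

lemma finrank_hom (d : ℕ) : Module.finrank ℂ (homogeneousSubmodule (Fin ℓ) ℂ d) =
    (Finset.finsuppAntidiag (Finset.univ : Finset (Fin ℓ)) d).card := by
  let F := Finset.finsuppAntidiag (Finset.univ : Finset (Fin ℓ)) d
  let b : F → Spoly ℓ := fun m => basisMonomials (Fin ℓ) ℂ m.1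
  have hb : LinearIndependent ℂ b :=
    (basisMonomials (Fin ℓ) ℂ).linearIndependent.comp _ Subtype.val_injective
  have h := finrank_span_eq_card hb
  have e : Submodule.span ℂ (Set.range b) = homogeneousSubmodule (Fin ℓ) ℂ d := by
    apply le_antisymm
    · rw [Submodule.span_le]
      rintro _ ⟨m, rfl⟩
      have := Finset.mem_finsuppAntidiag.1 m.2
      simp only [b, coe_basisMonomials, SetLike.mem_coe, mem_homogeneousSubmodule]
      apply isHomogeneous_monomial
      rw [Finsupp.degree_eq_sum]; exact this.1
    · intro f hf
      rw [f.as_sum]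
      refine Submodule.sum_mem _ fun m hm => ?_
      have h1 : m ∈ F := by
        rw [Finset.mem_finsuppAntidiag]
        refine ⟨?_, Finset.subset_univ _⟩
        have := (mem_homogeneousSubmodule d f).1 hf (mem_support_iff.1 hm)
        rw [← Finsupp.degree_eq_sum]
        rw [← this, Finsupp.degree_eq_weight_one]; rfl
      have h2 : monomial m (coeff m f) = coeff m f • b ⟨m, h1⟩ := by
        simp [b, smul_monomial]
      rw [h2]
      exact Submodule.smul_mem _ _ (Submodule.subset_span ⟨_, rfl⟩)
  rw [← e, h]
  simp [F]

lemma hsS : (1 - PowerSeries.X) ^ ℓ * (PowerSeries.mk fun d =>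
    (Module.finrank ℂ (homogeneousSubmodule (Fin ℓ) ℂ d) : ℚ)) = 1 := by
  have : (PowerSeries.mk fun d => (Module.finrank ℂ (homogeneousSubmodule (Fin ℓ) ℂ d) : ℚ)) =
      ∏ _i : Fin ℓ, (PowerSeries.mk 1 : PowerSeries ℚ) := by
    ext d
    rw [PowerSeries.coeff_prod, PowerSeries.coeff_mk, finrank_hom]
    simp
  rw [this, Finset.prod_const, Finset.card_univ, Fintype.card_fin, ← mul_pow, mul_comm,
    PowerSeries.mk_one_mul_one_sub_eq_one, one_pow]

lemma prod_dvd (hA : IsArrangement A) {f : Spoly ℓ} (h : ∀ α ∈ A, α ∣ f) : ∏ α ∈ A, α ∣ f := by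
  refine Finset.prod_dvd_of_isRelPrime (fun α hα β hβ hne => ?_) h
  rw [Function.onFun]
  rw [(arr_prime hA hα).irreducible.isRelPrime_iff_not_dvd]
  intro hd
  obtain ⟨c, hc⟩ := lin_dvd (hA.1 α hα).1 (hA.1 β hβ).1 hd
  exact hA.2 β hβ α hα (Ne.symm hne) c hc

lemma Q_homog (hA : IsArrangement A) : (∏ α ∈ A, α).IsHomogeneous A.card := by
  have := IsHomogeneous.prod A (fun α => α) (fun _ => 1) (fun α h => (hA.1 α h).1)
  simpa using this

lemma Q_ne (hA : IsArrangement A) : (∏ α ∈ A, α) ≠ 0 :=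
  Finset.prod_ne_zero_iff.2 fun α h => (hA.1 α h).2

lemma hs_zero0 (hA : IsArrangement A) : hs (MB A ∅ ⊓ supp ℓ 0) = PowerSeries.X ^ A.card *
    (PowerSeries.mk fun d => (Module.finrank ℂ (homogeneousSubmodule (Fin ℓ) ℂ d) : ℚ)) := by
  ext d
  rw [PowerSeries.coeff_X_pow_mul', hs, PowerSeries.coeff_mk, PowerSeries.coeff_mk]
  have hQ := Q_homog hA
  have hdiv : ∀ ψ ∈ pc (MB A ∅ ⊓ supp ℓ 0) d, ∃ g, ψ ∅ = (∏ α ∈ A, α) * g ∧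
      ψ ∅ = if A.card ≤ d then (∏ α ∈ A, α) * homogeneousComponent (d - A.card) g else 0 := by
    rintro ψ ⟨⟨h1, h2⟩, h3⟩
    obtain ⟨g, hg⟩ := prod_dvd hA (fun α hα => h1.2 α hα (by simp) ∅)
    refine ⟨g, hg, ?_⟩
    have := homogeneousComponent_of_mem (h3 ∅) (m := d)
    rw [if_pos rfl] at this
    rw [← this, hg, homog_mul hQ]
  have hz : ∀ ψ ∈ pc (MB A ∅ ⊓ supp ℓ 0) d, ∀ I, I ≠ ∅ → ψ I = 0 := by
    rintro ψ ⟨⟨h1, h2⟩, h3⟩ I hI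
    exact h2 I (by simpa using hI)
  split_ifs with hd
  · norm_cast
    unfold hf
    symm
    let T : homogeneousSubmodule (Fin ℓ) ℂ (d - A.card) →ₗ[ℂ] Form ℓ :=
      { toFun := fun f => fun I => if I = ∅ then (∏ α ∈ A, α) * f.1 else 0
        map_add' := fun f g => by funext I; by_cases h : I = ∅ <;> simp [h, mul_add]
        map_smul' := fun c g => by funext I; by_cases h : I = ∅ <;> simp [h] }
    have hT : Function.Injective T := by
      intro f g h
      have := congrFun h ∅
      simp only [T, LinearMap.coe_mk, AddHom.coe_mk, if_true] at this
      exact Subtype.ext (mul_left_cancel₀ (Q_ne hA) this)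
    have hr : LinearMap.range T = pc (MB A ∅ ⊓ supp ℓ 0) d := by
      apply le_antisymm
      · rintro _ ⟨f, rfl⟩
        refine ⟨⟨⟨by simp, fun α hα _ J => ?_⟩, fun I hI => ?_⟩, fun I => ?_⟩
        · by_cases h : J = ∅
          · simp only [T, LinearMap.coe_mk, AddHom.coe_mk, if_pos h]
            exact (Finset.dvd_prod_of_mem (fun α => α) hα).mul_right _
          · simp [T, h]
        · have : I ≠ ∅ := by rintro rfl; simp at hI
          simp [T, this]
        · by_cases h : I = ∅
          · simp only [T, LinearMap.coe_mk, AddHom.coe_mk, if_pos h]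
            have := hQ.mul ((mem_homogeneousSubmodule _ _).1 f.2)
            rwa [Nat.add_sub_cancel' hd] at this
          · simp only [T, LinearMap.coe_mk, AddHom.coe_mk, if_neg h]
            exact isHomogeneous_zero _ _ _
      · intro ψ hψ
        obtain ⟨g, hg, hg2⟩ := hdiv ψ hψ
        rw [if_pos hd] at hg2
        refine ⟨⟨homogeneousComponent (d - A.card) g, homogeneousComponent_mem _ _⟩, ?_⟩
        funext I
        by_cases h : I = ∅
        · simp only [T, LinearMap.coe_mk, AddHom.coe_mk, if_pos h]
          rw [h, hg2]
        · simp only [T, LinearMap.coe_mk, AddHom.coe_mk, if_neg h]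
          exact (hz ψ hψ I h).symm
    rw [← hr, LinearMap.finrank_range_of_inj hT]
  · have : pc (MB A ∅ ⊓ supp ℓ 0) d = ⊥ := by
      rw [eq_bot_iff]
      intro ψ hψ
      obtain ⟨g, hg, hg2⟩ := hdiv ψ hψ
      rw [if_neg hd] at hg2
      rw [Submodule.mem_bot]
      funext I
      by_cases h : I = ∅
      · rw [h, hg2]; rfl
      · exact hz ψ hψ I h
    unfold hf; rw [this]; simp

def Phi (A B : Finset (Spoly ℓ)) : Polynomial (PowerSeries ℚ) :=
  ∑ p ∈ Finset.range (ℓ + 1), Polynomial.C (hs (MB A B ⊓ supp ℓ p)) * Polynomial.X ^ p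

def Psi (A B : Finset (Spoly ℓ)) : Polynomial (PowerSeries ℚ) := (Phi A B).comp LL

lemma KB_std {B : Finset (Spoly ℓ)} (p : ℕ) :
    KB A B (fun i : Fin ℓ => (Pi.single i 1 : Fin ℓ → ℂ)) ℓ (p + 1) = ⊥ := by
  rw [eq_bot_iff]
  rintro ψ ⟨⟨h1, h2⟩, h3⟩
  rw [Submodule.mem_bot]
  funext I
  by_cases hI : I.card = p + 1
  swap
  · exact h2 I hI
  obtain ⟨i, hi⟩ : I.Nonempty := by rw [← Finset.card_pos]; omega
  have := congrFun (h3 i i.2) (I.erase i)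
  rw [contr_coeff, Finset.sum_eq_single i] at this
  · rw [if_neg (by simp)] at this
    have e : insert i (I.erase i) = I := Finset.insert_erase hi
    have e2 : ∀ J, (J = insert i (I.erase i)) → ψ J = ψ I := fun J hJ => by rw [hJ, e]
    rw [e2 _ (by congr!)] at this
    simp only [cv, Pi.single_eq_same, map_one, one_smul, Pi.zero_apply] at this
    rw [zsmul_eq_mul, mul_eq_zero] at this
    refine this.resolve_left ?_
    have h5 : sg i (I.erase i) ≠ 0 := by unfold sg; simp
    exact_mod_cast h5
  · intro j _ hj
    simp [cv, hj]
  · simp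

theorem base_val (hA : IsArrangement A) : HVP (Psi A ∅) (Polynomial.X ^ ℓ) := by
  have h := KB_poly (A := A) (B := ∅) (fun i : Fin ℓ => (Pi.single i 1 : Fin ℓ → ℂ))
    (fun i : Fin ℓ => (Pi.single i 1 : Fin ℓ → ℂ)) (by simp) (fun i j => by
      simp [Pi.single_apply, eq_comm]) ℓ le_rfl
  have h2 : Phi A ∅ = (1 + Polynomial.X) ^ ℓ * Polynomial.C (hs (MB A ∅ ⊓ supp ℓ 0)) := by
    unfold Phi
    rw [h, Finset.sum_eq_single 0]
    · simp [KB_step0]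
    · intro p _ hp
      obtain ⟨p, rfl⟩ := Nat.exists_eq_succ_of_ne_zero hp
      rw [Nat.succ_eq_add_one, KB_std]
      have : hs (⊥ : Submodule (Spoly ℓ) (Form ℓ)) = 0 := by
        ext d
        have : pc (⊥ : Submodule (Spoly ℓ) (Form ℓ)) d = ⊥ := by
          rw [eq_bot_iff]; intro w hw; exact hw.1
        have h0 : hf (⊥ : Submodule (Spoly ℓ) (Form ℓ)) d = 0 := by
          unfold hf; rw [this]; simp
        simp [hs, h0]
      rw [this]; simp
    · simp
  have h3 : Psi A ∅ = Polynomial.X ^ ℓ * Polynomial.C ((Polynomial.X ^ A.card : Polynomial ℚ) : PowerSeries ℚ) := by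
    unfold Psi
    rw [h2, hs_zero0 hA]
    simp only [Polynomial.mul_comp, Polynomial.pow_comp, Polynomial.add_comp, Polynomial.one_comp,
      Polynomial.X_comp, Polynomial.C_comp]
    have : 1 + LL = Polynomial.C (1 - PowerSeries.X) * Polynomial.X := by unfold LL; ring
    rw [this, mul_pow, ← Polynomial.C_pow, mul_comm (Polynomial.C _), mul_assoc, ← Polynomial.C_mul,
      mul_left_comm, hsS]
    simp
  rw [h3]
  have := (HVP.X.pow ℓ).mul (HVP.C (Polynomial.X ^ A.card))
  simpa using this
end base
end ST

namespace ST
section ind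
variable {ℓ : ℕ} {A : Finset (Spoly ℓ)} {μ : Submodule ℂ (Fin ℓ → ℂ) → ℤ}

def mm (μ : Submodule ℂ (Fin ℓ → ℂ) → ℤ) (Z : Submodule ℂ (Fin ℓ → ℂ)) : Polynomial ℚ :=
  Polynomial.C (μ Z : ℚ) * Polynomial.X ^ Module.finrank ℂ Z

def chi (A : Finset (Spoly ℓ)) (μ : Submodule ℂ (Fin ℓ → ℂ) → ℤ) (Y : Submodule ℂ (Fin ℓ → ℂ)) :
    Polynomial ℚ := ∑ Z ∈ (LA A).filter (fun Z => Y ≤ Z), mm μ Z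

lemma AY_top (hA : IsArrangement A) : AY A ⊤ = ∅ := by
  rw [Finset.eq_empty_iff_forall_notMem]
  intro α h
  obtain ⟨h1, h2⟩ := mem_AY.1 h
  apply (hA.1 α h1).2
  rw [← lin_eq (hA.1 α h1).1]
  refine Finset.sum_eq_zero fun i _ => ?_
  have h3 : linFun α (Pi.single i 1) = 0 := h2 trivial
  have : coeff (Finsupp.single i 1) α = 0 := by
    simpa [linFun, LinearMap.sum_apply, Pi.single_apply] using h3
  simp [cf, this]

lemma psi_eval (hA : IsArrangement A) {B : Finset (Spoly ℓ)} (hB : B ⊆ A) (hne : B.Nonempty) :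
    (Psi A B).eval 1 = 0 := by
  obtain ⟨α, hα⟩ := hne
  unfold Psi Phi LL
  rw [Polynomial.eval_comp]
  have := euler_vanish hA hB hα
  simp only [Polynomial.eval_finsetSum, Polynomial.eval_mul, Polynomial.eval_C, Polynomial.eval_pow,
    Polynomial.eval_X, Polynomial.eval_sub, Polynomial.eval_one, mul_one]
  rw [← this]
  refine Finset.sum_congr rfl fun p _ => ?_
  congr 2; ring

lemma ints_AY {Y : Submodule ℂ (Fin ℓ → ℂ)} (hY : Y ∈ LA A) : ints (AY A Y) = Y := by
  apply le_antisymm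
  · obtain ⟨C, hC, rfl⟩ := mem_LA.1 hY
    exact le_ints.2 fun α h => ints_le (mem_AY.2 ⟨hC h, ints_le h⟩)
  · exact le_ints.2 fun α h => (mem_AY.1 h).2

/-- alternating sum identity -/
lemma alt_sum {r : ℕ} (A : Finset (Spoly ℓ)) (μ : Submodule ℂ (Fin ℓ → ℂ) → ℤ)
    {Y : Submodule ℂ (Fin ℓ → ℂ)} (hY : Y ∈ LA A) (τ : Fin r → Submodule ℂ (Fin ℓ → ℂ))
    (hτ : ∀ Z, (∃ i, τ i = Z) ↔ Z ∈ LA A ∧ Y < Z) :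
    ∑ S : Finset (Fin r), (-1) ^ S.card *
      ∑ Z ∈ (LA A).filter (fun Z => Y ≤ Z ∧ ∀ i ∈ S, τ i ≤ Z), mm μ Z = mm μ Y := by
  have h1 : ∀ S : Finset (Fin r), (-1 : Polynomial ℚ) ^ S.card *
      ∑ Z ∈ (LA A).filter (fun Z => Y ≤ Z ∧ ∀ i ∈ S, τ i ≤ Z), mm μ Z =
      ∑ Z ∈ (LA A).filter (fun Z => Y ≤ Z), mm μ Z *
        (if S ⊆ Finset.univ.filter (fun i => τ i ≤ Z) then (-1) ^ S.card else 0) := by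
    intro S
    rw [← Finset.filter_filter, Finset.sum_filter _ (fun Z => mm μ Z), Finset.mul_sum]
    refine Finset.sum_congr rfl fun Z _ => ?_
    have : S ⊆ Finset.univ.filter (fun i => τ i ≤ Z) ↔ ∀ i ∈ S, τ i ≤ Z := by
      simp [Finset.subset_iff]
    by_cases h : ∀ i ∈ S, τ i ≤ Z
    · rw [if_pos h, if_pos (this.2 h)]; ring
    · rw [if_neg h, if_neg (fun h' => h (this.1 h'))]; ring
  rw [Finset.sum_congr rfl fun S _ => h1 S, Finset.sum_comm]
  simp only [← Finset.mul_sum]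
  have h2 : ∀ I : Finset (Fin r), ∑ S : Finset (Fin r), (if S ⊆ I then (-1 : Polynomial ℚ) ^ S.card else 0) =
      if I = ∅ then 1 else 0 := by
    intro I
    rw [← Finset.sum_filter]
    have e : Finset.univ.filter (fun S : Finset (Fin r) => S ⊆ I) = I.powerset := by ext; simp
    rw [e]
    have := congrArg (fun z : ℤ => (z : Polynomial ℚ)) (Finset.sum_powerset_neg_one_pow_card (x := I))
    push_cast at this
    rw [this]
  rw [Finset.sum_eq_single Y]
  · rw [h2, if_pos, mul_one]
    rw [Finset.filter_eq_empty_iff]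
    intro i _ hi
    exact absurd (lt_of_lt_of_le ((hτ _).1 ⟨i, rfl⟩).2 hi) (lt_irrefl _)
  · intro Z hZ hne
    obtain ⟨hZ1, hZ2⟩ := Finset.mem_filter.1 hZ
    obtain ⟨i, hi⟩ := (hτ Z).2 ⟨hZ1, lt_of_le_of_ne hZ2 (Ne.symm hne)⟩
    rw [h2, if_neg, mul_zero]
    intro h
    have : i ∈ Finset.univ.filter (fun i => τ i ≤ Z) := by simp [hi]
    rw [h] at this; simp at this
  · intro h
    exact absurd (Finset.mem_filter.2 ⟨hY, le_rfl⟩) h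

lemma BS_eq {r : ℕ} {Y : Submodule ℂ (Fin ℓ → ℂ)} (τ : Fin r → Submodule ℂ (Fin ℓ → ℂ))
    (S : Finset (Fin r)) : BS A Y τ S = AY A (ints (BS A Y τ S)) := by
  have h1 : Y ≤ ints (BS A Y τ S) := le_ints.2 fun α h => (mem_BS.1 h).2.1
  have h2 : ∀ i ∈ S, τ i ≤ ints (BS A Y τ S) := fun i hi =>
    le_ints.2 fun α h => (mem_BS.1 h).2.2 i hi
  ext α
  rw [mem_AY]
  constructor
  · exact fun h => ⟨(mem_BS.1 h).1, ints_le h⟩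
  · rintro ⟨h3, h4⟩
    exact mem_BS.2 ⟨h3, h1.trans h4, fun i hi => (h2 i hi).trans h4⟩

lemma ints_BS {r : ℕ} {Y : Submodule ℂ (Fin ℓ → ℂ)} (τ : Fin r → Submodule ℂ (Fin ℓ → ℂ))
    (S : Finset (Fin r)) {Z : Submodule ℂ (Fin ℓ → ℂ)} (hZ : Z ∈ LA A) :
    ints (BS A Y τ S) ≤ Z ↔ Y ≤ Z ∧ ∀ i ∈ S, τ i ≤ Z := by
  have h1 : Y ≤ ints (BS A Y τ S) := le_ints.2 fun α h => (mem_BS.1 h).2.1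
  have h2 : ∀ i ∈ S, τ i ≤ ints (BS A Y τ S) := fun i hi =>
    le_ints.2 fun α h => (mem_BS.1 h).2.2 i hi
  constructor
  · exact fun h => ⟨h1.trans h, fun i hi => (h2 i hi).trans h⟩
  · rintro ⟨h3, h4⟩
    obtain ⟨C, hC, rfl⟩ := mem_LA.1 hZ
    exact le_ints.2 fun α h => ints_le (mem_BS.2 ⟨hC h, h3.trans (ints_le h),
      fun i hi => (h4 i hi).trans (ints_le h)⟩)

lemma alt_Psi (hA : IsArrangement A) {r : ℕ} {Y : Submodule ℂ (Fin ℓ → ℂ)} (hY : Y ∈ LA A)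
    (τ : Fin r → Submodule ℂ (Fin ℓ → ℂ))
    (hτ : ∀ Z, (∃ i, τ i = Z) ↔ Z ∈ LA A ∧ Y < Z) :
    ∃ c : ℚ, HVP (∑ S : Finset (Fin r), (-1) ^ S.card * Psi A (BS A Y τ S))
      (Polynomial.C c * Polynomial.X ^ Module.finrank ℂ Y) := by
  obtain ⟨v, β, hv, hβ, hβ2⟩ := exists_dual Y
  choose g hg using local_poly hA hY τ hτ v β hβ2
  have h1 : ∀ S, Phi A (BS A Y τ S) = (1 + Polynomial.X) ^ Module.finrank ℂ Y *
      ∑ p ∈ Finset.range (ℓ + 1), Polynomial.C (hs (KB A (BS A Y τ S) v (Module.finrank ℂ Y) p)) *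
        Polynomial.X ^ p := fun S =>
    KB_poly v β (fun i α hα => (mem_BS.1 hα).2.1 (hv i)) hβ _ le_rfl
  have hL : 1 + LL = Polynomial.C (1 - PowerSeries.X) * Polynomial.X := by unfold LL; ring
  have h2 : ∑ S : Finset (Fin r), (-1) ^ S.card * Psi A (BS A Y τ S) =
      Polynomial.X ^ Module.finrank ℂ Y * ∑ p ∈ Finset.range (ℓ + 1),
        Polynomial.C (g p : PowerSeries ℚ) * LL ^ p := by
    have e : ∀ S, (-1) ^ S.card * Psi A (BS A Y τ S) = Polynomial.X ^ Module.finrank ℂ Y *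
        ∑ p ∈ Finset.range (ℓ + 1), Polynomial.C ((1 - PowerSeries.X) ^ Module.finrank ℂ Y *
          ((-1) ^ S.card * hs (KB A (BS A Y τ S) v (Module.finrank ℂ Y) p))) * LL ^ p := by
      intro S
      unfold Psi
      rw [h1, Polynomial.mul_comp, Polynomial.pow_comp, Polynomial.add_comp, Polynomial.one_comp,
        Polynomial.X_comp, hL, Polynomial.sum_comp, Finset.mul_sum, Finset.mul_sum,
        Finset.mul_sum]
      refine Finset.sum_congr rfl fun p _ => ?_
      rw [Polynomial.mul_comp, Polynomial.C_comp, Polynomial.pow_comp, Polynomial.X_comp]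
      simp only [Polynomial.C_mul, Polynomial.C_pow, Polynomial.C_neg, Polynomial.C_1, mul_pow]
      ring
    rw [Finset.sum_congr rfl fun S _ => e S, ← Finset.mul_sum, Finset.sum_comm]
    congr 1
    refine Finset.sum_congr rfl fun p _ => ?_
    rw [← Finset.sum_mul, ← map_sum, ← Finset.mul_sum, hg]
  refine ⟨∑ p ∈ Finset.range (ℓ + 1), (g p).eval 1 * (-1) ^ p, ?_⟩
  rw [h2]
  have := (HVP.X.pow (Module.finrank ℂ Y)).mul (HVP.sum (Finset.range (ℓ + 1)) (fun p _ =>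
    (HVP.C (g p)).mul (HVP_LL.pow p)))
  convert this using 1
  rw [mul_comm, map_sum]
  simp

theorem main_val (hA : IsArrangement A) (hμ : IsMoebius A μ) (Y : Submodule ℂ (Fin ℓ → ℂ)) :
    Y ∈ LA A → HVP (Psi A (AY A Y)) (chi A μ Y) := by
  induction Y using WellFoundedGT.induction with
  | ind Y ih =>
  intro hY
  by_cases htop : Y = ⊤
  · subst htop
    rw [AY_top hA]
    have : chi A μ ⊤ = Polynomial.X ^ ℓ := by
      unfold chi
      rw [Finset.sum_eq_single ⊤]
      · simp [mm, hμ.1]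
      · intro Z hZ hne
        exact absurd (top_le_iff.1 (Finset.mem_filter.1 hZ).2) hne
      · intro h
        exact absurd (Finset.mem_filter.2 ⟨hY, le_rfl⟩) h
    rw [this]
    exact base_val hA
  obtain ⟨r, τ, hτ⟩ : ∃ r, ∃ τ : Fin r → Submodule ℂ (Fin ℓ → ℂ),
      ∀ Z, (∃ i, τ i = Z) ↔ Z ∈ LA A ∧ Y < Z := by
    let T := (LA A).filter fun Z => Y < Z
    refine ⟨T.card, fun i => (T.equivFin.symm i).1, fun Z => ?_⟩
    rw [← Finset.mem_filter]
    constructor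
    · rintro ⟨i, rfl⟩; exact (T.equivFin.symm i).2
    · intro h; exact ⟨T.equivFin ⟨Z, h⟩, by simp⟩
  obtain ⟨c, hc⟩ := alt_Psi hA hY τ hτ
  have halt := alt_sum A μ hY τ hτ
  have hBS0 : BS A Y τ ∅ = AY A Y := by unfold BS; simp
  have hterm : ∀ S ∈ (Finset.univ : Finset (Finset (Fin r))).erase ∅,
      HVP ((-1) ^ S.card * Psi A (BS A Y τ S)) ((-1) ^ S.card *
        ∑ Z ∈ (LA A).filter (fun Z => Y ≤ Z ∧ ∀ i ∈ S, τ i ≤ Z), mm μ Z) := by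
    intro S hS
    obtain ⟨i, hi⟩ : S.Nonempty := Finset.nonempty_iff_ne_empty.2 (Finset.ne_of_mem_erase hS)
    refine (HVP.neg_one.pow _).mul ?_
    have hL : ints (BS A Y τ S) ∈ LA A := mem_LA.2 ⟨_, fun α h => (mem_BS.1 h).1, rfl⟩
    have hgt : Y < ints (BS A Y τ S) := lt_of_lt_of_le ((hτ _).1 ⟨i, rfl⟩).2
      (le_ints.2 fun α h => (mem_BS.1 h).2.2 i hi)
    have := ih _ hgt hL
    rw [← BS_eq] at this
    convert this using 1
    unfold chi
    refine Finset.sum_congr (Finset.filter_congr fun Z hZ => ?_) fun _ _ => rfl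
    rw [ints_BS τ S hZ]
  have hsum := HVP.sum _ hterm
  rw [← Finset.add_sum_erase _ _ (Finset.mem_univ ∅)] at hc halt
  simp only [Finset.card_empty, pow_zero, one_mul, hBS0, Finset.notMem_empty, false_implies,
    implies_true, and_true] at hc halt
  have h1 := hc.sub hsum
  rw [add_sub_cancel_right] at h1
  have hval : (Polynomial.C c * Polynomial.X ^ Module.finrank ℂ Y -
      ∑ S ∈ (Finset.univ : Finset (Finset (Fin r))).erase ∅, (-1) ^ S.card *
        ∑ Z ∈ (LA A).filter (fun Z => Y ≤ Z ∧ ∀ i ∈ S, τ i ≤ Z), mm μ Z) =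
      chi A μ Y + Polynomial.C (c - μ Y) * Polynomial.X ^ Module.finrank ℂ Y := by
    rw [eq_sub_of_add_eq' halt]
    unfold chi
    rw [Polynomial.C_sub]
    simp only [mm]
    ring
  rw [hval] at h1
  have hne : (AY A Y).Nonempty := by
    rw [Finset.nonempty_iff_ne_empty]
    intro h
    apply htop
    rw [← ints_AY hY, h]
    simp [ints]
  have h2 := h1.eval_one (psi_eval hA (Finset.filter_subset _ _) hne)
  have h3 : (chi A μ Y).eval 1 = 0 := by
    have := hμ.2 Y hY htop
    unfold chi mm
    simp only [Polynomial.eval_finsetSum, Polynomial.eval_mul, Polynomial.eval_C,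
      Polynomial.eval_pow, Polynomial.eval_X, one_pow, mul_one]
    exact_mod_cast this
  have h4 : c - μ Y = 0 := by simpa [h3] using h2
  rw [h4] at h1
  simpa using h1
end ind
end ST

namespace ST
section link
variable {ℓ : ℕ} {A : Finset (Spoly ℓ)}

lemma rational (hA : IsArrangement A) (p : ℕ) : ∃ g : Polynomial ℚ,
    (1 - PowerSeries.X) ^ ℓ * hs (MB A A ⊓ supp ℓ p) = (g : PowerSeries ℚ) := by
  let ys : List (Spoly ℓ) := List.ofFn (fun i => (X i : Spoly ℓ))
  obtain ⟨e, he⟩ := nulls ((⊥ : Ideal (Spoly ℓ)) ⊔ Ideal.span {y | y ∈ ys}) (by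
    intro v hv
    funext i
    have := hv (X i) (Ideal.mem_sup_right (Ideal.subset_span (List.mem_ofFn.2 ⟨i, rfl⟩)))
    simpa using this)
  obtain ⟨g, hg⟩ := hilbert_serre ys (by
      intro y hy
      obtain ⟨i, rfl⟩ := List.mem_ofFn.1 hy
      exact isHomogeneous_X _ _) (MB A A ⊓ supp ℓ p) ⊥
    ((MB_gr (fun α h => (hA.1 α h).1) subset_rfl).inf (supp_gr p)) isGr_bot bot_le ⊥
    (by
      intro q hq n _
      rw [Ideal.mem_bot.1 hq, zero_smul]; exact zero_mem _) e he
  refine ⟨g, ?_⟩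
  have h0 : hs (⊥ : Submodule (Spoly ℓ) (Form ℓ)) = 0 := by
    ext d
    have : pc (⊥ : Submodule (Spoly ℓ) (Form ℓ)) d = ⊥ := by
      rw [eq_bot_iff]; intro w hw; exact hw.1
    simp only [hs, PowerSeries.coeff_mk, hf]
    rw [this]; simp
  rw [h0, sub_zero] at hg
  simpa [ys] using hg

lemma pderiv_lin {α : Spoly ℓ} (h : α.IsHomogeneous 1) (j : Fin ℓ) : pderiv j α = cf α j := by
  conv_lhs => rw [← lin_eq h]
  rw [map_sum, Finset.sum_eq_single j]
  · simp [cf]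
  · intro i _ hij
    simp [cf, pderiv_X_of_ne hij]
  · simp

lemma wedgeCoeff_eq {p : ℕ} {α : Spoly ℓ} (h : α.IsHomogeneous 1) (φ : Form ℓ)
    (J : PIdx ℓ (p + 1)) : wedgeCoeff α (fun I : PIdx ℓ p => φ I.1) J = dw α φ J.1 := by
  unfold wedgeCoeff dw
  rw [wedge_coeff, ← Finset.sum_attach J.1]
  refine Finset.sum_congr rfl fun j _ => ?_
  rw [pderiv_lin h, smul_eq_mul, zsmul_eq_mul, sg]
  push_cast
  have : ∀ a b c : Spoly ℓ, a * b * c = b * (a * c) := fun a b c => by ring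
  rw [this]
  congr!

/-- `ψ ↦ ψ / Q` -/
def EE (A : Finset (Spoly ℓ)) (p : ℕ) : Form ℓ →ₗ[ℂ] RForm ℓ p where
  toFun ψ := fun I => algebraMap (Spoly ℓ) (Frac ℓ) (ψ I.1) *
    (algebraMap (Spoly ℓ) (Frac ℓ) (∏ α ∈ A, α))⁻¹
  map_add' f g := by funext I; simp [add_mul]
  map_smul' r f := by
    funext I
    simp only [Pi.smul_apply, RingHom.id_apply]
    rw [Algebra.smul_def, map_mul, mul_assoc, Algebra.smul_def,
      IsScalarTower.algebraMap_apply ℂ (Spoly ℓ) (Frac ℓ)]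

lemma aQ_ne (hA : IsArrangement A) : algebraMap (Spoly ℓ) (Frac ℓ) (∏ α ∈ A, α) ≠ 0 := by
  rw [Ne, IsFractionRing.to_map_eq_zero_iff]
  exact Q_ne hA

lemma EE_spec (hA : IsArrangement A) (p : ℕ) (ψ : Form ℓ) (I : PIdx ℓ p) :
    algebraMap (Spoly ℓ) (Frac ℓ) (∏ α ∈ A, α) * EE A p ψ I =
      algebraMap (Spoly ℓ) (Frac ℓ) (ψ I.1) := by
  simp only [EE, LinearMap.coe_mk, AddHom.coe_mk]
  rw [mul_left_comm, mul_inv_cancel₀ (aQ_ne hA), mul_one]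

lemma Qpoly_one : Qpoly A (fun _ => 1) = ∏ α ∈ A, α := by simp [Qpoly]

lemma gen_fwd (hA : IsArrangement A) {p : ℕ} {d : ℤ} {ω : RForm ℓ p}
    (h1 : ω ∈ OmegaMod A (fun _ => 1) p) (h2 : IsHomogForm ω d) :
    ∃ ψ ∈ MB A A ⊓ supp ℓ p, EE A p ψ = ω ∧
      (∀ e : ℕ, d + A.card = e → ψ ∈ Fd _ ℓ e) ∧ (d + A.card < 0 → ψ = 0) := by
  obtain ⟨ψ, hψ, hd⟩ := h1
  rw [Qpoly_one] at hψ
  let φ : Form ℓ := fun I => if h : I.card = p then ψ ⟨I, h⟩ else 0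
  have hφ : ∀ I : PIdx ℓ p, φ I.1 = ψ I := fun I => by simp only [φ]; rw [dif_pos I.2]
  have hφ' : (fun I : PIdx ℓ p => φ I.1) = ψ := funext hφ
  have hs : φ ∈ supp ℓ p := fun I hI => by simp only [φ]; rw [dif_neg hI]
  have hom : ∀ I : PIdx ℓ p, ∃ (h g : Spoly ℓ) (a b : ℕ), h ≠ 0 ∧ g.IsHomogeneous a ∧
      h.IsHomogeneous b ∧ d = (a : ℤ) - b ∧ h * ψ I = (∏ α ∈ A, α) * g := by
    intro I
    obtain ⟨g, h, a, b, h0, hg, hh, hab, e⟩ := h2 I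
    refine ⟨h, g, a, b, h0, hg, hh, hab, ?_⟩
    apply IsFractionRing.injective (Spoly ℓ) (Frac ℓ)
    rw [map_mul, map_mul, ← hψ, ← e]; ring
  refine ⟨φ, ⟨⟨?_, fun α h h' => absurd h h'⟩, hs⟩, ?_, ?_, ?_⟩
  · intro α hα J
    by_cases hJ : J.card = p + 1
    · have := hd α hα ⟨J, hJ⟩
      rw [pow_one, ← hφ', wedgeCoeff_eq (hA.1 α hα).1] at this
      exact this
    · have : dw α φ J = 0 := wedge_supp _ hs J hJ
      rw [this]; exact dvd_zero _
  · funext I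
    apply mul_left_cancel₀ (aQ_ne hA)
    rw [EE_spec hA, hφ, hψ]
  · intro e he I
    by_cases hI : I.card = p
    · obtain ⟨h, g, a, b, h0, hg, hh, hab, e1⟩ := hom ⟨I, hI⟩
      rw [← hφ] at e1
      have e2 := homog_mul hh (φ I) (b + e)
      rw [e1, if_pos (by omega), Nat.add_sub_cancel_left] at e2
      rw [homogeneousComponent_of_mem ((Q_homog hA).mul hg), if_pos (by omega), ← e1] at e2
      rw [mul_left_cancel₀ h0 e2]
      exact homogeneousComponent_isHomogeneous _ _
    · rw [hs I hI]; exact isHomogeneous_zero _ _ _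
  · intro hlt
    funext I
    by_cases hI : I.card = p
    · obtain ⟨h, g, a, b, h0, hg, hh, hab, e1⟩ := hom ⟨I, hI⟩
      rw [← hφ] at e1
      have e2 := homog_mul hh (φ I) (A.card + a)
      rw [e1, if_neg (by omega)] at e2
      rw [homogeneousComponent_of_mem ((Q_homog hA).mul hg), if_pos rfl, ← e1] at e2
      exact (mul_eq_zero.1 e2).resolve_left h0
    · exact hs I hI

lemma gen_bwd (hA : IsArrangement A) {p e : ℕ} {d : ℤ} (he : d + A.card = e) {ψ : Form ℓ}
    (h : ψ ∈ pc (MB A A ⊓ supp ℓ p) e) :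
    EE A p ψ ∈ OmegaMod A (fun _ => 1) p ∧ IsHomogForm (EE A p ψ) d := by
  obtain ⟨⟨h1, h2⟩, h3⟩ := mem_pc.1 h
  refine ⟨⟨fun I => ψ I.1, fun I => ?_, fun α hα J => ?_⟩, fun I => ?_⟩
  · rw [Qpoly_one]; exact EE_spec hA p ψ I
  · rw [pow_one, wedgeCoeff_eq (hA.1 α hα).1]
    exact h1.1 α hα J.1
  · exact ⟨ψ I.1, ∏ α ∈ A, α, e, A.card, Q_ne hA, h3 I.1, Q_homog hA, by omega,
      EE_spec hA p ψ I⟩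

lemma finrank_piece (hA : IsArrangement A) (p : ℕ) (d : ℤ) :
    Module.finrank ℂ (OmegaPiece A (fun _ => 1) p d) =
      if d + A.card < 0 then 0 else hf (MB A A ⊓ supp ℓ p) (d + A.card).natAbs := by
  split_ifs with hlt
  · have : OmegaPiece A (fun _ => 1) p d = ⊥ := by
      rw [eq_bot_iff, OmegaPiece, Submodule.span_le]
      rintro ω ⟨h1, h2⟩
      obtain ⟨ψ, _, h3, _, h4⟩ := gen_fwd hA h1 h2
      rw [h4 hlt, map_zero] at h3
      exact h3.symm
    rw [this]; simp
  · have he : d + A.card = ((d + A.card).natAbs : ℤ) := by omega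
    generalize (d + A.card).natAbs = e at he ⊢
    have h1 : OmegaPiece A (fun _ => 1) p d =
        LinearMap.range ((EE A p).domRestrict (pc (MB A A ⊓ supp ℓ p) e)) := by
      rw [LinearMap.range_domRestrict]
      apply le_antisymm
      · rw [OmegaPiece, Submodule.span_le]
        rintro ω ⟨h1, h2⟩
        obtain ⟨ψ, h, h3, h4, _⟩ := gen_fwd hA h1 h2
        exact ⟨ψ, mem_pc.2 ⟨h, h4 e he⟩, h3⟩
      · rintro _ ⟨ψ, h, rfl⟩
        exact Submodule.subset_span (gen_bwd hA he h)
    rw [h1, LinearMap.finrank_range_of_inj, hf]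
    rw [injective_iff_map_eq_zero]
    rintro ⟨ψ, h⟩ h0
    rw [LinearMap.domRestrict_apply] at h0
    ext1
    funext I
    by_cases hI : I.card = p
    · have := EE_spec hA p ψ ⟨I, hI⟩
      rw [h0] at this
      simp only [Pi.zero_apply, mul_zero] at this
      exact (IsFractionRing.to_map_eq_zero_iff (K := Frac ℓ)).1 this.symm
    · exact (mem_pc.1 h).1.2 I hI

lemma coeff_Psi (k : ℕ) (A B : Finset (Spoly ℓ)) : (Psi A B).coeff k =
    (1 - PowerSeries.X) ^ k * ∑ p ∈ Finset.range (ℓ + 1),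
      PowerSeries.C ((-1 : ℚ) ^ (p - k) * (p.choose k : ℚ)) * hs (MB A B ⊓ supp ℓ p) := by
  have hL : LL = (Polynomial.X + Polynomial.C (-1 : PowerSeries ℚ)).comp
      (Polynomial.C (1 - PowerSeries.X) * Polynomial.X) := by
    simp [LL, sub_eq_add_neg]
  have hp : ∀ p, (LL ^ p).coeff k = (-1) ^ (p - k) * (p.choose k : PowerSeries ℚ) *
      (1 - PowerSeries.X) ^ k := by
    intro p
    rw [hL, ← Polynomial.pow_comp, Polynomial.comp_C_mul_X_coeff, Polynomial.coeff_X_add_C_pow]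
  rw [Psi, Phi, Polynomial.sum_comp, Polynomial.finsetSum_coeff, Finset.mul_sum]
  refine Finset.sum_congr rfl fun p _ => ?_
  rw [Polynomial.mul_comp, Polynomial.C_comp, Polynomial.pow_comp, Polynomial.X_comp,
    Polynomial.coeff_C_mul, hp]
  simp only [map_mul, map_pow, map_neg, map_one, map_natCast]
  ring

end link
end ST

namespace ST
section transfer
open scoped RatFunc
variable {F : Type*} [Field F]

/-- rational functions into Laurent series -/
def ph : RatFunc F →+* LaurentSeries F := (algebraMap (RatFunc F) (LaurentSeries F) :)
/-- power series into Laurent series -/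
def io : PowerSeries F →+* LaurentSeries F := HahnSeries.ofPowerSeries ℤ F

lemma ph_poly (P : Polynomial F) : ph (algebraMap (Polynomial F) (RatFunc F) P) =
    io (P : PowerSeries F) := (RatFunc.coe_coe P).symm

lemma ph_inj : Function.Injective (ph (F := F)) := ph.injective

lemma ph_smul (c : F) (r : RatFunc F) : ph (c • r) = io (PowerSeries.C c) * ph r := by
  have : c • r = algebraMap (Polynomial F) (RatFunc F) (Polynomial.C c) * r := by
    rw [RatFunc.algebraMap_C, RatFunc.smul_eq_C_mul]
  rw [this, map_mul, ph_poly, Polynomial.coe_C]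

lemma exists_r (g : Polynomial F) (f : PowerSeries F) (l n : ℕ)
    (h : (1 - PowerSeries.X) ^ l * f = (g : PowerSeries F)) :
    ∃ r : RatFunc F, io (PowerSeries.X ^ n) * ph r = io f := by
  let a : Polynomial F := (1 - Polynomial.X) ^ l
  let b : Polynomial F := Polynomial.X ^ n
  have ha : a ≠ 0 := by
    intro h0
    have := congrArg (Polynomial.eval 0) h0
    simp [a] at this
  have hb : b ≠ 0 := pow_ne_zero _ Polynomial.X_ne_zero
  have ha' : algebraMap (Polynomial F) (RatFunc F) a ≠ 0 := RatFunc.algebraMap_ne_zero ha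
  have hb' : algebraMap (Polynomial F) (RatFunc F) b ≠ 0 := RatFunc.algebraMap_ne_zero hb
  refine ⟨algebraMap _ _ g / (algebraMap _ _ a * algebraMap _ _ b), ?_⟩
  have e1 : algebraMap (Polynomial F) (RatFunc F) a * (algebraMap _ _ b *
    (algebraMap _ _ g / (algebraMap _ _ a * algebraMap _ _ b))) = algebraMap _ _ g := by
    field_simp
  have e2 := congrArg ph e1
  rw [map_mul, map_mul, ph_poly, ph_poly, ph_poly g, ← h, map_mul] at e2
  have ea : (a : PowerSeries F) = (1 - PowerSeries.X) ^ l := by simp [a]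
  have eb : (b : PowerSeries F) = PowerSeries.X ^ n := by simp [b]
  rw [ea, eb] at e2
  refine mul_left_cancel₀ ?_ e2
  rw [← ea, ← ph_poly]
  exact fun h0 => ha' (ph_inj (h0.trans ph.map_zero.symm))

lemma coeff_r (r : RatFunc F) (f : PowerSeries F) (n : ℕ)
    (h : io (PowerSeries.X ^ n) * ph r = io f) (d : ℤ) :
    (ph r).coeff d = if d + n < 0 then 0 else PowerSeries.coeff (d + n).natAbs f := by
  have h1 := congrArg (fun z : LaurentSeries F => z.coeff (d + n)) h
  simp only [io, HahnSeries.ofPowerSeries_X_pow, HahnSeries.coeff_single_mul, one_mul] at h1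
  rw [PowerSeries.coeff_coe] at h1
  simpa using h1

end transfer
end ST

/-- Solomon–Terao's formula: the Hilbert series `H(Ω^p(𝒜), x)` are rational functions
`r p` of `x`, and each `t`-coefficient of
`Φ(𝒜; x, t(1-x) - 1) = ∑_{p=0}^ℓ H(Ω^p(𝒜), x)·(t(1-x)-1)^p`
(the coefficient of `t^k` being `(1-x)^k ∑_p (-1)^{p-k} (p choose k) H(Ω^p(𝒜), x)`)
is regular at `x = 1` (it can be written `u/v` with `v(1) ≠ 0`), with value at `x = 1`
the corresponding coefficient of the characteristic polynomial
`χ(𝒜, t) = ∑_{X ∈ L(𝒜)} μ(X) t^{dim X}`. -/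
theorem solomon_terao (ℓ : ℕ) (A : Finset (Spoly ℓ)) (hA : IsArrangement A)
    (μ : Submodule ℂ (Fin ℓ → ℂ) → ℤ) (hμ : IsMoebius A μ) :
    ∃ r : ℕ → RatFunc ℚ,
      (∀ p ≤ ℓ, ∀ d : ℤ,
        ((r p : LaurentSeries ℚ)).coeff d =
          (Module.finrank ℂ (OmegaPiece A (fun _ => 1) p d) : ℚ)) ∧
      ∀ k : ℕ, ∃ u v : Polynomial ℚ, Polynomial.eval 1 v ≠ 0 ∧
        ((1 - RatFunc.X) ^ k *
            ∑ p ∈ Finset.range (ℓ+1),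
              ((-1 : ℚ) ^ (p - k) * (p.choose k : ℚ)) • r p) *
          algebraMap (Polynomial ℚ) (RatFunc ℚ) v = algebraMap (Polynomial ℚ) (RatFunc ℚ) u ∧
        Polynomial.coeff
            (∑ Y ∈ LA A, (μ Y : ℚ) • (Polynomial.X : Polynomial ℚ) ^ (Module.finrank ℂ Y)) k *
          Polynomial.eval 1 v = Polynomial.eval 1 u := by
  choose g hg using fun p => ST.rational hA p
  choose r hr using fun p => ST.exists_r (g p) _ ℓ A.card (hg p)
  refine ⟨r, ?_, ?_⟩
  · intro p _ d
    have h1 := ST.coeff_r (r p) _ A.card (hr p) d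
    rw [ST.finrank_piece hA]
    refine h1.trans ?_
    split_ifs
    · simp
    · simp [ST.hs]
  · intro k
    have hY : ST.ints A ∈ LA A := ST.mem_LA.2 ⟨A, subset_rfl, rfl⟩
    have hAY : ST.AY A (ST.ints A) = A := by
      ext α
      rw [ST.mem_AY]
      exact ⟨fun h => h.1, fun h => ⟨h, ST.ints_le h⟩⟩
    have hchi : ST.chi A μ (ST.ints A) = ∑ Y ∈ LA A, (μ Y : ℚ) •
        (Polynomial.X : Polynomial ℚ) ^ (Module.finrank ℂ Y) := by
      rw [ST.chi, Finset.filter_true_of_mem]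
      · refine Finset.sum_congr rfl fun Y _ => ?_
        rw [ST.mm, Polynomial.smul_eq_C_mul]
      · intro Z hZ
        obtain ⟨C, hC, rfl⟩ := ST.mem_LA.1 hZ
        exact ST.le_ints.2 fun α hα => ST.ints_le (hC hα)
    have hm := ST.main_val hA hμ (ST.ints A) hY
    rw [hAY, hchi] at hm
    obtain ⟨u, v, hv, huv, hval⟩ := hm.coeff k
    refine ⟨u, Polynomial.X ^ A.card * v, by simpa using hv, ?_, by simpa using hval⟩
    apply ST.ph_inj
    rw [ST.ph_poly u, ← huv, ST.coeff_Psi, map_mul, map_mul, map_pow, map_sum, ST.ph_poly]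
    have hX : ST.ph (1 - RatFunc.X) = ST.io (1 - PowerSeries.X : PowerSeries ℚ) := by
      have := ST.ph_poly (1 - Polynomial.X : Polynomial ℚ)
      simpa using this
    rw [hX]
    simp only [ST.ph_smul, map_mul, map_sum, map_pow, ← hr, Polynomial.coe_mul, Polynomial.coe_pow,
      Polynomial.coe_X, Finset.mul_sum, Finset.sum_mul]
    refine Finset.sum_congr rfl fun p _ => ?_
    ring
end
end
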